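/- Let (R,𝔪,k) be a complete Noetherian local domain whose residue field k is algebraically closed, and let Q ⊆ R be a prime ideal of height one. Suppose both R and R/Q have mixed characteristic. Then there exist a balanced big Cohen-Macaulay R-algebra B, a balanced big Cohen-Macaulay R/Q-algebra C, and a ring homomorphism B → C such that the square formed by R → R/Q, the structure maps R → B and R/Q → C, and B → C commutes. -/

import Mathlib

/-- A list of elements of a Noetherian local ring is a system of parameters if it consists of
elements of the maximal ideal, has length equal to the Krull dimension, and the radical of the
ideal it generates is the maximal ideal. -/
def IsSOP (R : Type*) [CommRing R] [IsLocalRing R] (xs : List R) : Prop :=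
  (∀ x ∈ xs, x ∈ IsLocalRing.maximalIdeal R) ∧
    (xs.length : WithBot ℕ∞) = ringKrullDim R ∧
    (Ideal.span {x | x ∈ xs}).radical = IsLocalRing.maximalIdeal R

/-- An `R`-algebra `B` is a balanced big Cohen-Macaulay algebra for the local ring `(R, 𝔪)` if
`𝔪 B ≠ B` and every system of parameters of `R` is a regular sequence on `B`, i.e. each
parameter is a nonzerodivisor modulo the previous ones. -/
def IsBalancedBigCM (R B : Type*) [CommRing R] [IsLocalRing R] [CommRing B] [Algebra R B] :
    Prop :=
  (IsLocalRing.maximalIdeal R).map (algebraMap R B) ≠ ⊤ ∧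
    ∀ xs : List R, IsSOP R xs → RingTheory.Sequence.IsWeaklyRegular B xs

/-- A local ring has mixed characteristic if it has characteristic zero and its residue field
has characteristic `p > 0`. -/
def MixedCharLocal (R : Type*) [CommRing R] [IsLocalRing R] : Prop :=
  CharZero R ∧ ∃ p : ℕ, 0 < p ∧ CharP (IsLocalRing.ResidueField R) p

universe u

namespace BigCM

open Ideal

/-- `zs` is a weakly regular sequence on `B ⧸ I`. -/
def WReg {B : Type*} [CommRing B] : Ideal B → List B → Prop
  | _, [] => True
  | I, z :: zs => (∀ b, z * b ∈ I → b ∈ I) ∧ WReg (I ⊔ span {z}) zs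

section WReg

variable {B : Type*} [CommRing B]

@[simp] lemma wreg_nil (I : Ideal B) : WReg I [] := trivial

lemma wreg_cons {I : Ideal B} {z : B} {zs : List B} :
    WReg I (z :: zs) ↔ (∀ b, z * b ∈ I → b ∈ I) ∧ WReg (I ⊔ span {z}) zs := Iff.rfl

lemma wreg_append {I : Ideal B} {ys zs : List B} :
    WReg I (ys ++ zs) ↔ WReg I ys ∧ WReg (I ⊔ ofList ys) zs := by
  induction ys generalizing I with
  | nil => simp
  | cons y ys ih =>
    rw [List.cons_append, wreg_cons, wreg_cons, ih, ofList_cons, ← sup_assoc, and_assoc]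

lemma mem_ofList {zs : List B} {z : B} (hz : z ∈ zs) : z ∈ ofList zs :=
  subset_span hz

lemma map_ofList' {C : Type*} [CommRing C] (f : B →+* C) (zs : List B) :
    (ofList zs).map f = ofList (zs.map f) := map_ofList f zs

lemma WReg.isWeaklyRegular {zs : List B} (h : WReg ⊥ zs) :
    RingTheory.Sequence.IsWeaklyRegular B zs := by
  refine ⟨fun i hi => ?_⟩
  have h1 : WReg ⊥ (zs.take i ++ zs.drop i) := by rwa [List.take_append_drop]
  rw [wreg_append, bot_sup_eq, List.drop_eq_getElem_cons hi, wreg_cons] at h1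
  have h2 := h1.2.1
  rw [isSMulRegular_iff_right_eq_zero_of_smul]
  intro x hx
  obtain ⟨b, rfl⟩ := Submodule.Quotient.mk_surjective _ x
  rw [← Submodule.Quotient.mk_smul, Submodule.Quotient.mk_eq_zero] at hx
  rw [Submodule.Quotient.mk_eq_zero]
  rw [smul_eq_mul, Ideal.mul_top] at *
  exact h2 b hx

lemma wreg_comap {C : Type*} [CommRing C] {f : B →+* C} (hf : Function.Surjective f)
    {I : Ideal C} {zs : List B} : WReg (I.comap f) zs ↔ WReg I (zs.map f) := by
  induction zs generalizing I with
  | nil => simp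
  | cons z zs ih =>
    have h1 : I.comap f ⊔ span {z} = (I ⊔ span {f z}).comap f := by
      apply le_antisymm
      · refine sup_le (comap_mono le_sup_left) ?_
        rw [span_singleton_le_iff_mem, mem_comap]
        exact le_sup_right (a := I) (mem_span_singleton_self _)
      · intro b hb
        rw [mem_comap, Submodule.mem_sup] at hb
        obtain ⟨i, hi, s, hs, e⟩ := hb
        obtain ⟨c, rfl⟩ := mem_span_singleton'.mp hs
        obtain ⟨c, rfl⟩ := hf c
        rw [Submodule.mem_sup]
        refine ⟨b - c * z, ?_, c * z, mul_mem_left _ _ (mem_span_singleton_self z), by ring⟩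
        rw [mem_comap, map_sub, map_mul, ← e]
        simpa using hi
    rw [List.map_cons, wreg_cons, wreg_cons, h1, ih]
    refine and_congr_left fun _ => ?_
    rw [hf.forall]
    simp

/-- If `a` is a nonzerodivisor modulo `I` and `b` is one modulo `I + (a)` then `a` is a
nonzerodivisor modulo `I + (b)`. -/
lemma nzd_sup_of_nzd {I : Ideal B} {a b : B} (ha : ∀ u, a * u ∈ I → u ∈ I)
    (hb : ∀ u, b * u ∈ I ⊔ span {a} → u ∈ I ⊔ span {a}) :
    ∀ u, a * u ∈ I ⊔ span {b} → u ∈ I ⊔ span {b} := by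
  intro u hu
  obtain ⟨i, hi, s, hs, e⟩ := Submodule.mem_sup.mp hu
  obtain ⟨v, rfl⟩ := mem_span_singleton'.mp hs
  have h1 : b * v ∈ I ⊔ span {a} := by
    rw [show b * v = -i + u * a by linear_combination e]
    exact Submodule.add_mem_sup (neg_mem hi) (mul_mem_left _ _ (mem_span_singleton_self a))
  obtain ⟨j, hj, s, hs, e'⟩ := Submodule.mem_sup.mp (hb v h1)
  obtain ⟨w, rfl⟩ := mem_span_singleton'.mp hs
  have h2 : a * (u - w * b) ∈ I := by
    rw [show a * (u - w * b) = i + j * b by linear_combination -e - b * e']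
    exact add_mem hi (mul_mem_right _ _ hj)
  rw [show u = (u - w * b) + w * b by ring]
  exact Submodule.add_mem_sup (ha _ h2) (mul_mem_left _ _ (mem_span_singleton_self b))

/-- `B ⧸ I` is derived complete along `x`. -/
def DC (I : Ideal B) (x : B) : Prop :=
  (∀ u : ℕ → B, (∀ i, u i - x * u (i + 1) ∈ I) → ∀ i, u i ∈ I) ∧
    ∀ m : ℕ → B, ∃ u : ℕ → B, ∀ i, u i - x * u (i + 1) - m i ∈ I

lemma DC.sup {I : Ideal B} {x : B} (h : DC I x) (z : B) : DC (I ⊔ span {z}) x := by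
  refine ⟨fun u hu => ?_, fun m => ?_⟩
  · have h1 : ∀ i, ∃ m : B, u i - x * u (i + 1) - m * z ∈ I := by
      intro i
      obtain ⟨j, hj, s, hs, e⟩ := Submodule.mem_sup.mp (hu i)
      obtain ⟨m, rfl⟩ := mem_span_singleton'.mp hs
      exact ⟨m, by rwa [← e, add_sub_cancel_right]⟩
    choose m hm using h1
    obtain ⟨v, hv⟩ := h.2 m
    intro i
    have := h.1 (fun i => u i - v i * z) (fun i => by
      have := sub_mem (hm i) (mul_mem_right z _ (hv i))
      convert this using 1
      ring) i
    rw [show u i = (u i - v i * z) + v i * z by ring]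
    exact Submodule.add_mem_sup this (mul_mem_left _ _ (mem_span_singleton_self z))
  · obtain ⟨u, hu⟩ := h.2 m
    exact ⟨u, fun i => le_sup_left (a := I) (hu i)⟩

lemma DC.sup_ofList {I : Ideal B} {x : B} (h : DC I x) (zs : List B) : DC (I ⊔ ofList zs) x := by
  induction zs generalizing I with
  | nil => simpa
  | cons z zs ih => rw [ofList_cons, ← sup_assoc]; exact ih (h.sup z)

lemma nzd_of_swap {I : Ideal B} {a b : B} (hdc : DC I a) (ha : ∀ u, a * u ∈ I → u ∈ I)
    (hb : ∀ u, b * u ∈ I ⊔ span {a} → u ∈ I ⊔ span {a}) : ∀ u, b * u ∈ I → u ∈ I := by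
  intro u hu
  have step : ∀ u : {u // b * u ∈ I}, ∃ v : {u // b * u ∈ I}, u.1 - a * v.1 ∈ I := by
    rintro ⟨u, hu⟩
    obtain ⟨i, hi, s, hs, e⟩ := Submodule.mem_sup.mp (hb u (le_sup_left (a := I) hu))
    obtain ⟨v, rfl⟩ := mem_span_singleton'.mp hs
    refine ⟨⟨v, ha _ ?_⟩, ?_⟩
    · rw [show a * (b * v) = b * u - b * i by rw [← e]; ring]
      exact sub_mem hu (mul_mem_left _ _ hi)
    · show u - a * v ∈ I
      rwa [← e, mul_comm a v, add_sub_cancel_right]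
  choose f hf using step
  exact hdc.1 (fun n => (f^[n] ⟨u, hu⟩).1) (fun i => by
    rw [Function.iterate_succ_apply']
    exact hf _) 0

lemma WReg.last_to_front {I : Ideal B} {zs : List B} {s : B} (h : WReg I (zs ++ [s]))
    (hdc : ∀ z ∈ zs, DC I z) : WReg I (s :: zs) := by
  induction zs generalizing I with
  | nil => simpa using h
  | cons z zs ih =>
    rw [List.cons_append, wreg_cons] at h
    obtain ⟨h1, h2⟩ := h
    obtain ⟨h3, h4⟩ := ih h2 fun y hy => (hdc y (List.mem_cons_of_mem _ hy)).sup z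
    refine ⟨nzd_of_swap (hdc z List.mem_cons_self) h1 h3, nzd_sup_of_nzd h1 h3, ?_⟩
    rwa [sup_right_comm]

lemma WReg.front_to_last {I : Ideal B} {zs : List B} {s : B} (h : WReg I (s :: zs))
    (hdc : DC I s) : WReg I (zs ++ [s]) := by
  induction zs generalizing I with
  | nil => simpa using h
  | cons z zs ih =>
    obtain ⟨h1, h2, h3⟩ := h
    refine ⟨nzd_of_swap hdc h1 h2, ih ⟨nzd_sup_of_nzd h1 h2, ?_⟩ (hdc.sup z)⟩
    rwa [sup_right_comm]

lemma WReg.replace_last {I : Ideal B} {zs : List B} {s t c : B} {N : ℕ} (h : WReg I (zs ++ [s]))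
    (ht : s ^ N - c * t ∈ I ⊔ ofList zs) : WReg I (zs ++ [t]) := by
  rw [wreg_append] at h ⊢
  refine ⟨h.1, fun u hu => ?_, trivial⟩
  have key : ∀ (N : ℕ) (u : B), s ^ N * u ∈ I ⊔ ofList zs → u ∈ I ⊔ ofList zs := by
    intro N
    induction N with
    | zero => intro u hu; simpa using hu
    | succ N ih => intro u hu; exact ih _ (h.2.1 _ (by rwa [← mul_assoc, ← pow_succ']))
  apply key N
  rw [show s ^ N * u = (s ^ N - c * t) * u + c * (t * u) by ring]
  exact add_mem (mul_mem_right _ _ ht) (mul_mem_left _ _ hu)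

end WReg

section Switch

variable {R : Type*} [CommRing R] [IsNoetherianRing R] [IsLocalRing R]

open IsLocalRing

lemma eq_maximalIdeal_of_sup_singleton {I P : Ideal R} {a s : R}
    (ha : (I ⊔ span {a}).radical = maximalIdeal R) [hP : P.IsPrime] (hI : I ≤ P) (hs : s ∈ P)
    (hmin : ∀ P₀ ∈ I.minimalPrimes, P₀ ≠ maximalIdeal R → s ∉ P₀) : P = maximalIdeal R := by
  by_contra hne
  obtain ⟨P₀, hP₀, hle⟩ := Ideal.exists_minimalPrimes_le hI
  have hP₀p := hP₀.1.1
  have hPm : P < maximalIdeal R := lt_of_le_of_ne (le_maximalIdeal hP.ne_top) hne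
  have hP₀m : P₀ ≠ maximalIdeal R := fun h => hPm.not_ge (h ▸ hle)
  have hlt : P₀ < P := lt_of_le_of_ne hle fun h => hmin P₀ hP₀ hP₀m (h ▸ hs)
  have ham : a ∈ maximalIdeal R := by
    rw [← ha]; exact le_radical (le_sup_right (a := I) (mem_span_singleton_self a))
  have hmem : maximalIdeal R ∈ (P₀ ⊔ span {a}).minimalPrimes := by
    refine ⟨⟨inferInstance, sup_le (hlt.le.trans hPm.le) ?_⟩, fun J hJ _ => ?_⟩
    · rwa [span_singleton_le_iff_mem]
    · rw [← ha]
      exact hJ.1.radical_le_iff.mpr ((sup_le_sup_right hP₀.1.2 _).trans hJ.2)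
  have h1 := Ideal.map_height_le_one_of_mem_minimalPrimes hmem
  have hk : ∀ {J : Ideal R}, P₀ ≤ J → (J.map (Ideal.Quotient.mk P₀)).comap (Ideal.Quotient.mk P₀)
      = J := fun {J} hJ => by
    rw [comap_map_of_surjective' _ Ideal.Quotient.mk_surjective, Ideal.mk_ker, sup_eq_left]
    exact hJ
  have hp1 : (P.map (Ideal.Quotient.mk P₀)).IsPrime :=
    isPrime_map_quotientMk_of_isPrime hlt.le
  have hp2 : ((maximalIdeal R).map (Ideal.Quotient.mk P₀)).IsPrime :=
    isPrime_map_quotientMk_of_isPrime (hlt.le.trans hPm.le)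
  have h2 : P.map (Ideal.Quotient.mk P₀) < (maximalIdeal R).map (Ideal.Quotient.mk P₀) := by
    refine lt_of_le_of_ne (map_mono hPm.le) fun h => hPm.ne ?_
    rw [← hk hlt.le, h, hk (hlt.le.trans hPm.le)]
  have h3 : P.map (Ideal.Quotient.mk P₀) ≠ ⊥ := by
    intro h
    have h4 := hk hlt.le
    rw [h, ← RingHom.ker_eq_comap_bot, Ideal.mk_ker] at h4
    exact hlt.ne h4
  rw [← Nat.cast_one (R := ℕ∞), Ideal.height_le_iff] at h1
  have h4 := h1 _ hp1 h2
  rw [Nat.cast_one, Order.lt_one_iff, Ideal.height_eq_zero_iff] at h4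
  rw [IsDomain.minimalPrimes_eq_singleton_bot] at h4
  exact h3 h4

lemma exists_common_parameter {I J : Ideal R} {a b : R}
    (ha : (I ⊔ span {a}).radical = maximalIdeal R)
    (hb : (J ⊔ span {b}).radical = maximalIdeal R) :
    ∃ s, (I ⊔ span {s}).radical = maximalIdeal R ∧ (J ⊔ span {s}).radical = maximalIdeal R := by
  have hfin : ({P | P ∈ I.minimalPrimes ∪ J.minimalPrimes ∧ P ≠ maximalIdeal R}).Finite :=
    ((finite_minimalPrimes_of_isNoetherianRing R I).union
      (finite_minimalPrimes_of_isNoetherianRing R J)).subset fun P hP => hP.1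
  have hnot : ¬ ((maximalIdeal R : Set R) ⊆
      ⋃ P ∈ {P | P ∈ I.minimalPrimes ∪ J.minimalPrimes ∧ P ≠ maximalIdeal R}, (P : Set R)) := by
    rw [Ideal.subset_union_prime_finite hfin ⊥ ⊥]
    · rintro ⟨P, hP, hle⟩
      have hPp : P.IsPrime := by
        rcases hP.1 with h | h <;> exact h.1.1
      exact hP.2 (le_antisymm (le_maximalIdeal hPp.ne_top) hle)
    · intro P hP _ _
      rcases hP.1 with h | h <;> exact h.1.1
  obtain ⟨s, hs, hs'⟩ := Set.not_subset.mp hnot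
  simp only [Set.mem_iUnion, not_exists] at hs'
  have key : ∀ {I : Ideal R} {a : R}, (I ⊔ span {a}).radical = maximalIdeal R →
      (∀ P₀ ∈ I.minimalPrimes, P₀ ≠ maximalIdeal R → s ∉ P₀) →
      (I ⊔ span {s}).radical = maximalIdeal R := by
    intro I a ha h
    have hI : I ≤ maximalIdeal R := le_sup_left.trans (le_radical.trans ha.le)
    rw [radical_eq_sInf]
    apply le_antisymm
    · exact sInf_le ⟨sup_le hI ((span_singleton_le_iff_mem _).mpr hs), inferInstance⟩
    · refine le_sInf fun P ⟨hP, hPp⟩ => ?_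
      exact (eq_maximalIdeal_of_sup_singleton ha (le_sup_left.trans hP)
        (hP (le_sup_right (a := I) (mem_span_singleton_self s))) h).ge
  exact ⟨s, key ha fun P hP hne h => hs' P ⟨Or.inl hP, hne⟩ h,
    key hb fun P hP hne h => hs' P ⟨Or.inr hP, hne⟩ h⟩

theorem WReg.switch {B : Type*} [CommRing B] (φ : R →+* B) (m : ℕ) :
    ∀ (v w : List R) (a : Ideal R) (I : Ideal B), v.length = m → w.length = m →
      (a ⊔ ofList v).radical = maximalIdeal R → (a ⊔ ofList w).radical = maximalIdeal R →
      a.map φ ≤ I → (∀ x ∈ maximalIdeal R, DC I (φ x)) → WReg I (v.map φ) →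
      WReg I (w.map φ) := by
  induction m with
  | zero =>
    intro v w a I hv hw
    rw [List.length_eq_zero_iff] at hv hw
    subst hv hw
    simp
  | succ m ih =>
    intro v w a I hv hw hrv hrw haI hdc hreg
    have split : ∀ l : List R, l.length = m + 1 → ∃ l' y, l = l' ++ [y] ∧ l'.length = m := by
      intro l hl
      have hne : l ≠ [] := by rintro rfl; simp at hl
      exact ⟨l.dropLast, l.getLast hne, (List.dropLast_append_getLast hne).symm, by simp [hl]⟩
    obtain ⟨v, y, rfl, hv'⟩ := split v hv
    obtain ⟨w, z, rfl, hw'⟩ := split w hw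
    rw [ofList_append, ofList_singleton, ← sup_assoc] at hrv hrw
    obtain ⟨s, hsv, hsw⟩ := exists_common_parameter hrv hrw
    have hsm : s ∈ maximalIdeal R := by
      rw [← hsv]; exact le_radical (le_sup_right (a := a ⊔ ofList v) (mem_span_singleton_self s))
    have hvm : ∀ x ∈ v, x ∈ maximalIdeal R := fun x hx => by
      rw [← hsv]
      exact le_radical (le_sup_left (b := span {s}) (le_sup_right (a := a) (mem_ofList hx)))
    have pow_mem : ∀ {l : List R} {x t : R}, x ∈ maximalIdeal R →
        (a ⊔ ofList l ⊔ span {t}).radical = maximalIdeal R →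
        ∃ (N : ℕ) (c : B), φ x ^ N - c * φ t ∈ I ⊔ ofList (l.map φ) := by
      intro l x t hx ht
      rw [← ht] at hx
      obtain ⟨N, hN⟩ := hx
      obtain ⟨i, hi, q, hq, e⟩ := Submodule.mem_sup.mp hN
      obtain ⟨c, rfl⟩ := mem_span_singleton'.mp hq
      refine ⟨N, φ c, ?_⟩
      rw [← map_pow, ← map_mul, ← map_sub, ← e, add_sub_cancel_right]
      have h1 := mem_map_of_mem φ hi
      rw [Ideal.map_sup, map_ofList'] at h1
      exact sup_le_sup_right haI _ h1
    have hy : y ∈ maximalIdeal R := by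
      rw [← hrv]; exact le_radical (le_sup_right (a := a ⊔ ofList v) (mem_span_singleton_self y))
    obtain ⟨N, c, h1⟩ := pow_mem hy hsv
    rw [List.map_append, List.map_singleton] at hreg ⊢
    have h2 := (hreg.replace_last h1).last_to_front fun x hx => by
      obtain ⟨x', hx', rfl⟩ := List.mem_map.mp hx
      exact hdc x' (hvm x' hx')
    have h3 : WReg I (φ s :: w.map φ) := by
      refine ⟨h2.1, ih v w (a ⊔ span {s}) (I ⊔ span {φ s}) hv' hw' ?_ ?_ ?_ ?_ h2.2⟩
      · rwa [sup_right_comm]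
      · rwa [sup_right_comm]
      · rw [Ideal.map_sup, Ideal.map_span, Set.image_singleton]
        exact sup_le_sup_right haI _
      · exact fun x hx => (hdc x hx).sup _
    obtain ⟨N, c, h4⟩ := pow_mem hsm hrw
    exact (h3.front_to_last (hdc s hsm)).replace_last h4

end Switch

end BigCM

namespace BigCM

open Ideal

section DCArith

variable {B : Type*} [CommRing B]

lemma dc_bot_iff {x : B} : DC (⊥ : Ideal B) x ↔
    (∀ u : ℕ → B, (∀ i, u i = x * u (i + 1)) → ∀ i, u i = 0) ∧
      ∀ m : ℕ → B, ∃ u : ℕ → B, ∀ i, u i = m i + x * u (i + 1) := by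
  simp only [DC, Ideal.mem_bot, sub_eq_zero]
  refine and_congr_right fun _ => forall_congr' fun m => exists_congr fun u => forall_congr' fun i => ?_
  exact sub_eq_iff_eq_add

lemma DC.exists_sum {x : B} (h : DC (⊥ : Ideal B) x) : ∃ S : (ℕ → B) →ₗ[B] B,
    ∀ m, S m = m 0 + x * S (fun i => m (i + 1)) := by
  rw [dc_bot_iff] at h
  obtain ⟨h1, h2⟩ := h
  choose U hU using h2
  have uniq : ∀ (m u : ℕ → B), (∀ i, u i = m i + x * u (i + 1)) → u = U m := by
    intro m u hu
    funext i
    refine sub_eq_zero.mp (h1 (fun i => u i - U m i) (fun i => ?_) i)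
    rw [hu i, hU m i]; ring
  refine ⟨{ toFun := fun m => U m 0, map_add' := fun m m' => ?_, map_smul' := fun a m => ?_ },
    fun m => ?_⟩
  · rw [← uniq (m + m') (U m + U m') fun i => ?_]
    · rfl
    · simp only [Pi.add_apply]
      rw [hU m i, hU m' i]; ring
  · rw [← uniq (a • m) (a • U m) fun i => ?_]
    · rfl
    · simp only [Pi.smul_apply, smul_eq_mul]
      rw [hU m i]; ring
  · show U m 0 = m 0 + x * U (fun i => m (i + 1)) 0
    rw [← uniq (fun i => m (i + 1)) (fun i => U m (i + 1)) fun i => hU m (i + 1)]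
    exact hU m 0

lemma DC.sum_sub {x : B} (h : DC (⊥ : Ideal B) x) {S : (ℕ → B) →ₗ[B] B}
    (hS : ∀ m, S m = m 0 + x * S (fun i => m (i + 1))) (a : ℕ → B) :
    S (fun i => a i - x * a (i + 1)) = a 0 := by
  rw [dc_bot_iff] at h
  have key : ∀ j, S (fun i => a (j + i) - x * a (j + i + 1)) - a j =
      x * (S (fun i => a (j + 1 + i) - x * a (j + 1 + i + 1)) - a (j + 1)) := by
    intro j
    rw [hS]
    have : (fun i => a (j + (i + 1)) - x * a (j + (i + 1) + 1)) =
        fun i => a (j + 1 + i) - x * a (j + 1 + i + 1) := by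
      funext i
      rw [show j + (i + 1) = j + 1 + i by ring]
    simp only [this, add_zero]
    ring
  have e := h.1 (fun j => S (fun i => a (j + i) - x * a (j + i + 1)) - a j) key 0
  simpa [sub_eq_zero] using e

lemma dc_of_sum {x : B} (h1 : ∀ u : ℕ → B, (∀ i, u i = x * u (i + 1)) → u 0 = 0)
    (T : (ℕ → B) → B) (hT : ∀ m, T m = m 0 + x * T (fun i => m (i + 1))) :
    DC (⊥ : Ideal B) x := by
  rw [dc_bot_iff]
  refine ⟨fun u hu i => ?_, fun m => ⟨fun i => T (fun j => m (i + j)), fun i => ?_⟩⟩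
  · simpa using h1 (fun j => u (i + j)) fun j => hu (i + j)
  · show T (fun j => m (i + j)) = m i + x * T (fun j => m (i + 1 + j))
    rw [hT]
    have : (fun j => m (i + (j + 1))) = fun j => m (i + 1 + j) := by
      funext j
      rw [show i + (j + 1) = i + 1 + j by ring]
    simp only [this, add_zero]

lemma DC.const_mul {x : B} (h : DC (⊥ : Ideal B) x) (a : B) : DC (⊥ : Ideal B) (a * x) := by
  obtain ⟨S, hS⟩ := h.exists_sum
  refine dc_of_sum (fun u hu => ?_) (fun m => S (fun i => a ^ i * m i)) fun m => ?_
  · rw [dc_bot_iff] at h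
    have := h.1 (fun i => a ^ i * u i) (fun i => by rw [hu i]; ring) 0
    simpa using this
  · rw [hS]
    have : (fun i => a ^ (i + 1) * m (i + 1)) = a • fun i => a ^ i * m (i + 1) := by
      funext i; simp only [Pi.smul_apply, smul_eq_mul]; ring
    rw [this, map_smul, smul_eq_mul]; ring

lemma DC.of_pow {x : B} {N : ℕ} (h : DC (⊥ : Ideal B) (x ^ N)) :
    DC (⊥ : Ideal B) x := by
  obtain ⟨S, hS⟩ := h.exists_sum
  refine dc_of_sum (fun u hu => ?_)
    (fun m => S (fun q => ∑ r ∈ Finset.range N, x ^ r * m (N * q + r))) fun m => ?_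
  · have key : ∀ k i, u i = x ^ k * u (i + k) := by
      intro k
      induction k with
      | zero => simp
      | succ k ih => intro i; rw [ih, hu (i + k)]; ring_nf
    rw [dc_bot_iff] at h
    have := h.1 (fun i => u (N * i)) (fun i => by rw [key N (N * i)]; ring_nf) 0
    simpa using this
  · have e1 : x * S (fun q => ∑ r ∈ Finset.range N, x ^ r * m (N * q + r + 1)) =
        S (fun q => ∑ r ∈ Finset.range N, x ^ (r + 1) * m (N * q + (r + 1))) := by
      rw [← smul_eq_mul, ← map_smul]
      congr 1
      funext q
      simp only [Pi.smul_apply, smul_eq_mul, Finset.mul_sum]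
      refine Finset.sum_congr rfl fun r _ => ?_
      rw [add_assoc]; ring
    rw [e1, ← sub_eq_iff_eq_add, ← map_sub]
    have := h.sum_sub hS (fun q => m (N * q))
    rw [mul_zero] at this
    rw [← this]
    congr 1
    funext q
    have h2 := Finset.sum_range_succ (fun r => x ^ r * m (N * q + r)) N
    have h3 := Finset.sum_range_succ' (fun r => x ^ r * m (N * q + r)) N
    simp only [Pi.sub_apply]
    rw [h2] at h3
    simp only [pow_zero, one_mul, add_zero] at h3
    rw [mul_add, mul_one]
    linear_combination h3

lemma DC.add {x y : B} (hx : DC (⊥ : Ideal B) x) (hy : DC (⊥ : Ideal B) y) :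
    DC (⊥ : Ideal B) (x + y) := by
  obtain ⟨S, hS⟩ := hx.exists_sum
  obtain ⟨T, hT⟩ := hy.exists_sum
  refine dc_of_sum (fun u hu => ?_)
    (fun m => S fun j => T fun k => ((j + k).choose j : B) * m (j + k)) fun m => ?_
  · have step : ∀ u : {u : ℕ → B // ∀ i, u i = (x + y) * u (i + 1)},
        ∃ v : {u : ℕ → B // ∀ i, u i = (x + y) * u (i + 1)}, ∀ i, u.1 i = y * v.1 i := by
      rintro ⟨u, hu⟩
      have hmul : ∀ i, (x + y) * S (fun k => u (i + k + 1)) = S (fun k => u (i + k)) := by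
        intro i
        rw [← smul_eq_mul, ← map_smul]
        congr 1
        funext k
        exact (hu (i + k)).symm
      refine ⟨⟨fun i => S (fun k => u (i + k + 1)), fun i => ?_⟩, fun i => ?_⟩
      · have := hmul (i + 1)
        simp only [add_right_comm i 1] at this
        simp only [add_right_comm i 1]
        exact this.symm
      · have := hmul i
        rw [hS (fun k => u (i + k))] at this
        simp only [add_zero, ← add_assoc] at this
        linear_combination -this
    choose f hf using step
    rw [dc_bot_iff] at hy
    exact hy.1 (fun n => (f^[n] ⟨u, hu⟩).1 0) (fun i => by
      rw [Function.iterate_succ_apply']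
      exact hf _ 0) 0
  · set D : (ℕ → ℕ → B) → B := fun c => S fun j => T (c j) with hD
    have hadd : ∀ c c', D (c + c') = D c + D c' := by
      intro c c'
      simp only [hD]
      rw [← map_add]
      congr 1
      funext j
      simp
    have hDx : ∀ c, D c = T (c 0) + x * D (fun j => c (j + 1)) := fun c => hS _
    have hDy : ∀ c, D c = S (fun j => c j 0) + y * D (fun j k => c j (k + 1)) := by
      intro c
      simp only [hD]
      rw [← smul_eq_mul, ← map_smul, ← map_add]
      congr 1
      funext j
      rw [hT]
      rfl
    have hzero : D 0 = 0 := by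
      have := hadd 0 0
      simpa using this
    have e1 : x * D (fun j k => ((j + k).choose j : B) * m (j + k + 1)) =
        D (fun j k => Nat.casesOn j 0 fun j => ((j + k).choose j : B) * m (j + k + 1)) := by
      rw [hDx (fun j k => Nat.casesOn j 0 fun j => ((j + k).choose j : B) * m (j + k + 1))]
      have : T (fun _ => 0) = 0 := T.map_zero
      simp [this]
    have e2 : y * D (fun j k => ((j + k).choose j : B) * m (j + k + 1)) =
        D (fun j k => Nat.casesOn k 0 fun k => ((j + k).choose j : B) * m (j + k + 1)) := by
      rw [hDy (fun j k => Nat.casesOn k 0 fun k => ((j + k).choose j : B) * m (j + k + 1))]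
      have : S (fun _ => 0) = 0 := S.map_zero
      simp [this]
    have e3 : D (fun j k => if j = 0 ∧ k = 0 then m 0 else 0) = m 0 := by
      rw [hDx, hT]
      have h1 : T (fun _ => 0) = 0 := T.map_zero
      have h2 : D (fun _ _ => 0) = 0 := hzero
      simp [h1, h2]
    change D (fun j k => ((j + k).choose j : B) * m (j + k)) =
      m 0 + (x + y) * D (fun j k => ((j + k).choose j : B) * m (j + k + 1))
    rw [add_mul, e1, e2, ← e3, ← hadd, ← hadd]
    congr 1
    funext j k
    simp only [Pi.add_apply]
    rcases j with _ | j <;> rcases k with _ | k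
    · simp
    · simp
    · simp
    · simp only [Nat.add_eq_zero_iff, one_ne_zero, and_false, if_false, zero_add]
      have : ((j + 1 + (k + 1)).choose (j + 1) : B) =
          ((j + (k + 1)).choose j : B) + ((j + 1 + k).choose (j + 1) : B) := by
        rw [← Nat.cast_add]
        congr 1
        rw [show j + 1 + (k + 1) = (j + (k + 1)) + 1 by ring, Nat.choose_succ_succ]
        congr 2
        ring
      rw [this, add_mul, show j + (k + 1) + 1 = j + 1 + (k + 1) by ring,
        show j + 1 + k + 1 = j + 1 + (k + 1) by ring]

lemma dc_zero : DC (⊥ : Ideal B) 0 :=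
  dc_bot_iff.mpr ⟨fun u hu i => by simpa using hu i, fun m => ⟨m, by simp⟩⟩

/-- The elements along which a ring is derived complete form a radical ideal. -/
lemma DC.of_mem_radical {R : Type*} [CommRing R] (φ : R →+* B) {zs : List R}
    (h : ∀ z ∈ zs, DC (⊥ : Ideal B) (φ z)) {x : R} (hx : x ∈ (ofList zs).radical) :
    DC (⊥ : Ideal B) (φ x) := by
  obtain ⟨N, hN⟩ := hx
  have hmem : ∀ y ∈ ofList zs, DC (⊥ : Ideal B) (φ y) := by
    intro y hy
    refine Submodule.span_induction (fun z hz => h z hz) ?_ (fun a b _ _ ha hb => ?_)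
      (fun a b _ hb => ?_) hy
    · rw [map_zero]; exact dc_zero
    · rw [map_add]; exact ha.add hb
    · rw [smul_eq_mul, map_mul]; exact hb.const_mul _
  have h1 := hmem _ (show x ^ (N + 1) ∈ ofList zs by rw [pow_succ]; exact mul_mem_right _ _ hN)
  rw [map_pow] at h1
  exact h1.of_pow

end DCArith

end BigCM

namespace BigCM

open Ideal PowerSeries

section Completion

variable {B : Type*} [CommRing B]

/-- The ideal of power series with coefficients in `I`. -/
noncomputable def coefIdeal (I : Ideal B) : Ideal B⟦X⟧ :=
  RingHom.ker (PowerSeries.map (Ideal.Quotient.mk I))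

lemma mem_coefIdeal {I : Ideal B} {f : B⟦X⟧} : f ∈ coefIdeal I ↔ ∀ n, coeff n f ∈ I := by
  rw [coefIdeal, RingHom.mem_ker, PowerSeries.ext_iff]
  simp [Ideal.Quotient.eq_zero_iff_mem]

lemma coefIdeal_bot : coefIdeal (⊥ : Ideal B) = ⊥ := by
  ext f
  rw [mem_coefIdeal, Ideal.mem_bot, PowerSeries.ext_iff]
  simp

lemma coefIdeal_sup_singleton (I : Ideal B) (a : B) :
    coefIdeal (I ⊔ span {a}) = coefIdeal I ⊔ span {C a} := by
  apply le_antisymm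
  · intro f hf
    rw [mem_coefIdeal] at hf
    have h : ∀ n, ∃ b, coeff n f - b * a ∈ I := by
      intro n
      obtain ⟨j, hj, s, hs, e⟩ := Submodule.mem_sup.mp (hf n)
      obtain ⟨b, rfl⟩ := mem_span_singleton'.mp hs
      exact ⟨b, by rwa [← e, add_sub_cancel_right]⟩
    choose b hb using h
    rw [← sub_add_cancel f (PowerSeries.mk b * C a)]
    refine Submodule.add_mem_sup (mem_coefIdeal.mpr fun n => ?_)
      (mul_mem_left _ _ (mem_span_singleton_self _))
    rw [map_sub, coeff_mul_C, coeff_mk]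
    exact hb n
  · refine sup_le (fun f hf => mem_coefIdeal.mpr fun n =>
      le_sup_left (a := I) (mem_coefIdeal.mp hf n)) ?_
    rw [span_singleton_le_iff_mem, mem_coefIdeal]
    intro n
    rw [coeff_C]
    split_ifs
    · exact le_sup_right (a := I) (mem_span_singleton_self _)
    · exact zero_mem _

lemma X_sub_C_nzd {I : Ideal B} {z : B} (hz : (∀ b, z * b ∈ I → b ∈ I) ∨ z ∈ I) :
    ∀ f : B⟦X⟧, (X - C z) * f ∈ coefIdeal I → f ∈ coefIdeal I := by
  intro f hf
  rw [mem_coefIdeal] at hf ⊢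
  rcases hz with hz | hz
  · intro n
    induction n with
    | zero =>
      have := hf 0
      rw [sub_mul, map_sub, coeff_zero_X_mul, coeff_C_mul, zero_sub, neg_mem_iff] at this
      exact hz _ this
    | succ n ih =>
      have := hf (n + 1)
      rw [sub_mul, map_sub, coeff_succ_X_mul, coeff_C_mul] at this
      exact hz _ (by simpa using sub_mem ih this)
  · intro n
    have := hf (n + 1)
    rw [sub_mul, map_sub, coeff_succ_X_mul, coeff_C_mul] at this
    simpa using add_mem this (mul_mem_right (coeff (n + 1) f) I hz)

lemma WReg.coefIdeal_sup {z : B} {zs : List B} {I : Ideal B}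
    (hz : ∀ l l', zs = l ++ l' → l ≠ [] →
      (∀ b, z * b ∈ I ⊔ ofList l → b ∈ I ⊔ ofList l) ∨ z ∈ I ⊔ ofList l)
    (h : WReg I zs) : WReg (coefIdeal I ⊔ span {X - C z}) (zs.map C) := by
  induction zs generalizing I with
  | nil => trivial
  | cons a zs ih =>
    obtain ⟨h1, h2⟩ := h
    refine ⟨nzd_sup_of_nzd (fun f hf => ?_) ?_, ?_⟩
    · rw [mem_coefIdeal] at hf ⊢
      exact fun n => h1 _ (by simpa using hf n)
    · rw [← coefIdeal_sup_singleton]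
      refine X_sub_C_nzd ?_
      have := hz [a] zs rfl (by simp)
      rwa [ofList_singleton] at this
    · rw [sup_right_comm, ← coefIdeal_sup_singleton]
      refine ih (fun l l' e hl => ?_) h2
      have := hz (a :: l) l' (by rw [e]; rfl) (by simp)
      rwa [ofList_cons, ← sup_assoc] at this

lemma dc_C {x : B} (h : DC (⊥ : Ideal B) x) : DC (⊥ : Ideal B⟦X⟧) (C x) := by
  rw [dc_bot_iff] at h ⊢
  refine ⟨fun u hu i => ?_, fun m => ?_⟩
  · ext n
    exact h.1 (fun i => coeff n (u i)) (fun i => by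
      conv_lhs => rw [hu i]
      rw [coeff_C_mul]) i
  · choose u hu using fun n => h.2 fun i => coeff n (m i)
    refine ⟨fun i => PowerSeries.mk fun n => u n i, fun i => ?_⟩
    ext n
    rw [map_add, coeff_C_mul, coeff_mk, coeff_mk, hu n i]

lemma dc_X : DC (⊥ : Ideal B⟦X⟧) X := by
  refine dc_of_sum (fun u hu => ?_)
    (fun m => PowerSeries.mk fun n => ∑ k ∈ Finset.range (n + 1), coeff (n - k) (m k)) fun m => ?_
  · have : ∀ n i, coeff n (u i) = 0 := by
      intro n
      induction n with
      | zero => intro i; rw [hu i, coeff_zero_X_mul]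
      | succ n ih => intro i; rw [hu i, coeff_succ_X_mul, ih]
    ext n
    simpa using this n 0
  · ext n
    rcases n with _ | n
    · simp
    · rw [map_add, coeff_succ_X_mul, coeff_mk, coeff_mk, Finset.sum_range_succ', add_comm]
      simp

lemma DC.quotient {J : Ideal B} {x : B} (h : DC J x) :
    DC (⊥ : Ideal (B ⧸ J)) (Ideal.Quotient.mk J x) := by
  rw [dc_bot_iff]
  have lift : ∀ m : ℕ → B ⧸ J, ∃ m' : ℕ → B, ∀ i, Ideal.Quotient.mk J (m' i) = m i := fun m =>
    ⟨fun i => (Ideal.Quotient.mk_surjective (m i)).choose,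
      fun i => (Ideal.Quotient.mk_surjective (m i)).choose_spec⟩
  refine ⟨fun u hu i => ?_, fun m => ?_⟩
  · obtain ⟨v, hv⟩ := lift u
    rw [← hv i, Ideal.Quotient.eq_zero_iff_mem]
    refine h.1 v (fun i => ?_) i
    rw [← Ideal.Quotient.eq_zero_iff_mem, map_sub, map_mul, hv, hv, ← hu i, sub_self]
  · obtain ⟨v, hv⟩ := lift m
    obtain ⟨u, hu⟩ := h.2 v
    refine ⟨fun i => Ideal.Quotient.mk J (u i), fun i => ?_⟩
    have := hu i
    rw [← Ideal.Quotient.eq_zero_iff_mem, map_sub, map_sub, map_mul, hv] at this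
    linear_combination this

/-- The derived completion of `B` along `z` (in good cases). -/
abbrev Compl (z : B) : Type _ := B⟦X⟧ ⧸ span {(X : B⟦X⟧) - C z}

/-- The canonical map to `Compl z`. -/
noncomputable def complMk (z : B) : B →+* Compl z := (Ideal.Quotient.mk _).comp C

lemma dc_complMk_self (z : B) : DC (⊥ : Ideal (Compl z)) (complMk z z) := by
  have h1 : complMk z z = Ideal.Quotient.mk _ (X : B⟦X⟧) := by
    rw [eq_comm, complMk, RingHom.comp_apply, Ideal.Quotient.mk_eq_mk_iff_sub_mem]
    exact mem_span_singleton_self _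
  rw [h1]
  refine DC.quotient ?_
  simpa using (dc_X (B := B)).sup (X - C z)

lemma dc_complMk {x : B} (h : DC (⊥ : Ideal B) x) (z : B) :
    DC (⊥ : Ideal (Compl z)) (complMk z x) := by
  refine DC.quotient ?_
  simpa using (dc_C h).sup (X - C z)

lemma wreg_complMk {z : B} {zs : List B}
    (hz : ∀ l l', zs = l ++ l' → l ≠ [] → (∀ b, z * b ∈ ofList l → b ∈ ofList l) ∨ z ∈ ofList l)
    (h : WReg ⊥ zs) : WReg ⊥ (zs.map (complMk z)) := by
  have h1 := WReg.coefIdeal_sup (I := ⊥) (z := z) (by simpa using hz) h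
  rw [coefIdeal_bot, bot_sup_eq] at h1
  rw [show zs.map (complMk z) = (zs.map C).map (Ideal.Quotient.mk (span {X - C z})) by
    simp [complMk], ← wreg_comap Ideal.Quotient.mk_surjective, ← RingHom.ker_eq_comap_bot,
    Ideal.mk_ker]
  exact h1

lemma map_complMk_ne_top {z : B} {J : Ideal B} (hJ : J ≠ ⊤) (hz : z ∈ J) :
    J.map (complMk z) ≠ ⊤ := by
  let f : Compl z →+* B ⧸ J := Ideal.Quotient.lift _
    ((Ideal.Quotient.mk J).comp constantCoeff) (by
      intro a ha
      obtain ⟨b, rfl⟩ := mem_span_singleton'.mp ha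
      simp [Ideal.Quotient.eq_zero_iff_mem.mpr hz])
  intro h
  have h1 : J.map (complMk z) ≤ RingHom.ker f := by
    rw [Ideal.map_le_iff_le_comap]
    intro b hb
    rw [mem_comap, RingHom.mem_ker]
    show Ideal.Quotient.mk J (constantCoeff (C b)) = 0
    simpa [Ideal.Quotient.eq_zero_iff_mem] using hb
  have h2 : f 1 = 0 := h1 (h ▸ Submodule.mem_top)
  rw [map_one, ← map_one (Ideal.Quotient.mk J), Ideal.Quotient.eq_zero_iff_mem] at h2
  exact hJ ((eq_top_iff_one J).mpr h2)

/-- Functoriality of `Compl`. -/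
noncomputable def complMap {C' : Type*} [CommRing C'] (g : B →+* C') (z : B) :
    Compl z →+* Compl (g z) :=
  Ideal.quotientMap _ (PowerSeries.map g) (by
    rw [span_singleton_le_iff_mem, mem_comap]
    simp)

lemma complMap_complMk {C' : Type*} [CommRing C'] (g : B →+* C') (z b : B) :
    complMap g z (complMk z b) = complMk (g z) (g b) := by
  simp [complMap, complMk]

/-- Prefix condition for the next element of a regular sequence. -/
lemma condition_of_initial_segment {zs₁ zs₂ : List B} {z : B} (h : WReg ⊥ (zs₁ ++ z :: zs₂))
    (hdc : ∀ y ∈ zs₁, DC (⊥ : Ideal B) y) : ∀ l l', zs₁ ++ z :: zs₂ = l ++ l' → l ≠ [] →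
      (∀ b, z * b ∈ ofList l → b ∈ ofList l) ∨ z ∈ ofList l := by
  intro l l' e _
  rcases List.append_eq_append_iff.mp e with ⟨k, rfl, e2⟩ | ⟨k, rfl, e2⟩
  · rcases k with _ | ⟨y, k⟩
    · left
      rw [wreg_append, bot_sup_eq] at h
      simpa using h.2.1
    · right
      rw [List.cons_append, List.cons.injEq] at e2
      exact mem_ofList (by simp [e2.1])
  · left
    rw [show l ++ k ++ z :: zs₂ = l ++ ((k ++ [z]) ++ zs₂) by simp, wreg_append, wreg_append,
      bot_sup_eq] at h
    refine (h.2.1.last_to_front fun y hy => ?_).1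
    have := (hdc y (List.mem_append_right _ hy)).sup_ofList l
    rwa [bot_sup_eq] at this

end Completion

theorem exists_completion {A : Type*} (zs₂ : List A) : ∀ (zs₁ : List A) (s : A) (B C : Type u)
    [CommRing B] [CommRing C] (β : A → B) (g : B →+* C),
    WReg ⊥ (((zs₁ ++ zs₂) ++ [s]).map β) → WReg ⊥ ((zs₁ ++ zs₂).map (g ∘ β)) → g (β s) = 0 →
    ofList ((zs₁ ++ zs₂).map (g ∘ β)) ≠ ⊤ →
    (∀ z ∈ zs₁, DC ⊥ (β z)) → (∀ z ∈ zs₁, DC ⊥ (g (β z))) →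
    ∃ (B' C' : Type u) (_ : CommRing B') (_ : CommRing C') (ι : B →+* B') (κ : C →+* C')
      (g' : B' →+* C'), (∀ b, g' (ι b) = κ (g b)) ∧
      WReg ⊥ (((zs₁ ++ zs₂) ++ [s]).map (ι ∘ β)) ∧ WReg ⊥ ((zs₁ ++ zs₂).map (κ ∘ g ∘ β)) ∧
      ofList ((zs₁ ++ zs₂).map (κ ∘ g ∘ β)) ≠ ⊤ ∧
      (∀ z ∈ (zs₁ ++ zs₂) ++ [s], DC ⊥ (ι (β z))) ∧
      (∀ z ∈ zs₁ ++ zs₂, DC ⊥ (κ (g (β z)))) := by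
  induction zs₂ with
  | nil =>
    intro zs₁ s B C _ _ β g hB hC hs htop hdB hdC
    simp only [List.append_nil] at *
    refine ⟨Compl (β s), Compl (g (β s)), inferInstance, inferInstance, complMk _, complMk _,
      complMap g _, complMap_complMk g _, ?_, ?_, ?_, ?_, ?_⟩
    · rw [← List.map_map]
      refine wreg_complMk ?_ hB
      rw [List.map_append] at hB ⊢
      exact condition_of_initial_segment hB (by simpa using hdB)
    · rw [← List.map_map]
      refine wreg_complMk (fun l l' _ _ => Or.inr ?_) hC
      rw [hs]; exact zero_mem _
    · rw [← List.map_map, ← map_ofList']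
      exact map_complMk_ne_top htop (by rw [hs]; exact zero_mem _)
    · intro z hz
      rcases List.mem_append.mp hz with hz | hz
      · exact dc_complMk (hdB z hz) _
      · rw [List.mem_singleton.mp hz]
        exact dc_complMk_self _
    · exact fun z hz => dc_complMk (hdC z hz) _
  | cons y zs₂ ih =>
    intro zs₁ s B C _ _ β g hB hC hs htop hdB hdC
    have hBw : WReg ⊥ (((zs₁ ++ y :: zs₂) ++ [s]).map (complMk (β y) ∘ β)) := by
      rw [← List.map_map]
      refine wreg_complMk ?_ hB
      rw [List.append_assoc, List.cons_append, List.map_append, List.map_cons] at hB ⊢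
      exact condition_of_initial_segment hB (by simpa using hdB)
    have hCw : WReg ⊥ ((zs₁ ++ y :: zs₂).map (complMk (g (β y)) ∘ (g ∘ β))) := by
      rw [← List.map_map]
      refine wreg_complMk ?_ hC
      rw [List.map_append, List.map_cons] at hC ⊢
      exact condition_of_initial_segment hC (by simpa using hdC)
    have e : (zs₁ ++ y :: zs₂) = (zs₁ ++ [y]) ++ zs₂ := by simp
    have hg : ∀ b, complMap g (β y) (complMk (β y) b) = complMk (g (β y)) (g b) :=
      complMap_complMk g _
    have hCfun : (complMap g (β y)) ∘ (complMk (β y) ∘ β) = complMk (g (β y)) ∘ (g ∘ β) := by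
      funext a; exact hg _
    obtain ⟨B', C', i1, i2, ι, κ, g', h1, h2, h3, h4, h5, h6⟩ :=
      ih (zs₁ ++ [y]) s (Compl (β y)) (Compl (g (β y))) (complMk (β y) ∘ β) (complMap g (β y))
        (by rw [← e]; exact hBw) (by rw [hCfun, ← e]; exact hCw)
        (by simp only [Function.comp_apply]; rw [hg, hs, map_zero])
        (by
          rw [hCfun, ← e, ← List.map_map, ← map_ofList']
          refine map_complMk_ne_top htop (mem_ofList ?_)
          simp)
        (by
          intro z hz
          rcases List.mem_append.mp hz with hz | hz
          · exact dc_complMk (hdB z hz) _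
          · rw [List.mem_singleton.mp hz]
            exact dc_complMk_self _)
        (by
          intro z hz
          simp only [Function.comp_apply, hg]
          rcases List.mem_append.mp hz with hz | hz
          · exact dc_complMk (hdC z hz) _
          · rw [List.mem_singleton.mp hz]
            exact dc_complMk_self _)
    rw [hCfun] at h3 h4
    rw [← e] at h2 h3 h4 h5 h6
    refine ⟨B', C', i1, i2, ι.comp (complMk _), κ.comp (complMk _), g', fun b => ?_, h2, h3, h4,
      h5, fun z hz => ?_⟩
    · simp only [RingHom.comp_apply, ← hg, h1]
    · have := h6 z hz
      simp only [Function.comp_apply, hg] at this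
      exact this

end BigCM

namespace BigCM

open Ideal IsLocalRing

theorem isBalancedBigCM_of_wreg {R B : Type*} [CommRing R] [IsNoetherianRing R] [IsLocalRing R]
    [CommRing B] [Algebra R B] {zs : List R} (hzs : IsSOP R zs)
    (hreg : WReg ⊥ (zs.map (algebraMap R B)))
    (hdc : ∀ z ∈ zs, DC ⊥ (algebraMap R B z))
    (htop : (maximalIdeal R).map (algebraMap R B) ≠ ⊤) : IsBalancedBigCM R B := by
  refine ⟨htop, fun xs hxs => ?_⟩
  have hlen : xs.length = zs.length := by
    have := hxs.2.1.trans hzs.2.1.symm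
    exact_mod_cast this
  have h1 : WReg ⊥ (xs.map (algebraMap R B)) := by
    refine WReg.switch (algebraMap R B) zs.length zs xs ⊥ ⊥ rfl hlen ?_ ?_ ?_ ?_ hreg
    · rw [bot_sup_eq]; exact hzs.2.2
    · rw [bot_sup_eq]; exact hxs.2.2
    · rw [Ideal.map_bot]
    · intro x hx
      refine DC.of_mem_radical (algebraMap R B) hdc ?_
      rw [show (ofList zs).radical = maximalIdeal R from hzs.2.2]
      exact hx
  exact (RingTheory.Sequence.isWeaklyRegular_map_algebraMap_iff B B xs).mp h1.isWeaklyRegular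

lemma map_maximalIdeal_ne_top {R B : Type*} [CommRing R] [IsNoetherianRing R] [IsLocalRing R]
    [CommRing B] (φ : R →+* B) {zs : List R} (hzs : IsSOP R zs)
    (htop : ofList (zs.map φ) ≠ ⊤) : (maximalIdeal R).map φ ≠ ⊤ := by
  intro h
  obtain ⟨n, hn⟩ := Ideal.exists_radical_pow_le_of_fg (ofList zs) (IsNoetherian.noetherian _)
  rw [show (ofList zs).radical = maximalIdeal R from hzs.2.2] at hn
  have := map_mono (f := φ) hn
  rw [Ideal.map_pow, h, map_ofList', Ideal.top_pow, top_le_iff] at this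
  exact htop this

theorem exists_bigCM_of_wreg {R : Type u} [CommRing R] [IsNoetherianRing R] [IsLocalRing R]
    (Q : Ideal R) [IsLocalRing (R ⧸ Q)] (ws : List R) (s : R) (hs : s ∈ Q)
    (hsop : IsSOP R (ws ++ [s])) (hsop' : IsSOP (R ⧸ Q) (ws.map (Ideal.Quotient.mk Q)))
    (B C : Type u) [CommRing B] [CommRing C] (ψ : R →+* B) (ψ' : R ⧸ Q →+* C) (g : B →+* C)
    (hg : ∀ r, g (ψ r) = ψ' (Ideal.Quotient.mk Q r)) (hB : WReg ⊥ ((ws ++ [s]).map ψ))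
    (hC : WReg ⊥ (ws.map (g ∘ ψ))) (htop : ofList (ws.map (g ∘ ψ)) ≠ ⊤) :
    ∃ (B : Type u) (C : Type u) (_ : CommRing B) (_ : CommRing C) (_ : Algebra R B)
        (_ : Algebra (R ⧸ Q) C) (f : B →+* C),
        IsBalancedBigCM R B ∧ IsBalancedBigCM (R ⧸ Q) C ∧
        ∀ r : R, f (algebraMap R B r) = algebraMap (R ⧸ Q) C (Ideal.Quotient.mk Q r) := by
  obtain ⟨B', C', i1, i2, ι, κ, g', h1, h2, h3, h4, h5, h6⟩ :=
    exists_completion ws [] s B C ψ g (by simpa using hB) (by simpa using hC)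
      (by rw [hg, Ideal.Quotient.eq_zero_iff_mem.mpr hs, map_zero]) (by simpa using htop)
      (by simp) (by simp)
  simp only [List.nil_append] at h2 h3 h4 h5 h6
  let a1 : Algebra R B' := (ι.comp ψ).toAlgebra
  let a2 : Algebra (R ⧸ Q) C' := (κ.comp ψ').toAlgebra
  have e2 : (κ ∘ g ∘ ψ) = (κ.comp ψ') ∘ (Ideal.Quotient.mk Q) := by
    funext r; simp [hg]
  rw [e2, ← List.map_map] at h3 h4
  have hC' := map_maximalIdeal_ne_top (κ.comp ψ') hsop' h4
  have hcomm : ∀ r, g' (ι (ψ r)) = κ (ψ' (Ideal.Quotient.mk Q r)) := fun r => by rw [h1, hg]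
  refine ⟨B', C', i1, i2, a1, a2, g', isBalancedBigCM_of_wreg hsop h2 h5 ?_,
    isBalancedBigCM_of_wreg hsop' h3 ?_ hC', hcomm⟩
  · intro h
    refine hC' (top_le_iff.mp ?_)
    have h7 := congrArg (Ideal.map g') h
    rw [Ideal.map_map, Ideal.map_top] at h7
    rw [← h7, Ideal.map_le_iff_le_comap]
    intro r hr
    rw [mem_comap]
    have : (g'.comp (algebraMap R B')) r = (κ.comp ψ') (Ideal.Quotient.mk Q r) := hcomm r
    rw [this]
    refine mem_map_of_mem _ ?_
    have : IsLocalHom (Ideal.Quotient.mk Q) := IsLocalHom.of_surjective _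
      Ideal.Quotient.mk_surjective
    rw [mem_maximalIdeal, mem_nonunits_iff] at hr ⊢
    exact fun hu => hr (isUnit_of_map_unit _ _ hu)
  · intro z hz
    obtain ⟨w, hw, rfl⟩ := List.mem_map.mp hz
    have := h6 w hw
    rw [hg] at this
    exact this

end BigCM

namespace BigCM

open Ideal

section Pi

variable {E : Type*} [CommRing E]

lemma wreg_pi {I : Ideal E} {zs : List E} (h : WReg I zs) :
    WReg (Ideal.pi fun _ : ℕ => I) (zs.map (Pi.constRingHom ℕ E)) := by
  induction zs generalizing I with
  | nil => trivial
  | cons z zs ih =>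
    have e : (Ideal.pi fun _ : ℕ => I) ⊔ span {Pi.constRingHom ℕ E z} =
        Ideal.pi fun _ : ℕ => I ⊔ span {z} := by
      apply le_antisymm
      · refine sup_le (fun u hu k => le_sup_left (a := I) (hu k)) ?_
        rw [span_singleton_le_iff_mem]
        exact fun k => le_sup_right (a := I) (mem_span_singleton_self z)
      · intro u hu
        have h : ∀ n, ∃ b, u n - b * z ∈ I := by
          intro n
          obtain ⟨j, hj, s, hs, e⟩ := Submodule.mem_sup.mp (hu n)
          obtain ⟨b, rfl⟩ := mem_span_singleton'.mp hs
          exact ⟨b, by rwa [← e, add_sub_cancel_right]⟩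
        choose b hb using h
        rw [← sub_add_cancel u (b * Pi.constRingHom ℕ E z)]
        exact Submodule.add_mem_sup hb (mul_mem_left _ _ (mem_span_singleton_self _))
    refine ⟨fun u hu k => h.1 _ (hu k), ?_⟩
    rw [e]
    exact ih h.2

lemma mem_of_mem_map_const {I : Ideal E} {u : ℕ → E} (hu : u ∈ I.map (Pi.constRingHom ℕ E))
    (k : ℕ) : u k ∈ I := by
  have : I.map (Pi.constRingHom ℕ E) ≤ Ideal.pi fun _ : ℕ => I :=
    Ideal.map_le_iff_le_comap.mpr fun x hx _ => hx
  exact this hu k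

lemma wreg_localization {L : Type*} [CommRing L] [Algebra E L] (M : Submonoid E)
    [IsLocalization M L] {I : Ideal E} {zs : List E} (h : WReg I zs) :
    WReg (I.map (algebraMap E L)) (zs.map (algebraMap E L)) := by
  induction zs generalizing I with
  | nil => trivial
  | cons z zs ih =>
    refine ⟨fun u hu => ?_, ?_⟩
    · obtain ⟨⟨b, m⟩, hb⟩ := IsLocalization.surj M u
      obtain ⟨⟨⟨a, ha⟩, n⟩, h2⟩ := (IsLocalization.mem_map_algebraMap_iff M L).mp hu
      simp only at hb h2
      have h3 : algebraMap E L (z * b * n) = algebraMap E L (a * m) := by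
        rw [map_mul, map_mul, map_mul, ← h2, ← hb]; ring
      obtain ⟨c, hc⟩ := (IsLocalization.eq_iff_exists M L).mp h3
      have h4 : (c : E) * n * b ∈ I := by
        refine h.1 _ ?_
        rw [show z * ((c : E) * n * b) = c * (z * b * n) by ring, hc]
        exact mul_mem_left _ _ (mul_mem_right _ _ ha)
      rw [IsLocalization.mem_map_algebraMap_iff M L]
      refine ⟨⟨⟨_, h4⟩, c * n * m⟩, ?_⟩
      simp only [Submonoid.coe_mul, map_mul]
      rw [← hb]; ring
    · have := ih h.2
      rwa [Ideal.map_sup, Ideal.map_span, Set.image_singleton] at this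

end Pi

lemma exists_lift_of_away {A R F L B : Type*} [CommRing A] [CommRing R] [CommRing F] [CommRing L]
    [CommRing B] [Algebra A R] [Algebra F L] (e : F) [IsLocalization.Away e L]
    (j : F →+* B) (hj : ∀ u, j e * u = 0 → u = 0) (α : A →+* F) (ψ : R →+* L)
    (hψ : ∀ a, ψ (algebraMap A R a) = algebraMap F L (α a)) {S : Set R}
    (hS : Algebra.adjoin A S = ⊤)
    (hgen : ∀ r ∈ S, ∃ (b : B) (a : F), algebraMap F L e * ψ r = algebraMap F L a ∧
      j e * b = j a) :
    ∃ (ρ : R →+* B) (lam : L →+* Localization.Away (j e)),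
      (∀ f, lam (algebraMap F L f) = algebraMap B _ (j f)) ∧
      ∀ r, algebraMap B _ (ρ r) = lam (ψ r) := by
  have hu : IsUnit (((algebraMap B (Localization.Away (j e))).comp j) e) :=
    IsLocalization.Away.algebraMap_isUnit (S := Localization.Away (j e)) (j e)
  let lam : L →+* Localization.Away (j e) := IsLocalization.Away.lift e hu
  have hlam : ∀ f, lam (algebraMap F L f) = algebraMap B _ (j f) := fun f =>
    IsLocalization.Away.lift_eq e hu f
  have hinj : Function.Injective (algebraMap B (Localization.Away (j e))) := by
    refine IsLocalization.injective (M := Submonoid.powers (j e)) _ ?_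
    rw [Submonoid.powers_le, mem_nonZeroDivisors_iff]
    exact ⟨hj, fun u hu => hj u (by rwa [mul_comm])⟩
  have hr : ∀ r : R, lam (ψ r) ∈ (algebraMap B (Localization.Away (j e))).range := by
    intro r
    have hr : r ∈ Algebra.adjoin A S := hS ▸ Algebra.mem_top
    induction hr using Algebra.adjoin_induction with
    | mem r hr =>
      obtain ⟨b, a, h1, h2⟩ := hgen r hr
      refine ⟨b, hu.mul_left_cancel ?_⟩
      rw [RingHom.comp_apply, ← map_mul, h2, ← hlam, ← hlam, ← h1, map_mul]
    | algebraMap a => exact ⟨j (α a), by rw [hψ, hlam]⟩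
    | add x y _ _ hx hy => rw [map_add, map_add]; exact add_mem hx hy
    | mul x y _ _ hx hy => rw [map_mul, map_mul]; exact mul_mem hx hy
  choose ρ hρ using hr
  refine ⟨⟨⟨⟨ρ, ?_⟩, ?_⟩, ?_, ?_⟩, lam, hlam, hρ⟩
  · apply hinj; simp only [hρ, map_one]
  · intro x y; apply hinj; simp only [hρ, map_mul]
  · apply hinj; simp only [hρ, map_zero]
  · intro x y; apply hinj; simp only [hρ, map_add]

lemma eq_zero_of_pow_mul_eq_zero {E : Type*} [CommRing E] [IsReduced E] {c u : E} {n : ℕ}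
    (h : c ^ n * u = 0) : c * u = 0 := by
  have : (c * u) ^ (n + 1) = 0 := by
    rw [mul_pow, pow_succ c, pow_succ u,
      show c ^ n * c * (u ^ n * u) = c ^ n * u * (c * u ^ n) by ring, h, zero_mul]
  exact eq_zero_of_pow_eq_zero this

/-- In the localization of a power of a reduced ring at a sequence of roots of `c`, the
element `c` is a nonzerodivisor. -/
lemma const_nzd_of_roots {E : Type*} [CommRing E] [IsReduced E] {c : E} {γ : ℕ → E} {q : ℕ → ℕ}
    (hγ : ∀ k, γ k ^ q k = c) {B : Type*} [CommRing B] [Algebra (ℕ → E) B]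
    [IsLocalization.Away γ B] (u : B)
    (hu : algebraMap (ℕ → E) B (Pi.constRingHom ℕ E c) * u = 0) : u = 0 := by
  obtain ⟨⟨b, m⟩, hb⟩ := IsLocalization.surj (Submonoid.powers γ) u
  simp only at hb
  have h1 : algebraMap (ℕ → E) B (Pi.constRingHom ℕ E c * b) = 0 := by
    rw [map_mul, ← hb, ← mul_assoc, hu, zero_mul]
  rw [IsLocalization.map_eq_zero_iff (Submonoid.powers γ)] at h1
  obtain ⟨⟨_, n, rfl⟩, hn⟩ := h1
  have h2 : γ * b = 0 := by
    funext k
    have h3 := congrFun hn k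
    simp only [Pi.mul_apply, Pi.pow_apply, Pi.zero_apply, Pi.constRingHom_apply,
      Function.const_apply] at h3 ⊢
    rw [← hγ k, ← mul_assoc, ← pow_add] at h3
    exact eq_zero_of_pow_mul_eq_zero h3
  have h3 : algebraMap (ℕ → E) B b = 0 :=
    (IsLocalization.map_eq_zero_iff (Submonoid.powers γ) _ b).mpr
      ⟨⟨γ, Submonoid.mem_powers γ⟩, h2⟩
  rw [h3] at hb
  exact (IsLocalization.map_units B m).mul_left_eq_zero.mp hb

theorem exists_wreg_of_roots_aux {A R F F' L L' E E' : Type u} [CommRing A] [CommRing R] [CommRing F]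
    [CommRing F'] [CommRing L] [CommRing L'] [CommRing E] [CommRing E'] [Algebra A R]
    [Algebra F L] [Algebra F' L'] [IsReduced E] [IsReduced E'] (π : F →+* F') (e : F)
    [IsLocalization.Away e L] [IsLocalization.Away (π e) L'] (τ : L →+* L')
    (hτ : ∀ f, τ (algebraMap F L f) = algebraMap F' L' (π f)) (α : A →+* F) (ψ : R →+* L)
    (hψ : ∀ a, ψ (algebraMap A R a) = algebraMap F L (α a)) (Q : Ideal R)
    (hQ : ∀ r ∈ Q, τ (ψ r) = 0) {S : Set R} (hS : Algebra.adjoin A S = ⊤) (a : R → F)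
    (ha : ∀ r ∈ S, algebraMap F L e * ψ r = algebraMap F L (a r))
    (δ : F →+* E) (δ' : F' →+* E') (g : E →+* E') (hδ : ∀ f, g (δ f) = δ' (π f))
    (ζ : R → E) (c : E) (hec : δ e ∣ c) (hc : ∀ r ∈ S, c * (δ e * ζ r - δ (a r)) = 0)
    (γ : ℕ → E) (q : ℕ → ℕ) (hγ : ∀ k, γ k ^ q k = c) (ws : List A) (s : A)
    (hE : WReg ⊥ ((ws ++ [s]).map (δ ∘ α))) (hE' : WReg ⊥ (ws.map (δ' ∘ π ∘ α)))
    (hsep : ∀ n, ∃ k, g c ^ n ∉ ofList (ws.map (δ' ∘ π ∘ α)) ^ q k) (γ' : ℕ → E')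
    (hγ' : ∀ k, γ' k = g (γ k)) (B C : Type u) [CommRing B] [CommRing C] [Algebra (ℕ → E) B]
    [Algebra (ℕ → E') C] [IsLocalization.Away γ B] [IsLocalization.Away γ' C] :
    ∃ (B C : Type u) (_ : CommRing B) (_ : CommRing C) (ρ : R →+* B) (ρ' : R ⧸ Q →+* C)
      (G : B →+* C), (∀ r, G (ρ r) = ρ' (Ideal.Quotient.mk Q r)) ∧
      WReg ⊥ ((ws ++ [s]).map (ρ ∘ algebraMap A R)) ∧
      WReg ⊥ (ws.map (G ∘ ρ ∘ algebraMap A R)) ∧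
      ofList (ws.map (G ∘ ρ ∘ algebraMap A R)) ≠ ⊤ := by
  have hγ'c : ∀ k, γ' k ^ q k = g c := fun k => by
    rw [hγ', ← map_pow, hγ]
  let i : E →+* B := (algebraMap (ℕ → E) B).comp (Pi.constRingHom ℕ E)
  let i' : E' →+* C := (algebraMap (ℕ → E') C).comp (Pi.constRingHom ℕ E')
  let P : (ℕ → E) →+* (ℕ → E') := RingHom.pi fun k => g.comp (Pi.evalRingHom _ k)
  have hP : IsUnit (((algebraMap (ℕ → E') C).comp P) γ) := by
    have : P γ = γ' := funext fun k => (hγ' k).symm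
    rw [RingHom.comp_apply, this]
    exact IsLocalization.Away.algebraMap_isUnit γ'
  let G : B →+* C := IsLocalization.Away.lift γ hP
  have hG : ∀ x, G (i x) = i' (g x) := by
    intro x
    exact IsLocalization.Away.lift_eq γ hP (Pi.constRingHom ℕ E x)
  have hcB : ∀ u, i c * u = 0 → u = 0 := fun u hu => const_nzd_of_roots hγ u hu
  have hcC : ∀ u, i' (g c) * u = 0 → u = 0 := fun u hu => const_nzd_of_roots hγ'c u hu
  have heB : ∀ u, (i.comp δ) e * u = 0 → u = 0 := by
    intro u hu
    obtain ⟨d, hd⟩ := hec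
    exact hcB u (by rw [hd, map_mul, mul_right_comm]; rw [RingHom.comp_apply] at hu; rw [hu, zero_mul])
  have heC : ∀ u, (i'.comp δ') (π e) * u = 0 → u = 0 := by
    intro u hu
    obtain ⟨d, hd⟩ := hec
    refine hcC u ?_
    rw [hd, map_mul, map_mul, mul_right_comm, hδ]
    rw [RingHom.comp_apply] at hu
    rw [hu, zero_mul]
  obtain ⟨ρ, lam, hlam, hρ⟩ := exists_lift_of_away (A := A) (R := R) (L := L) e (i.comp δ) heB α ψ
    hψ hS fun r hr => ⟨i (ζ r), a r, ha r hr, by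
      have := hcB (i (δ e * ζ r - δ (a r))) (by rw [← map_mul, hc r hr, map_zero])
      rw [map_sub, sub_eq_zero, map_mul] at this
      exact this⟩
  have hinj : Function.Injective (algebraMap C (Localization.Away ((i'.comp δ') (π e)))) := by
    refine IsLocalization.injective (M := Submonoid.powers ((i'.comp δ') (π e))) _ ?_
    rw [Submonoid.powers_le, mem_nonZeroDivisors_iff]
    exact ⟨heC, fun u hu => heC u (by rwa [mul_comm])⟩
  have hu : IsUnit (((algebraMap C (Localization.Away ((i'.comp δ') (π e)))).comp
      (i'.comp δ')) (π e)) := IsLocalization.Away.algebraMap_isUnit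
      (S := Localization.Away ((i'.comp δ') (π e))) ((i'.comp δ') (π e))
  let lam' : L' →+* Localization.Away ((i'.comp δ') (π e)) := IsLocalization.Away.lift (π e) hu
  have hlam' : ∀ f, lam' (algebraMap F' L' f) =
      algebraMap C (Localization.Away ((i'.comp δ') (π e))) ((i'.comp δ') f) := fun f =>
    IsLocalization.Away.lift_eq (π e) hu f
  have hGe : G ((i.comp δ) e) = (i'.comp δ') (π e) :=
    (hG (δ e)).trans (congrArg i' (hδ e))
  have hu2 : IsUnit (((algebraMap C (Localization.Away ((i'.comp δ') (π e)))).comp G)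
      ((i.comp δ) e)) := by
    have h1 := congrArg (algebraMap C (Localization.Away ((i'.comp δ') (π e)))) hGe
    exact h1 ▸ hu
  let μ : Localization.Away ((i.comp δ) e) →+* Localization.Away ((i'.comp δ') (π e)) :=
    IsLocalization.Away.lift ((i.comp δ) e) hu2
  have hμ : ∀ b, μ (algebraMap B _ b) =
      algebraMap C (Localization.Away ((i'.comp δ') (π e))) (G b) := fun b =>
    IsLocalization.Away.lift_eq ((i.comp δ) e) hu2 b
  have hμlam : μ.comp lam = lam'.comp τ := by
    refine IsLocalization.ringHom_ext (Submonoid.powers e) (RingHom.ext fun f => ?_)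
    have h1 := congrArg (algebraMap C (Localization.Away ((i'.comp δ') (π e))))
      ((hG (δ f)).trans (congrArg i' (hδ f)))
    exact ((congrArg μ (hlam f)).trans ((hμ _).trans h1)).trans
      ((congrArg lam' (hτ f)).trans (hlam' _)).symm
  have hker : ∀ r ∈ Q, (G.comp ρ) r = 0 := by
    intro r hr
    apply hinj
    have h1 := (congrArg μ (hρ r)).trans (RingHom.congr_fun hμlam (ψ r))
    have h2 : lam' (τ (ψ r)) = 0 := by rw [hQ r hr, map_zero]
    exact ((hμ _).symm.trans (h1.trans h2)).trans (map_zero _).symm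
  have hρA : ∀ x, ρ (algebraMap A R x) = i (δ (α x)) := by
    intro x
    have hinj : Function.Injective (algebraMap B (Localization.Away ((i.comp δ) e))) := by
      refine IsLocalization.injective (M := Submonoid.powers ((i.comp δ) e)) _ ?_
      rw [Submonoid.powers_le, mem_nonZeroDivisors_iff]
      exact ⟨heB, fun u hu => heB u (by rwa [mul_comm])⟩
    apply hinj
    rw [hρ, hψ, hlam]
    rfl
  have hGA : G ∘ ρ ∘ algebraMap A R = i' ∘ (δ' ∘ π ∘ α) := by
    funext x
    simp only [Function.comp_apply, hρA, hG, hδ]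
  refine ⟨B, C, inferInstance, inferInstance, ρ, Ideal.Quotient.lift Q (G.comp ρ) hker, G,
    fun r => rfl, ?_, ?_, ?_⟩
  · have h1 := wreg_localization (L := B) (Submonoid.powers γ) (wreg_pi hE)
    rw [show (Ideal.pi fun _ : ℕ => (⊥ : Ideal E)) = ⊥ from
      le_bot_iff.mp fun u hu => funext hu, Ideal.map_bot, List.map_map, List.map_map] at h1
    rwa [show ρ ∘ algebraMap A R = (algebraMap (ℕ → E) B) ∘ (Pi.constRingHom ℕ E) ∘ (δ ∘ α) from
      funext hρA]
  · have h1 := wreg_localization (L := C) (Submonoid.powers γ') (wreg_pi hE')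
    rw [show (Ideal.pi fun _ : ℕ => (⊥ : Ideal E')) = ⊥ from
      le_bot_iff.mp fun u hu => funext hu, Ideal.map_bot, List.map_map, List.map_map] at h1
    rwa [hGA]
  · intro htop
    rw [hGA, ← List.map_map, ← map_ofList' i'] at htop
    set J := ofList (ws.map (δ' ∘ π ∘ α)) with hJ
    have h1 : (1 : C) ∈ (J.map (Pi.constRingHom ℕ E')).map (algebraMap (ℕ → E') C) := by
      rw [Ideal.map_map]
      exact htop ▸ Submodule.mem_top
    obtain ⟨⟨⟨b, hb⟩, ⟨_, n, rfl⟩⟩, h2⟩ :=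
      (IsLocalization.mem_map_algebraMap_iff (Submonoid.powers γ') C).mp h1
    simp only [one_mul] at h2
    obtain ⟨⟨_, m, rfl⟩, h3⟩ := (IsLocalization.eq_iff_exists (Submonoid.powers γ') C).mp h2
    simp only at h3
    obtain ⟨k, hk⟩ := hsep (m + n)
    apply hk
    rw [← hγ'c k, ← pow_mul, mul_comm, pow_mul]
    refine Ideal.pow_mem_pow ?_ _
    have h4 := congrFun h3 k
    simp only [Pi.mul_apply, Pi.pow_apply] at h4
    rw [pow_add, h4]
    exact mul_mem_left _ _ (mem_of_mem_map_const hb k)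

theorem exists_wreg_of_roots {A R F F' L L' E E' : Type u} [CommRing A] [CommRing R] [CommRing F]
    [CommRing F'] [CommRing L] [CommRing L'] [CommRing E] [CommRing E'] [Algebra A R]
    [Algebra F L] [Algebra F' L'] [IsReduced E] [IsReduced E'] (π : F →+* F') (e : F)
    [IsLocalization.Away e L] [IsLocalization.Away (π e) L'] (τ : L →+* L')
    (hτ : ∀ f, τ (algebraMap F L f) = algebraMap F' L' (π f)) (α : A →+* F) (ψ : R →+* L)
    (hψ : ∀ a, ψ (algebraMap A R a) = algebraMap F L (α a)) (Q : Ideal R)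
    (hQ : ∀ r ∈ Q, τ (ψ r) = 0) {S : Set R} (hS : Algebra.adjoin A S = ⊤) (a : R → F)
    (ha : ∀ r ∈ S, algebraMap F L e * ψ r = algebraMap F L (a r))
    (δ : F →+* E) (δ' : F' →+* E') (g : E →+* E') (hδ : ∀ f, g (δ f) = δ' (π f))
    (ζ : R → E) (c : E) (hec : δ e ∣ c) (hc : ∀ r ∈ S, c * (δ e * ζ r - δ (a r)) = 0)
    (γ : ℕ → E) (q : ℕ → ℕ) (hγ : ∀ k, γ k ^ q k = c) (ws : List A) (s : A)
    (hE : WReg ⊥ ((ws ++ [s]).map (δ ∘ α))) (hE' : WReg ⊥ (ws.map (δ' ∘ π ∘ α)))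
    (hsep : ∀ n, ∃ k, g c ^ n ∉ ofList (ws.map (δ' ∘ π ∘ α)) ^ q k) :
    ∃ (B C : Type u) (_ : CommRing B) (_ : CommRing C) (ρ : R →+* B) (ρ' : R ⧸ Q →+* C)
      (G : B →+* C), (∀ r, G (ρ r) = ρ' (Ideal.Quotient.mk Q r)) ∧
      WReg ⊥ ((ws ++ [s]).map (ρ ∘ algebraMap A R)) ∧
      WReg ⊥ (ws.map (G ∘ ρ ∘ algebraMap A R)) ∧
      ofList (ws.map (G ∘ ρ ∘ algebraMap A R)) ≠ ⊤ :=
  exists_wreg_of_roots_aux π e τ hτ α ψ hψ Q hQ hS a ha δ δ' g hδ ζ c hec hc γ q hγ ws s hE hE' hsep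
    (fun k => g (γ k)) (fun _ => rfl) (Localization.Away γ) (Localization.Away fun k => g (γ k))

end BigCM

namespace BigCM

open Ideal

section Powers

variable {B : Type*} [CommRing B]

/-- Dividing by an element which is regular modulo all the nonempty initial segments. -/
lemma WReg.sup_of_nzd {r : B} {zs : List B} {I : Ideal B}
    (hr : ∀ l l', zs = l ++ l' → l ≠ [] → ∀ b, r * b ∈ I ⊔ ofList l → b ∈ I ⊔ ofList l)
    (h : WReg I zs) : WReg (I ⊔ span {r}) zs := by
  induction zs generalizing I with
  | nil => trivial
  | cons a zs ih =>
    obtain ⟨h1, h2⟩ := h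
    refine ⟨nzd_sup_of_nzd h1 ?_, ?_⟩
    · have := hr [a] zs rfl (by simp)
      rwa [ofList_singleton] at this
    · rw [sup_right_comm]
      refine ih (fun l l' e hl => ?_) h2
      have := hr (a :: l) l' (by rw [e]; rfl) (by simp)
      rwa [ofList_cons, ← sup_assoc] at this

lemma WReg.map_pow_head {z : B} {zs : List B} {I : Ideal B} (h : WReg I (z :: zs)) (N : ℕ) :
    WReg (I ⊔ span {z ^ N}) zs := by
  induction zs generalizing I with
  | nil => trivial
  | cons y zs ih =>
    obtain ⟨h1, h2, h3⟩ := h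
    refine ⟨?_, ?_⟩
    · have hpow : ∀ (n : ℕ) (b : B), z ^ n * b ∈ I → b ∈ I := by
        intro n
        induction n with
        | zero => intro b hb; simpa using hb
        | succ n ih => intro b hb; exact ih b (h1 _ (by rwa [← mul_assoc, ← pow_succ']))
      clear ih h3
      induction N with
      | zero => intro b _; simp
      | succ N ihN =>
        intro u hu
        have hle : I ⊔ span {z ^ (N + 1)} ≤ I ⊔ span {z ^ N} := by
          refine sup_le le_sup_left ?_
          rw [span_singleton_le_iff_mem, pow_succ]
          exact le_sup_right (a := I) (mul_mem_right _ _ (mem_span_singleton_self _))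
        obtain ⟨i, hi, s, hs, e⟩ := Submodule.mem_sup.mp (ihN u (hle hu))
        obtain ⟨v, rfl⟩ := mem_span_singleton'.mp hs
        obtain ⟨j, hj, s, hs, e'⟩ := Submodule.mem_sup.mp hu
        obtain ⟨w, rfl⟩ := mem_span_singleton'.mp hs
        have h4 : y * v - w * z ∈ I := by
          refine hpow N _ ?_
          rw [show z ^ N * (y * v - w * z) = j - y * i by
            rw [← e] at e'
            linear_combination -e']
          exact sub_mem hj (mul_mem_left _ _ hi)
        have h5 : v ∈ I ⊔ span {z} := by
          refine h2 v ?_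
          rw [show y * v = (y * v - w * z) + w * z by ring]
          exact Submodule.add_mem_sup h4 (mul_mem_left _ _ (mem_span_singleton_self _))
        obtain ⟨k, hk, s, hs, e''⟩ := Submodule.mem_sup.mp h5
        obtain ⟨x, rfl⟩ := mem_span_singleton'.mp hs
        rw [← e, ← e'', show i + (k + x * z) * z ^ N = (i + k * z ^ N) + x * z ^ (N + 1) by ring]
        exact Submodule.add_mem_sup (add_mem hi (mul_mem_right _ _ hk))
          (mul_mem_left _ _ (mem_span_singleton_self _))
    · rw [sup_right_comm]
      refine ih ⟨nzd_sup_of_nzd h1 h2, ?_⟩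
      rwa [sup_right_comm]

lemma WReg.pow_head {z : B} {zs : List B} {I : Ideal B} (h : WReg I (z :: zs)) (N : ℕ) :
    WReg I (z ^ N :: zs) := by
  refine ⟨?_, h.map_pow_head N⟩
  induction N with
  | zero => intro b hb; simpa using hb
  | succ n ih => intro b hb; exact ih b (h.1 _ (by rwa [← mul_assoc, ← pow_succ']))

lemma WReg.pow {zs : List B} {I : Ideal B} (h : WReg I zs) (N : ℕ) :
    WReg I (zs.map (· ^ N)) := by
  induction zs generalizing I with
  | nil => trivial
  | cons z zs ih => exact ⟨(h.pow_head N).1, ih (h.map_pow_head N)⟩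

lemma mem_ofList_pow_map {p : ℕ} [Fact p.Prime] [CharP B p] {zs : List B} {b : B}
    (hb : b ∈ ofList zs) (n : ℕ) : b ^ p ^ n ∈ ofList (zs.map (· ^ p ^ n)) := by
  have : ofList zs ≤ (ofList (zs.map (· ^ p ^ n))).comap (iterateFrobenius B p n) := by
    rw [ofList, Ideal.span_le]
    intro z hz
    exact mem_ofList (List.mem_map.mpr ⟨z, hz, rfl⟩)
  exact this hb

end Powers

section Perfect

variable {B D : Type*} [CommRing B] [CommRing D] (p : ℕ) [Fact p.Prime] [CharP B p] [CharP D p]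
  [PerfectRing D p]

/-- Regular sequences pass to perfect closures. -/
lemma wreg_of_isPerfectClosure (i : B →+* D) (h1 : ∀ d : D, ∃ (n : ℕ) (b : B), i b = d ^ p ^ n)
    (h2 : ∀ b : B, i b = 0 → ∃ n : ℕ, b ^ p ^ n = 0) {zs : List B} (h : WReg ⊥ zs) :
    WReg ⊥ (zs.map i) := by
  have key : ∀ (l : List B) (d : D), d ∈ ofList (l.map i) →
      ∃ (n : ℕ) (b : B), i b = d ^ p ^ n ∧ b ∈ ofList (l.map (· ^ p ^ n)) := by
    intro l d hd
    rw [← map_ofList'] at hd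
    induction hd using Submodule.span_induction with
    | mem d hd =>
      obtain ⟨b, hb, rfl⟩ := hd
      exact ⟨0, b, by simp, by simpa using hb⟩
    | zero => exact ⟨0, 0, by simp, zero_mem _⟩
    | add x y _ _ hx hy =>
      obtain ⟨n, b, hb, hbm⟩ := hx
      obtain ⟨m, c, hc, hcm⟩ := hy
      refine ⟨n + m, b ^ p ^ m + c ^ p ^ n, ?_, ?_⟩
      · rw [map_add, map_pow, map_pow, hb, hc, add_pow_char_pow, ← pow_mul, ← pow_mul, ← pow_add,
          ← pow_add, add_comm m n]
      · refine add_mem ?_ ?_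
        · have := mem_ofList_pow_map (p := p) hbm m
          simpa [Function.comp_def, ← pow_mul, ← pow_add] using this
        · have := mem_ofList_pow_map (p := p) hcm n
          simpa [Function.comp_def, ← pow_mul, ← pow_add, add_comm] using this
    | smul a x _ hx =>
      obtain ⟨n, b, hb, hbm⟩ := hx
      obtain ⟨m, c, hc⟩ := h1 a
      refine ⟨n + m, c ^ p ^ n * b ^ p ^ m, ?_, mul_mem_left _ _ ?_⟩
      · rw [map_mul, map_pow, map_pow, hb, hc, smul_eq_mul, mul_pow, ← pow_mul, ← pow_mul,
          ← pow_add, ← pow_add, add_comm m n]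
      · have := mem_ofList_pow_map (p := p) hbm m
        simpa [Function.comp_def, ← pow_mul, ← pow_add] using this
  have main : ∀ (l : List B) (z : B), WReg ⊥ (l ++ [z]) → ∀ d : D, i z * d ∈ ofList (l.map i) →
      d ∈ ofList (l.map i) := by
    intro l z hl d hd
    obtain ⟨n, b, hb, hbm⟩ := key l _ hd
    obtain ⟨m, c, hc⟩ := h1 d
    have h3 : i (z ^ p ^ (n + m) * c ^ p ^ n - b ^ p ^ m) = 0 := by
      rw [map_sub, map_mul, map_pow, map_pow, map_pow, hb, hc, mul_pow, mul_pow, ← pow_mul,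
        ← pow_mul, ← pow_mul, ← pow_add, ← pow_add, add_comm m n, sub_self]
    obtain ⟨k, hk⟩ := h2 _ h3
    rw [sub_pow_char_pow, sub_eq_zero, mul_pow, ← pow_mul, ← pow_mul, ← pow_mul, ← pow_add,
      ← pow_add, ← pow_add] at hk
    have h4 : c ^ p ^ (n + k) ∈ ofList (l.map (· ^ p ^ (n + m + k))) := by
      have h5 := hl.pow (p ^ (n + m + k))
      rw [List.map_append, List.map_singleton, wreg_append, bot_sup_eq] at h5
      refine h5.2.1 _ ?_
      rw [hk]
      have := mem_ofList_pow_map (p := p) hbm (m + k)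
      simpa [Function.comp_def, ← pow_mul, ← pow_add, add_assoc] using this
    have h6 := mem_map_of_mem i h4
    rw [map_pow, hc, ← pow_mul, ← pow_add, show m + (n + k) = n + m + k by ring, map_ofList',
      List.map_map] at h6
    set q := n + m + k
    have h7 : ofList (l.map (i ∘ (· ^ p ^ q))) ≤
        (ofList (l.map i)).map (iterateFrobenius D p q) := by
      rw [ofList, Ideal.span_le]
      intro x hx
      obtain ⟨y, hy, rfl⟩ := List.mem_map.mp hx
      have := mem_map_of_mem (iterateFrobenius D p q)
        (mem_ofList (List.mem_map_of_mem (f := i) hy))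
      simpa [iterateFrobenius_def] using this
    have h8 := h7 h6
    rw [Ideal.mem_map_iff_of_surjective (iterateFrobenius D p q) (bijective_iterateFrobenius D p q).2] at h8
    obtain ⟨x, hx, hxd⟩ := h8
    have : x = d := (bijective_iterateFrobenius D p q).1 (by
      simpa [iterateFrobenius_def] using hxd)
    exact this ▸ hx
  induction zs using List.reverseRecOn with
  | nil => trivial
  | append_singleton l z ih =>
    have h' := h
    rw [wreg_append] at h
    rw [List.map_append, wreg_append]
    refine ⟨ih h.1, ?_, trivial⟩
    rw [bot_sup_eq]
    exact main l z h'

end Perfect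

end BigCM

namespace BigCM

open Ideal

section AdicDC

variable {B : Type*} [CommRing B]

lemma exists_adic_sum (x : B) [IsAdicComplete (span {x}) B] (m : ℕ → B) :
    ∃ T : B, ∀ n, x ^ n ∣ T - ∑ k ∈ Finset.range n, x ^ k * m k := by
  have hc : ∀ {a b : ℕ}, a ≤ b → (∑ k ∈ Finset.range a, x ^ k * m k) ≡
      (∑ k ∈ Finset.range b, x ^ k * m k) [SMOD (span {x} ^ a • ⊤ : Submodule B B)] := by
    intro a b hab
    rw [SModEq.comm, SModEq.sub_mem, smul_eq_mul, mul_top, span_singleton_pow, mem_span_singleton,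
      Finset.sum_range_sub_sum_range hab]
    refine Finset.dvd_sum fun k hk => ?_
    exact Dvd.dvd.mul_right (pow_dvd_pow _ (Finset.mem_filter.mp hk).2) _
  obtain ⟨L, hL⟩ := IsPrecomplete.prec' (I := span {x}) (M := B) _ hc
  refine ⟨L, fun n => ?_⟩
  have := (hL n).symm
  rwa [SModEq.sub_mem, smul_eq_mul, mul_top, span_singleton_pow, mem_span_singleton] at this

lemma eq_zero_of_forall_pow_dvd (x : B) [IsAdicComplete (span {x}) B] {b : B}
    (h : ∀ n, x ^ n ∣ b) : b = 0 := by
  refine IsHausdorff.haus' (I := span {x}) b fun n => ?_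
  rw [SModEq.zero, smul_eq_mul, mul_top, span_singleton_pow, mem_span_singleton]
  exact h n

lemma dc_of_isAdicComplete (x : B) [IsAdicComplete (span {x}) B] : DC (⊥ : Ideal B) x := by
  choose T hT using exists_adic_sum (B := B) x
  refine dc_of_sum (fun u hu => ?_) T fun m => ?_
  · refine eq_zero_of_forall_pow_dvd x fun n => ?_
    have : ∀ n, u 0 = x ^ n * u n := by
      intro n
      induction n with
      | zero => simp
      | succ n ih => rw [ih, hu n, pow_succ, mul_assoc]
    exact ⟨_, this n⟩
  · rw [← sub_eq_zero]
    refine eq_zero_of_forall_pow_dvd x fun n => ?_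
    have h1 := (pow_dvd_pow x n.le_succ).trans (hT m (n + 1))
    have h2 := (hT (fun i => m (i + 1)) n).mul_left x
    have h3 := dvd_sub h1 h2
    rw [Finset.sum_range_succ'] at h3
    convert h3 using 1
    simp only [mul_sub, Finset.mul_sum, pow_succ', pow_zero, one_mul, mul_assoc]
    ring

end AdicDC

open WittVector

variable (p : ℕ) [hp : Fact p.Prime]

/-- The untilt of `D` along `t`, in which `p` acquires a compatible system of roots. -/
abbrev Untilt {D : Type*} [CommRing D] (t : D) : Type _ :=
  WittVector p D ⧸ span {(p : WittVector p D) - teichmuller p t}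

/-- The multiplicative sharp map. -/
noncomputable def tau {D : Type*} [CommRing D] (t : D) : D →* Untilt p t :=
  (Ideal.Quotient.mk (span {(p : WittVector p D) - teichmuller p t}) :
    WittVector p D →* Untilt p t).comp (teichmuller p)

section Functorial

variable {D D' D'' : Type*} [CommRing D] [CommRing D'] [CommRing D'']

/-- Functoriality of the untilt. -/
noncomputable def untiltMap (φ : D →+* D') {t : D} {t' : D'} (h : φ t = t') :
    Untilt p t →+* Untilt p t' :=
  Ideal.quotientMap _ (WittVector.map φ) (by
    rw [span_singleton_le_iff_mem, mem_comap, map_sub, map_natCast, map_teichmuller, h]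
    exact mem_span_singleton_self _)

variable {p}

@[simp] lemma untiltMap_mk (φ : D →+* D') {t : D} {t' : D'} (h : φ t = t') (w : WittVector p D) :
    untiltMap p φ h (Ideal.Quotient.mk _ w) = Ideal.Quotient.mk _ (WittVector.map φ w) := rfl

lemma tau_apply (t d : D) : tau p t d = Ideal.Quotient.mk _ (teichmuller p d) := rfl

@[simp] lemma untiltMap_tau (φ : D →+* D') {t : D} {t' : D'} (h : φ t = t') (d : D) :
    untiltMap p φ h (tau p t d) = tau p t' (φ d) := by
  rw [tau_apply, untiltMap_mk, map_teichmuller, tau_apply]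

lemma untiltMap_untiltMap (φ : D →+* D') (φ' : D' →+* D'') {t : D} {t' : D'} {t'' : D''}
    (h : φ t = t') (h' : φ' t' = t'') (x : Untilt p t) :
    untiltMap p φ' h' (untiltMap p φ h x) =
      untiltMap p (φ'.comp φ) (by rw [RingHom.comp_apply, h, h']) x := by
  obtain ⟨w, rfl⟩ := Ideal.Quotient.mk_surjective x
  simp only [untiltMap_mk]
  congr 1

lemma tau_self (t : D) : tau p t t = p := by
  rw [tau_apply, ← map_natCast (Ideal.Quotient.mk _), eq_comm, Ideal.Quotient.mk_eq_mk_iff_sub_mem]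
  exact mem_span_singleton_self _

end Functorial

variable {p} {D : Type*} [CommRing D] [CharP D p] [PerfectRing D p] {t : D} {l : List D}

lemma wreg_witt (h : WReg ⊥ (t :: l)) : WReg ⊥ ((p : WittVector p D) ::
    ((p : WittVector p D) - teichmuller p t) :: l.map (teichmuller p)) := by
  refine ⟨fun b hb => eq_zero_of_p_mul_eq_zero b (by simpa [mul_comm] using hb), ?_⟩
  rw [bot_sup_eq, ← ker_constantCoeff, RingHom.ker_eq_comap_bot,
    wreg_comap (constantCoeff_surjective p)]
  have h1 : (((p : WittVector p D) - teichmuller p t) :: l.map (teichmuller p)).map constantCoeff =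
      (-t) :: l := by
    have h2 : ∀ d : D, constantCoeff (teichmuller p d) = d := teichmuller_coeff_zero p
    simp only [List.map_cons, map_sub, h2, List.map_map, map_natCast, CharP.cast_eq_zero, zero_sub]
    congr 1
    exact (List.map_congr_left fun d _ => h2 d).trans (List.map_id _)
  rw [h1]
  refine ⟨fun b hb => h.1 b ?_, ?_⟩
  · simpa using hb
  · rw [span_singleton_neg]
    exact h.2

lemma dc_p : DC (⊥ : Ideal (WittVector p D)) (p : WittVector p D) :=
  dc_of_isAdicComplete _

omit [CharP D p] [PerfectRing D p] in
lemma wreg_untilt_iff {zs : List (WittVector p D)} :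
    WReg ⊥ (zs.map (Ideal.Quotient.mk (span {(p : WittVector p D) - teichmuller p t}))) ↔
      WReg (span {(p : WittVector p D) - teichmuller p t}) zs := by
  rw [← wreg_comap Ideal.Quotient.mk_surjective, ← RingHom.ker_eq_comap_bot, Ideal.mk_ker]

lemma wreg_p_tau (h : WReg ⊥ (t :: l)) : WReg ⊥ ((p : Untilt p t) :: l.map (tau p t)) := by
  have h1 := wreg_witt h
  have h2 : (p : Untilt p t) :: l.map (tau p t) = ((p : WittVector p D) ::
      l.map (teichmuller p)).map
      (Ideal.Quotient.mk (span {(p : WittVector p D) - teichmuller p t})) := by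
    simp [tau]
  rw [h2, wreg_untilt_iff]
  obtain ⟨h3, h4, h5⟩ := h1
  rw [bot_sup_eq] at h4 h5
  refine ⟨?_, ?_⟩
  · have := nzd_sup_of_nzd h3 (by simpa using h4)
    simpa using this
  · rwa [sup_comm]

lemma wreg_tau_p (h : WReg ⊥ (t :: l)) : WReg ⊥ (l.map (tau p t) ++ [(p : Untilt p t)]) := by
  have h1 := (wreg_witt h).front_to_last dc_p
  have h2 : l.map (tau p t) ++ [(p : Untilt p t)] = (l.map (teichmuller p) ++
      [(p : WittVector p D)]).map
      (Ideal.Quotient.mk (span {(p : WittVector p D) - teichmuller p t})) := by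
    simp [tau]
  rw [h2, wreg_untilt_iff]
  simpa using h1.2

/-- All permutations are weakly regular. -/
def PReg {B : Type*} [CommRing B] (l : List B) : Prop := ∀ l', l'.Perm l → WReg ⊥ l'

lemma preg_untilt (h : ∀ l', l'.Perm l → WReg ⊥ (t :: l')) :
    PReg ((p : Untilt p t) :: l.map (tau p t)) := by
  intro l'' hl
  obtain ⟨a, b, rfl⟩ := List.append_of_mem (hl.symm.subset List.mem_cons_self)
  have h1 : (a ++ b).Perm (l.map (tau p t)) := (List.perm_middle.symm.trans hl).cons_inv
  obtain ⟨l', hl', hab⟩ : ∃ l' : List D, l'.Perm l ∧ l'.map (tau p t) = a ++ b := by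
    obtain ⟨l', h2, h3⟩ : Relation.Comp (· = List.map (tau p t) ·) List.Perm (a ++ b) l := by
      rw [List.eq_map_comp_perm]
      exact h1
    exact ⟨l', h3, h2.symm⟩
  obtain ⟨a', b', rfl, rfl, rfl⟩ := List.map_eq_append_iff.mp hab
  have h2 := h _ hl'
  have h3 := wreg_p_tau (p := p) h2
  rw [← List.cons_append, wreg_append] at h2
  have h4 := wreg_tau_p (p := p) h2.1
  rw [wreg_append] at h4 ⊢
  refine ⟨h4.1, h4.2.1, ?_⟩
  rw [← List.singleton_append, List.map_append, ← List.append_assoc, wreg_append] at h3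
  have h5 := h3.2
  rw [ofList_append, ofList_singleton, ← sup_assoc, sup_right_comm] at h5
  exact h5

lemma dc_untilt : DC (⊥ : Ideal (Untilt p t)) (p : Untilt p t) := by
  have := ((dc_p (p := p) (D := D)).sup ((p : WittVector p D) - teichmuller p t))
  rw [bot_sup_eq] at this
  simpa using this.quotient

variable (p t) in
/-- The reduction of the untilt modulo `p`. -/
noncomputable def untiltRed : Untilt p t →+* D ⧸ span {t} :=
  Ideal.Quotient.lift _ ((Ideal.Quotient.mk (span {t})).comp constantCoeff) (by
    intro a ha
    obtain ⟨b, rfl⟩ := mem_span_singleton'.mp ha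
    have h2 : ∀ d : D, constantCoeff (teichmuller p d) = d := teichmuller_coeff_zero p
    rw [RingHom.comp_apply, Ideal.Quotient.eq_zero_iff_mem, map_mul, map_sub, h2, map_natCast,
      CharP.cast_eq_zero, zero_sub]
    exact mul_mem_left _ _ (neg_mem (mem_span_singleton_self _)))

omit [PerfectRing D p] in
lemma untiltRed_tau (d : D) : untiltRed p t (tau p t d) = Ideal.Quotient.mk _ d := by
  have h2 : ∀ d : D, constantCoeff (teichmuller p d) = d := teichmuller_coeff_zero p
  simp [untiltRed, tau_apply, h2]

omit [PerfectRing D p] in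
lemma ofList_untilt_ne_top (h : ofList (t :: l) ≠ ⊤) :
    ofList ((p : Untilt p t) :: l.map (tau p t)) ≠ ⊤ := by
  intro h1
  apply h
  have h2 := congrArg (Ideal.map (untiltRed p t)) h1
  rw [map_ofList', Ideal.map_top, List.map_cons, List.map_map, ← tau_self, untiltRed_tau,
    show untiltRed p t ∘ tau p t = Ideal.Quotient.mk (span {t}) from funext untiltRed_tau,
    ← List.map_cons (f := Ideal.Quotient.mk (span {t})), ← map_ofList'] at h2
  have h3 := congrArg (Ideal.comap (Ideal.Quotient.mk (span {t}))) h2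
  rw [Ideal.comap_map_of_surjective _ Ideal.Quotient.mk_surjective, ← RingHom.ker_eq_comap_bot,
    Ideal.mk_ker, Ideal.comap_top, ofList_cons, sup_right_comm, sup_idem, ← ofList_cons] at h3
  exact h3

lemma exists_sub_tau_mem (x : Untilt p t) : ∃ (d : D) (y : Untilt p t), x = tau p t d + p * y := by
  obtain ⟨w, rfl⟩ := Ideal.Quotient.mk_surjective x
  have h2 : ∀ d : D, constantCoeff (teichmuller p d) = d := teichmuller_coeff_zero p
  have h1 : w - teichmuller p (constantCoeff w) ∈ span {(p : WittVector p D)} := by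
    rw [← ker_constantCoeff, RingHom.mem_ker, map_sub, h2, sub_self]
  obtain ⟨v, hv⟩ := mem_span_singleton'.mp h1
  refine ⟨constantCoeff w, Ideal.Quotient.mk _ v, ?_⟩
  rw [tau_apply, ← map_natCast (Ideal.Quotient.mk _), ← map_mul, ← map_add, mul_comm, hv]
  simp

lemma isReduced_untilt (h : WReg ⊥ [t]) : IsReduced (Untilt p t) := by
  have hp0 := hp.out.pos
  set ϖ : Untilt p t := tau p t ((frobeniusEquiv D p).symm t) with hϖ
  have hϖp : ϖ ^ p = p := by
    rw [hϖ, ← map_pow, frobeniusEquiv_symm_pow_p, tau_self]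
  have hpn : ∀ b : Untilt p t, (p : Untilt p t) * b = 0 → b = 0 := (wreg_p_tau (l := []) h).1
  have hdc : DC (⊥ : Ideal (Untilt p t)) ϖ := DC.of_pow (N := p) (hϖp ▸ dc_untilt)
  rw [isReduced_iff_pow_one_lt p hp.out.one_lt]
  have step : ∀ x : {x : Untilt p t // x ^ p = 0}, ∃ y : {x : Untilt p t // x ^ p = 0},
      x.1 = ϖ * y.1 := by
    rintro ⟨x, hx⟩
    obtain ⟨d, y, rfl⟩ := exists_sub_tau_mem x
    have h1 : d ^ p ∈ span {t} := by
      rw [← Ideal.Quotient.eq_zero_iff_mem, map_pow, ← untiltRed_tau (p := p)]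
      have h3 : untiltRed p t p = 0 := by
        rw [← tau_self, untiltRed_tau, Ideal.Quotient.eq_zero_iff_mem]
        exact mem_span_singleton_self _
      have h4 := congrArg (untiltRed p t) hx
      rwa [map_pow, map_add, map_mul, h3, zero_mul, add_zero, map_zero] at h4
    obtain ⟨c, hc⟩ := mem_span_singleton'.mp h1
    have h5 : d = (frobeniusEquiv D p).symm c * (frobeniusEquiv D p).symm t := by
      rw [← map_mul, hc, ← frobenius_def, frobeniusEquiv_symm_apply_frobenius]
    have h6 : tau p t d + p * y = ϖ * (tau p t ((frobeniusEquiv D p).symm c) + ϖ ^ (p - 1) * y) := by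
      rw [mul_add, ← mul_assoc ϖ, ← pow_succ', Nat.sub_add_cancel hp0, hϖp, h5, map_mul, mul_comm ϖ]
    refine ⟨⟨_, ?_⟩, h6⟩
    rw [h6, mul_pow, hϖp] at hx
    exact hpn _ hx
  choose g hg using step
  intro x hx
  have := hdc.1 (fun i => (g^[i] ⟨x, hx⟩).1) (fun i => by
    simp only [Function.iterate_succ_apply']
    rw [← hg, sub_self]
    exact zero_mem _) 0
  simpa using this

end BigCM

namespace BigCM

open Ideal WittVector

section WittCoeff

variable {p : ℕ} [hp : Fact p.Prime] {S : Type*} [CommRing S]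

lemma coeff_add_congr {N : ℕ} {x x' y y' : WittVector p S}
    (hx : ∀ i < N, x.coeff i = x'.coeff i) (hy : ∀ i < N, y.coeff i = y'.coeff i) :
    ∀ i < N, (x + y).coeff i = (x' + y').coeff i := by
  intro i hi
  have h1 : truncate N x = truncate N x' := TruncatedWittVector.ext fun i => by
    rw [coeff_truncate, coeff_truncate, hx i i.2]
  have h2 : truncate N y = truncate N y' := TruncatedWittVector.ext fun i => by
    rw [coeff_truncate, coeff_truncate, hy i i.2]
  rw [← coeff_truncate (x + y) ⟨i, hi⟩, ← coeff_truncate (x' + y') ⟨i, hi⟩, map_add, map_add, h1, h2]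

omit hp in
lemma coeff_init' (N i : ℕ) (z : WittVector p S) :
    (init N z).coeff i = if i < N then z.coeff i else 0 := by
  simp only [init, select, WittVector.coeff_mk]
  congr

omit hp in
lemma coeff_tail' (N i : ℕ) (z : WittVector p S) :
    (tail N z).coeff i = if N ≤ i then z.coeff i else 0 := by
  simp only [tail, select, WittVector.coeff_mk]
  congr

lemma coeff_add_of_forall_lt {N : ℕ} (z : WittVector p S) {v : WittVector p S}
    (hv : ∀ i < N, v.coeff i = 0) : (z + v).coeff N = z.coeff N + v.coeff N := by
  have h0 : ∀ i < N, (tail N z).coeff i = 0 := fun i hi => by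
    rw [coeff_tail', if_neg (by omega)]
  have h1 : z + v = init N z + verschiebung^[N] ((tail N z).shift N + v.shift N) := by
    conv_lhs => rw [← init_add_tail z N, eq_iterate_verschiebung h0, eq_iterate_verschiebung hv]
    rw [add_assoc, iterate_map_add]
  rw [h1, coeff_add_of_disjoint]
  · rw [coeff_init', if_neg (lt_irrefl _), zero_add]
    have h2 := iterate_verschiebung_coeff ((tail N z).shift N + v.shift N) N 0
    rw [zero_add] at h2
    rw [h2, add_coeff_zero, shift_coeff, shift_coeff, coeff_tail']
    simp
  · intro n
    rcases lt_or_ge n N with h | h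
    · right
      exact iterate_verschiebung_coeff_eq_zero _ h
    · left
      rw [coeff_init', if_neg (by omega)]

lemma coeff_add_sub_coeff_add {N : ℕ} (x : WittVector p S) {y y' : WittVector p S}
    (hy : ∀ i < N, y.coeff i = y'.coeff i) :
    (x + y).coeff N - (x + y').coeff N = y.coeff N - y'.coeff N := by
  have h : ∀ y : WittVector p S, (x + y).coeff N = (x + init N y).coeff N + y.coeff N := by
    intro y
    conv_lhs => rw [← init_add_tail y N, ← add_assoc]
    rw [coeff_add_of_forall_lt]
    · congr 1
      rw [coeff_tail', if_pos le_rfl]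
    · intro i hi
      rw [coeff_tail', if_neg (by omega)]
  have h2 : init N y = init N y' := by
    ext i
    rw [coeff_init', coeff_init']
    split_ifs with hi
    · exact hy i hi
    · rfl
  rw [h y, h y', h2]
  ring

end WittCoeff

section Flat

variable {A : Type*} [CommRing A]

lemma WReg.mvPolynomial (σ : Type*) {I : Ideal A} {zs : List A} (h : WReg I zs) :
    WReg (I.map (MvPolynomial.C : A →+* MvPolynomial σ A))
      (zs.map (MvPolynomial.C : A →+* MvPolynomial σ A)) := by
  induction zs generalizing I with
  | nil => trivial
  | cons z zs ih =>
    refine ⟨fun b hb => ?_, ?_⟩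
    · rw [MvPolynomial.mem_map_C_iff] at hb ⊢
      intro m
      have := hb m
      rw [MvPolynomial.coeff_C_mul] at this
      exact h.1 _ this
    · have := ih h.2
      rwa [Ideal.map_sup, map_span, Set.image_singleton] at this

open Polynomial in
lemma monic_nzd_map_C {I : Ideal A} {m b : A[X]} (hm : m.Monic) (h : m * b ∈ I.map C) :
    b ∈ I.map C := by
  have hk : I.map C = RingHom.ker (mapRingHom (Ideal.Quotient.mk I)) := by
    rw [Polynomial.ker_mapRingHom, Ideal.mk_ker]
  rw [hk, RingHom.mem_ker, map_mul] at h
  rw [hk, RingHom.mem_ker]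
  exact ((hm.map (Ideal.Quotient.mk I)).mul_right_eq_zero_iff).mp h

open Polynomial in
/-- A triangular monic system is regular. -/
lemma nzd_of_triangular {r : ℕ → A} {N : ℕ} (Φ : A →+* A[X]) (Ψ : A[X] →+* A)
    (hΨ : ∀ a, Ψ (Φ a) = a) (hC : ∀ a, Ψ (C (r a)) = r a)
    (hN : (Φ (r N)).Monic) (hlt : ∀ j < N, Φ (r j) = C (r j))
    {b : A} (hb : r N * b ∈ span (r '' {j | j < N})) : b ∈ span (r '' {j | j < N}) := by
  have h1 : (span (r '' {j | j < N})).map Φ = (span (r '' {j | j < N})).map C := by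
    rw [map_span, map_span, Set.image_image, Set.image_image]
    congr 1
    exact Set.image_congr fun j hj => hlt j hj
  have h2 := mem_map_of_mem Φ hb
  rw [map_mul, h1] at h2
  have h3 := mem_map_of_mem Ψ (monic_nzd_map_C hN h2)
  rw [hΨ, Ideal.map_map, map_span, Set.image_image] at h3
  simpa [hC] using h3

end Flat

section Union

variable {B : Type*} [CommRing B]

lemma WReg.iSup {I : ℕ → Ideal B} (hI : Monotone I) {zs : List B} (h : ∀ n, WReg (I n) zs) :
    WReg (⨆ n, I n) zs := by
  induction zs generalizing I with
  | nil => trivial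
  | cons z zs ih =>
    refine ⟨fun b hb => ?_, ?_⟩
    · rw [Submodule.mem_iSup_of_directed _ hI.directed_le] at hb ⊢
      obtain ⟨n, hn⟩ := hb
      exact ⟨n, (h n).1 b hn⟩
    · have h1 : (⨆ n, I n) ⊔ span {z} = ⨆ n, I n ⊔ span {z} := by
        rw [iSup_sup]
      rw [h1]
      exact ih (fun a b hab => sup_le_sup_right (hI hab) _) fun n => (h n).2

lemma wreg_span_range {r : ℕ → B} {zs : List B} (h : WReg ⊥ zs)
    (hr : ∀ N, ∀ l l', zs = l ++ l' → l ≠ [] → ∀ b,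
      r N * b ∈ span (r '' {j | j < N}) ⊔ ofList l → b ∈ span (r '' {j | j < N}) ⊔ ofList l) :
    WReg (span (Set.range r)) zs := by
  have h1 : ∀ N, WReg (span (r '' {j | j < N})) zs := by
    intro N
    induction N with
    | zero => simpa using h
    | succ N ih =>
      have := WReg.sup_of_nzd (hr N) ih
      convert this using 1
      rw [← span_union]
      congr 1
      ext x
      simp only [Set.mem_image, Set.mem_ofPred_eq, Set.mem_union, Set.mem_singleton_iff]
      constructor
      · rintro ⟨j, hj, rfl⟩
        rcases Nat.lt_succ_iff_lt_or_eq.mp hj with h | rfl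
        · exact Or.inl ⟨j, h, rfl⟩
        · exact Or.inr rfl
      · rintro (⟨j, hj, rfl⟩ | rfl)
        · exact ⟨j, hj.trans N.lt_succ_self, rfl⟩
        · exact ⟨N, N.lt_succ_self, rfl⟩
  have h2 : span (Set.range r) = ⨆ N, span (r '' {j | j < N}) := by
    rw [← Ideal.span_iUnion]
    congr 1
    ext x
    simp only [Set.mem_range, Set.mem_iUnion, Set.mem_image, Set.mem_ofPred_eq]
    constructor
    · rintro ⟨j, rfl⟩
      exact ⟨j + 1, j, j.lt_succ_self, rfl⟩
    · rintro ⟨N, j, _, rfl⟩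
      exact ⟨j, rfl⟩
  rw [h2]
  exact WReg.iSup (fun a b hab => span_mono (Set.image_mono fun j (hj : j < a) => hj.trans_le hab)) h1

end Union

end BigCM

namespace BigCM

open Ideal WittVector

section Rho

variable {p : ℕ} [hp : Fact p.Prime] {D S S' : Type*} [CommRing D] [CommRing S] [CommRing S']

/-- The generic root equation. -/
noncomputable def rho (f : Polynomial (WittVector p D)) (t : D) (φ : D →+* S) (x : ℕ → S) :
    WittVector p S :=
  f.eval₂ (WittVector.map φ) (teichmuller p (x 0)) +
    ((p : WittVector p S) - teichmuller p (φ t)) * WittVector.mk p fun i => x (i + 1)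

lemma map_rho (f : Polynomial (WittVector p D)) (t : D) (φ : D →+* S) (x : ℕ → S) (g : S →+* S') :
    WittVector.map g (rho f t φ x) = rho f t (g.comp φ) (g ∘ x) := by
  rw [rho, rho, map_add, map_mul, map_sub, map_natCast, map_teichmuller, Polynomial.hom_eval₂,
    map_teichmuller]
  rfl

lemma coeff_rho_map (f : Polynomial (WittVector p D)) (t : D) (φ : D →+* S) (x : ℕ → S)
    (g : S →+* S') (i : ℕ) :
    g ((rho f t φ x).coeff i) = (rho f t (g.comp φ) (g ∘ x)).coeff i := by
  rw [← map_rho, WittVector.map_coeff]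

variable {f : Polynomial (WittVector p D)} {t : D}

lemma rho_of_map_eq_zero {φ : D →+* S} (ht : φ t = 0) (x : ℕ → S) :
    rho f t φ x = f.eval₂ (WittVector.map φ) (teichmuller p (x 0)) +
      (WittVector.mk p fun i => x (i + 1)) * (p : WittVector p S) := by
  rw [rho, ht, teichmuller_zero, sub_zero, mul_comm]

variable [CharP S p]

lemma coeff_zero_rho {φ : D →+* S} (ht : φ t = 0) (x : ℕ → S) :
    (rho f t φ x).coeff 0 = f.eval₂ (φ.comp constantCoeff) (x 0) := by
  rw [rho_of_map_eq_zero ht, add_coeff_zero, mul_charP_coeff_zero, add_zero]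
  have h : ∀ w : WittVector p S, w.coeff 0 = constantCoeff w := fun _ => rfl
  rw [h, Polynomial.hom_eval₂]
  have h2 : ∀ d : S, constantCoeff (teichmuller p d) = d := teichmuller_coeff_zero p
  rw [h2]
  rfl

lemma coeff_mk_mul_congr {x x' : ℕ → S} {N : ℕ} (hx : ∀ i < N, x i = x' i) :
    ∀ i < N, ((WittVector.mk p fun i => x (i + 1)) * (p : WittVector p S)).coeff i =
      ((WittVector.mk p fun i => x' (i + 1)) * (p : WittVector p S)).coeff i := by
  intro i hi
  cases i with
  | zero => rw [mul_charP_coeff_zero, mul_charP_coeff_zero]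
  | succ i => rw [mul_charP_coeff_succ, mul_charP_coeff_succ, coeff_mk, coeff_mk, hx _ hi]

lemma coeff_rho_congr {φ : D →+* S} (ht : φ t = 0) {x x' : ℕ → S} {N : ℕ}
    (hx : ∀ i < N, x i = x' i) : ∀ i < N, (rho f t φ x).coeff i = (rho f t φ x').coeff i := by
  intro i hi
  rw [rho_of_map_eq_zero ht, rho_of_map_eq_zero ht, hx 0 (by omega)]
  exact coeff_add_congr (fun _ _ => rfl) (coeff_mk_mul_congr hx) i hi

lemma coeff_rho_sub {φ : D →+* S} (ht : φ t = 0) {x x' : ℕ → S} {N : ℕ}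
    (hx : ∀ i < N + 1, x i = x' i) :
    (rho f t φ x).coeff (N + 1) - (rho f t φ x').coeff (N + 1) =
      x (N + 1) ^ p - x' (N + 1) ^ p := by
  rw [rho_of_map_eq_zero ht, rho_of_map_eq_zero ht, hx 0 (by omega),
    coeff_add_sub_coeff_add _ (coeff_mk_mul_congr hx), mul_charP_coeff_succ, mul_charP_coeff_succ,
    coeff_mk, coeff_mk]

end Rho

section Generic

variable {p : ℕ} [hp : Fact p.Prime] {D A : Type*} [CommRing D] [CommRing A]

/-- The coefficients of the generic root equation. -/
noncomputable def rhoCoeff (f : Polynomial (WittVector p D)) (t : D) (φ : D →+* A) (i : ℕ) :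
    MvPolynomial ℕ A :=
  (rho f t (MvPolynomial.C.comp φ) MvPolynomial.X).coeff i

open Polynomial in
lemma rhoCoeff_nzd [CharP A p] {f : Polynomial (WittVector p D)} (hf : f.Monic) {t : D}
    {φ : D →+* A} (ht : φ t = 0) (N : ℕ) {b : MvPolynomial ℕ A}
    (hb : rhoCoeff f t φ N * b ∈ span (rhoCoeff f t φ '' {j | j < N})) :
    b ∈ span (rhoCoeff f t φ '' {j | j < N}) := by
  have := hp.out.pos
  let κ : A →+* (MvPolynomial ℕ A)[X] := C.comp MvPolynomial.C
  let x : ℕ → (MvPolynomial ℕ A)[X] := fun j => C (MvPolynomial.X j)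
  let Φ : MvPolynomial ℕ A →+* (MvPolynomial ℕ A)[X] :=
    MvPolynomial.eval₂Hom κ (Function.update x N X)
  let Ψ : (MvPolynomial ℕ A)[X] →+* MvPolynomial ℕ A := evalRingHom (MvPolynomial.X N)
  have ht' : (κ.comp φ) t = 0 := by simp [κ, ht]
  have hΦ : ∀ j, Φ (rhoCoeff f t φ j) =
      (rho f t (κ.comp φ) (Function.update x N X)).coeff j := by
    intro j
    rw [rhoCoeff, coeff_rho_map]
    congr 2
    · ext d : 1
      simp [Φ]
    · ext d : 1
      simp [Φ]
  have hCC : ∀ j, (C : MvPolynomial ℕ A →+* (MvPolynomial ℕ A)[X]) (rhoCoeff f t φ j) =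
      (rho f t (κ.comp φ) x).coeff j := by
    intro j
    rw [rhoCoeff, coeff_rho_map]
    rfl
  have hx : ∀ i < N, Function.update x N X i = x i := fun i hi =>
    Function.update_of_ne hi.ne _ _
  refine nzd_of_triangular Φ Ψ (fun a => ?_) (fun a => ?_) ?_ (fun j hj => ?_) hb
  · have : Ψ.comp Φ = RingHom.id _ := by
      apply MvPolynomial.ringHom_ext
      · intro a
        simp [Ψ, Φ, κ]
      · intro i
        by_cases h : i = N
        · subst h
          simp [Ψ, Φ, κ]
        · simp [Ψ, Φ, κ, Function.update_of_ne h, x]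
    exact congrArg (fun g => g a) this
  · simp [Ψ]
  · cases N with
    | zero =>
      rw [hΦ, coeff_zero_rho ht', Function.update_self]
      exact hf.map (((MvPolynomial.C : A →+* MvPolynomial ℕ A).comp φ).comp WittVector.constantCoeff)
    | succ N =>
      have h1 := coeff_rho_sub (f := f) ht' hx
      rw [← hΦ, ← hCC, Function.update_self, sub_eq_iff_eq_add] at h1
      rw [h1, show x (N + 1) ^ p = C (MvPolynomial.X (N + 1) ^ p) by simp [x], sub_add_eq_add_sub,
        add_sub_assoc, ← C_sub]
      exact monic_X_pow_add_C _ hp.out.ne_zero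
  · rw [hΦ, hCC]
    exact coeff_rho_congr ht' hx j hj

lemma rhoCoeff_map {A' : Type*} [CommRing A'] (f : Polynomial (WittVector p D)) (t : D) (φ : D →+* A)
    (g : A →+* A') (i : ℕ) : MvPolynomial.map g (rhoCoeff f t φ i) = rhoCoeff f t (g.comp φ) i := by
  rw [rhoCoeff, coeff_rho_map]
  congr 2
  · ext d : 1
    simp
  · ext d : 1
    simp

lemma rhoCoeff_eval₂ {A' : Type*} [CommRing A'] (f : Polynomial (WittVector p D)) (t : D)
    (φ : D →+* A) (g : A →+* A') (x : ℕ → A') (i : ℕ) :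
    MvPolynomial.eval₂Hom g x (rhoCoeff f t φ i) = (rho f t (g.comp φ) x).coeff i := by
  rw [rhoCoeff, coeff_rho_map]
  congr 2
  · ext d : 1
    simp
  · ext d : 1
    simp

lemma wreg_rho [CharP D p] {f : Polynomial (WittVector p D)} (hf : f.Monic) {t : D} {l : List D}
    (h : WReg ⊥ (t :: l)) :
    WReg (span (Set.range (rhoCoeff f t (RingHom.id D)))) ((t :: l).map MvPolynomial.C) := by
  refine wreg_span_range ?_ ?_
  · simpa only [Ideal.map_bot] using h.mvPolynomial ℕ
  · intro N k k' hk hk0 b hb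
    obtain ⟨m, m', hm, rfl, rfl⟩ := List.map_eq_append_iff.mp hk
    have htm : t ∈ ofList m := by
      cases m with
      | nil => simp at hk0
      | cons a m =>
        obtain ⟨rfl, -⟩ := List.cons.inj hm
        exact mem_ofList List.mem_cons_self
    rw [← map_ofList'] at hb ⊢
    by_cases htop : ofList m = ⊤
    · rw [htop, Ideal.map_top, sup_top_eq]
      trivial
    have : Nontrivial (D ⧸ ofList m) := Ideal.Quotient.nontrivial_iff.mpr htop
    have : CharP (D ⧸ ofList m) p := by
      rw [CharP.charP_iff_prime_eq_zero hp.out, ← map_natCast (Ideal.Quotient.mk _),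
        CharP.cast_eq_zero, map_zero]
    set π : MvPolynomial ℕ D →+* MvPolynomial ℕ (D ⧸ ofList m) :=
      MvPolynomial.map (Ideal.Quotient.mk (ofList m)) with hπ
    have hsurj : Function.Surjective π := MvPolynomial.map_surjective _ Ideal.Quotient.mk_surjective
    have hker : (⊥ : Ideal _).comap π = (ofList m).map MvPolynomial.C := by
      rw [← RingHom.ker_eq_comap_bot, hπ, MvPolynomial.ker_map, Ideal.mk_ker]
    have himg : (span (rhoCoeff f t (RingHom.id D) '' {j | j < N})).map π =
        span (rhoCoeff f t (Ideal.Quotient.mk (ofList m)) '' {j | j < N}) := by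
      rw [map_span, Set.image_image]
      simp only [hπ, rhoCoeff_map, RingHom.comp_id]
    have hcomap : span (rhoCoeff f t (RingHom.id D) '' {j | j < N}) ⊔
        (ofList m).map MvPolynomial.C =
        (span (rhoCoeff f t (Ideal.Quotient.mk (ofList m)) '' {j | j < N})).comap π := by
      rw [← himg, Ideal.comap_map_of_surjective π hsurj, hker]
    rw [hcomap, mem_comap] at hb ⊢
    refine rhoCoeff_nzd hf (Ideal.Quotient.eq_zero_iff_mem.mpr htm) N ?_
    rw [map_mul, hπ, rhoCoeff_map, RingHom.comp_id, ← hπ] at hb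
    exact hb

end Generic

end BigCM

namespace BigCM

open Ideal WittVector

section Adjoin

variable {p : ℕ} [hp : Fact p.Prime]

lemma isPerfectClosure_of (K : Type*) [CommRing K] [CharP K p] :
    (∀ d : PerfectClosure K p, ∃ (n : ℕ) (b : K), PerfectClosure.of K p b = d ^ p ^ n) ∧
      ∀ b : K, PerfectClosure.of K p b = 0 → ∃ n : ℕ, b ^ p ^ n = 0 := by
  refine ⟨fun d => ?_, fun b hb => ?_⟩
  · obtain ⟨⟨n, b⟩, rfl⟩ := PerfectClosure.mk_surjective K p d
    refine ⟨n, b, ?_⟩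
    rw [← PerfectClosure.iterate_frobenius_mk, ← coe_iterateFrobenius, iterateFrobenius_def]
  · rw [PerfectClosure.of_apply, PerfectClosure.zero_def, PerfectClosure.mk_eq_iff] at hb
    obtain ⟨n, hn⟩ := hb
    refine ⟨n, ?_⟩
    simpa [← coe_iterateFrobenius, iterateFrobenius_def, hp.out.ne_zero] using hn

lemma tau_zero {D : Type*} [CommRing D] (t : D) : tau p t 0 = 0 := by
  rw [tau_apply, teichmuller_zero, map_zero]

/-- Over an algebraically closed field, polynomials over the untilt at `0` have roots. -/
lemma exists_root_of_isAlgClosed {K : Type*} [Field K] [CharP K p] [IsAlgClosed K]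
    {f : Polynomial (Untilt p (0 : K))} (hf : f.Monic) (hd : f.natDegree ≠ 0) :
    ∃ y : K, f.eval (tau p 0 y) = 0 := by
  have hp0 : (p : Untilt p (0 : K)) = 0 := by
    rw [← tau_self, tau_zero]
  have hspan : span {(0 : K)} = ⊥ := by simp
  have hbij : Function.Bijective (Ideal.Quotient.mk (span {(0 : K)})) := by
    refine ⟨?_, Ideal.Quotient.mk_surjective⟩
    rw [RingHom.injective_iff_ker_eq_bot, Ideal.mk_ker, hspan]
  let e : K ≃+* K ⧸ span {(0 : K)} := RingEquiv.ofBijective _ hbij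
  let g : Untilt p (0 : K) →+* K := (e.symm : K ⧸ span {(0 : K)} →+* K).comp (untiltRed p 0)
  have hg : ∀ d, g (tau p 0 d) = d := fun d => by
    simp only [g, RingHom.comp_apply, untiltRed_tau]
    exact e.symm_apply_apply d
  have hginj : ∀ z, g z = 0 → z = 0 := by
    intro z hz
    obtain ⟨d, y, rfl⟩ := exists_sub_tau_mem z
    rw [hp0, zero_mul, add_zero] at hz ⊢
    rw [hg] at hz
    rw [hz, tau_zero]
  have hdeg : (f.map g).degree ≠ 0 := by
    intro h
    apply hd
    rw [← hf.natDegree_map g]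
    exact Polynomial.natDegree_eq_of_degree_eq_some h
  obtain ⟨y, hy⟩ := IsAlgClosed.exists_root (f.map g) hdeg
  refine ⟨y, hginj _ ?_⟩
  rw [Polynomial.IsRoot, Polynomial.eval_map] at hy
  rw [← Polynomial.eval₂_at_apply, hg, hy]

/-- Generic adjunction of a sharp root of a monic polynomial. -/
theorem exists_adjoin_tau {D : Type u} [CommRing D] [CharP D p] [PerfectRing D p] (t : D)
    (ht : span {t} ≠ ⊤) {f : Polynomial (Untilt p t)} (hf : f.Monic) (hd : f.natDegree ≠ 0) :
    ∃ (D₁ : Type u) (_ : CommRing D₁) (_ : CharP D₁ p) (_ : PerfectRing D₁ p) (t₁ : D₁)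
      (φ : D →+* D₁) (h : φ t = t₁) (y : D₁),
      f.eval₂ (untiltMap p φ h) (tau p t₁ y) = 0 ∧
      (∀ l, WReg ⊥ (t :: l) → WReg ⊥ (t₁ :: l.map φ)) ∧
      (∀ l, ofList (t :: l) ≠ ⊤ → ofList (t₁ :: l.map φ) ≠ ⊤) ∧
      ∀ (D' : Type u) [CommRing D'] [CharP D' p] [PerfectRing D' p] (t' : D') (φ' : D →+* D')
        (h' : φ' t = t') (y' : D'), f.eval₂ (untiltMap p φ' h') (tau p t' y') = 0 →
        ∃ θ : D₁ →+* D', θ.comp φ = φ' ∧ θ y = y' ∧ θ t₁ = t' := by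
  obtain ⟨F, hF, hFd, hFm⟩ := Polynomial.lifts_and_natDegree_eq_and_monic
    (Polynomial.map_surjective _ Ideal.Quotient.mk_surjective f) hf
  subst hF
  let r := rhoCoeff F t (RingHom.id D)
  let J := span (Set.range r)
  have univ : ∀ (D' : Type u) [CommRing D'] [CharP D' p] (t' : D') (φ' : D →+* D')
        (h' : φ' t = t') (y' : D'),
        (F.map (Ideal.Quotient.mk _)).eval₂ (untiltMap p φ' h') (tau p t' y') = 0 →
        ∃ θ : MvPolynomial ℕ D ⧸ J →+* D', (θ.comp ((Ideal.Quotient.mk J).comp MvPolynomial.C)) = φ' ∧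
          θ (Ideal.Quotient.mk J (MvPolynomial.X 0)) = y' := by
    intro D' _ _ t' φ' h' y' hy
    have h1 : F.eval₂ (WittVector.map φ') (teichmuller p y') ∈
        span {(p : WittVector p D') - teichmuller p t'} := by
      rw [← Ideal.Quotient.eq_zero_iff_mem, Polynomial.hom_eval₂, ← hy, Polynomial.eval₂_map]
      rfl
    obtain ⟨w, hw⟩ := mem_span_singleton'.mp h1
    let x : ℕ → D' := fun i => Nat.casesOn i y' fun i => (-w).coeff i
    have h2 : rho F t φ' x = 0 := by
      have : (WittVector.mk p fun i => x (i + 1)) = -w := by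
        ext i
        rw [coeff_mk]
      rw [rho, this, show x 0 = y' from rfl, ← hw, h']
      ring
    have h3 : ∀ a ∈ J, MvPolynomial.eval₂Hom φ' x a = 0 := by
      intro a ha
      have : J ≤ RingHom.ker (MvPolynomial.eval₂Hom φ' x) := by
        rw [Ideal.span_le]
        rintro _ ⟨i, rfl⟩
        rw [SetLike.mem_coe, RingHom.mem_ker]
        simp only [r]
        rw [rhoCoeff_eval₂, RingHom.comp_id, h2, zero_coeff]
      exact this ha
    refine ⟨Ideal.Quotient.lift J (MvPolynomial.eval₂Hom φ' x) h3, ?_, ?_⟩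
    · ext d
      simp
    · simp [x]
  have toField : ∀ l, ofList (t :: l) ≠ ⊤ → ∃ (K : Type u) (_ : Field K) (_ : CharP K p)
      (_ : IsAlgClosed K) (θ : MvPolynomial ℕ D ⧸ J →+* K),
      ∀ a ∈ t :: l, θ (Ideal.Quotient.mk J (MvPolynomial.C a)) = 0 := by
    intro l hl
    obtain ⟨M, hM, hle⟩ := Ideal.exists_le_maximal _ hl
    let _ : Field (D ⧸ M) := Ideal.Quotient.field M
    let K := AlgebraicClosure (D ⧸ M)
    let φ' : D →+* K := (algebraMap (D ⧸ M) K).comp (Ideal.Quotient.mk M)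
    have hφ : ∀ a ∈ t :: l, φ' a = 0 := fun a ha => by
      simp only [φ', RingHom.comp_apply, Ideal.Quotient.eq_zero_iff_mem.mpr (hle (mem_ofList ha)),
        map_zero]
    have hK : CharP K p := by
      rw [CharP.charP_iff_prime_eq_zero hp.out, ← map_natCast φ', CharP.cast_eq_zero, map_zero]
    have hnt : Nontrivial (Untilt p (0 : K)) := by
      have : Nontrivial (K ⧸ span {(0 : K)}) := Ideal.Quotient.nontrivial_iff.mpr (by simp)
      exact (untiltRed p (0 : K)).domain_nontrivial
    obtain ⟨y, hy⟩ := exists_root_of_isAlgClosed (p := p) (K := K)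
      (hf.map (untiltMap p φ' (hφ t List.mem_cons_self))) (by rwa [hf.natDegree_map])
    rw [Polynomial.eval_map] at hy
    obtain ⟨θ, h1, -⟩ := univ K 0 φ' (hφ t List.mem_cons_self) y hy
    refine ⟨K, inferInstance, hK, inferInstance, θ, fun a ha => ?_⟩
    rw [← hφ a ha, ← h1]
    rfl
  have hnt : Nontrivial (MvPolynomial ℕ D ⧸ J) := by
    obtain ⟨K, _, _, _, θ, -⟩ := toField [] (by simpa using ht)
    exact θ.domain_nontrivial
  have hchar : CharP (MvPolynomial ℕ D ⧸ J) p := by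
    rw [CharP.charP_iff_prime_eq_zero hp.out,
      ← map_natCast ((Ideal.Quotient.mk J).comp MvPolynomial.C), CharP.cast_eq_zero, map_zero]
  let D₁ := PerfectClosure (MvPolynomial ℕ D ⧸ J) p
  let ι : MvPolynomial ℕ D ⧸ J →+* D₁ := PerfectClosure.of _ p
  let φ : D →+* D₁ := ι.comp ((Ideal.Quotient.mk J).comp MvPolynomial.C)
  let y : D₁ := ι (Ideal.Quotient.mk J (MvPolynomial.X 0))
  refine ⟨D₁, inferInstance, inferInstance, inferInstance, φ t, φ, rfl, y, ?_, ?_, ?_, ?_⟩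
  · have h1 : rho F t φ (ι ∘ Ideal.Quotient.mk J ∘ MvPolynomial.X) = 0 := by
      ext i
      have := coeff_rho_map F t (MvPolynomial.C.comp (RingHom.id D)) MvPolynomial.X
        (ι.comp (Ideal.Quotient.mk J)) i
      rw [zero_coeff]
      refine Eq.trans this.symm ?_
      rw [RingHom.comp_apply]
      have h2 : Ideal.Quotient.mk J (r i) = 0 :=
        Ideal.Quotient.eq_zero_iff_mem.mpr (subset_span ⟨i, rfl⟩)
      exact (congrArg ι h2).trans (map_zero ι)
    have h2 := congrArg (Ideal.Quotient.mk (span {(p : WittVector p D₁) - teichmuller p (φ t)})) h1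
    rw [rho, map_add, map_mul, Ideal.Quotient.eq_zero_iff_mem.mpr (mem_span_singleton_self _),
      zero_mul, add_zero, Polynomial.hom_eval₂, map_zero] at h2
    rw [Polynomial.eval₂_map]
    exact h2
  · intro l hl
    have h1 := wreg_rho hFm hl
    rw [← Ideal.mk_ker (I := span (Set.range (rhoCoeff F t (RingHom.id D)))),
      RingHom.ker_eq_comap_bot, wreg_comap Ideal.Quotient.mk_surjective] at h1
    have h2 := wreg_of_isPerfectClosure p ι (isPerfectClosure_of _).1 (isPerfectClosure_of _).2 h1
    simpa [φ, Function.comp_def] using h2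
  · intro l hl h
    obtain ⟨K, _, _, _, θ, hθ⟩ := toField l hl
    let θ' : D₁ →+* K := PerfectClosure.lift _ p K θ
    have h1 : θ'.comp ι = θ := (PerfectClosure.lift _ p K).symm_apply_apply θ
    have h2 : ofList (φ t :: l.map φ) ≤ RingHom.ker θ' := by
      rw [← List.map_cons, ofList, Ideal.span_le]
      intro a ha
      obtain ⟨b, hb, rfl⟩ := List.mem_map.mp ha
      rw [SetLike.mem_coe, RingHom.mem_ker, ← hθ b hb, ← h1]
      rfl
    rw [h, top_le_iff] at h2
    exact RingHom.ker_ne_top θ' h2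
  · intro D' _ _ _ t' φ' h' y' hy
    obtain ⟨θ, h1, h2⟩ := univ D' t' φ' h' y' hy
    have h3 : (PerfectClosure.lift _ p D' θ).comp ι = θ :=
      (PerfectClosure.lift _ p D').symm_apply_apply θ
    have h4 : (PerfectClosure.lift _ p D' θ).comp φ = φ' := by
      rw [← h1, ← h3]
      rfl
    refine ⟨PerfectClosure.lift _ p D' θ, h4, ?_, ?_⟩
    · rw [← h2, ← h3]
      rfl
    · rw [← h', ← h4]
      rfl

end Adjoin

end BigCM

namespace BigCM

open Ideal WittVector

section Extensions

variable {p : ℕ} [hp : Fact p.Prime]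

/-- Extensions preserving proper regular sequences that start with the distinguished element. -/
structure GoodExt {D D₁ : Type*} [CommRing D] [CommRing D₁] (t : D) (φ : D →+* D₁) : Prop where
  wreg : ∀ l, WReg ⊥ (t :: l) → WReg ⊥ (φ t :: l.map φ)
  ne_top : ∀ l, ofList (t :: l) ≠ ⊤ → ofList (φ t :: l.map φ) ≠ ⊤

lemma GoodExt.id {D : Type*} [CommRing D] (t : D) : GoodExt t (RingHom.id D) :=
  ⟨fun l h => by simpa using h, fun l h => by simpa using h⟩

lemma GoodExt.comp {D D₁ D₂ : Type*} [CommRing D] [CommRing D₁] [CommRing D₂] {t : D}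
    {φ : D →+* D₁} {φ' : D₁ →+* D₂} (h' : GoodExt (φ t) φ') (h : GoodExt t φ) :
    GoodExt t (φ'.comp φ) :=
  ⟨fun l hl => by simpa using h'.wreg _ (h.wreg l hl),
    fun l hl => by simpa using h'.ne_top _ (h.ne_top l hl)⟩

lemma untiltMap_comp {D D₁ D₂ : Type*} [CommRing D] [CommRing D₁] [CommRing D₂] {t : D}
    (φ : D →+* D₁) (φ' : D₁ →+* D₂) {t₂ : D₂} (h : φ' (φ t) = t₂) :
    (untiltMap p φ' h).comp (untiltMap p φ rfl) =
      untiltMap p (φ'.comp φ) (t := t) (t' := t₂) h := by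
  ext x
  exact untiltMap_untiltMap (p := p) φ φ' rfl h x

/-- Simultaneous adjunction of sharp roots, generic over prescribed roots in another ring. -/
theorem exists_adjoin_list {D' : Type u} [CommRing D'] [CharP D' p] [PerfectRing D' p] (t' : D')
    {D : Type u} [CommRing D] [CharP D p] [PerfectRing D p] (t : D) (ht : span {t} ≠ ⊤)
    (g : D →+* D') (hg : g t = t') (L : List (Polynomial (Untilt p t) × D'))
    (hL : ∀ q ∈ L, q.1.Monic ∧ q.1.natDegree ≠ 0 ∧
      q.1.eval₂ (untiltMap p g hg) (tau p t' q.2) = 0) :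
    ∃ (D₁ : Type u) (_ : CommRing D₁) (_ : CharP D₁ p) (_ : PerfectRing D₁ p)
      (φ : D →+* D₁) (θ : D₁ →+* D'), GoodExt t φ ∧ θ.comp φ = g ∧
      ∀ q ∈ L, ∃ y, q.1.eval₂ (untiltMap p φ rfl) (tau p (φ t) y) = 0 ∧ θ y = q.2 := by
  induction L with
  | nil => exact ⟨D, _, ‹_›, ‹_›, RingHom.id D, g, GoodExt.id t, rfl, by simp⟩
  | cons q L ih =>
    obtain ⟨D₁, _, _, _, φ, θ, h1, h2, h3⟩ := ih fun q' hq' => hL q' (List.mem_cons_of_mem _ hq')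
    obtain ⟨hm, hd, hr⟩ := hL q List.mem_cons_self
    have ht₁ : span {φ t} ≠ ⊤ := by simpa using h1.ne_top [] (by simpa using ht)
    have hθ : θ (φ t) = t' := by rw [← hg, ← h2]; rfl
    have : Nontrivial (Untilt p (φ t)) := by
      have : Nontrivial (D₁ ⧸ span {φ t}) := Ideal.Quotient.nontrivial_iff.mpr ht₁
      exact (untiltRed p (φ t)).domain_nontrivial
    obtain ⟨D₂, _, _, _, t₂, φ₂, hφ₂, y, a1, a2, a3, a4⟩ := exists_adjoin_tau (p := p) (φ t) ht₁
      (hm.map (untiltMap p φ rfl)) (by rwa [hm.natDegree_map])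
    subst hφ₂
    obtain ⟨θ₂, b1, b2, b3⟩ := a4 D' t' θ hθ q.2 (by
      rw [Polynomial.eval₂_map, untiltMap_comp]
      subst h2
      exact hr)
    refine ⟨D₂, inferInstance, inferInstance, inferInstance, φ₂.comp φ, θ₂,
      GoodExt.comp ⟨a2, a3⟩ h1, ?_, ?_⟩
    · rw [← RingHom.comp_assoc, b1, h2]
    · intro q' hq'
      rcases List.mem_cons.mp hq' with rfl | hq'
      · refine ⟨y, ?_, b2⟩
        rw [Polynomial.eval₂_map, untiltMap_comp] at a1
        exact a1
      · obtain ⟨z, hz, hz'⟩ := h3 q' hq'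
        refine ⟨φ₂ z, ?_, ?_⟩
        · have := congrArg (untiltMap p φ₂ rfl) hz
          rw [Polynomial.hom_eval₂, untiltMap_comp, map_zero, untiltMap_tau] at this
          exact this
        · rw [← hz', ← b1]
          rfl

/-- A monic polynomial splits, with sharp roots, over some good extension. -/
theorem exists_splits {D : Type u} [CommRing D] [CharP D p] [PerfectRing D p] (t : D)
    (ht : span {t} ≠ ⊤) {f : Polynomial (Untilt p t)} (hf : f.Monic) :
    ∃ (D₁ : Type u) (_ : CommRing D₁) (_ : CharP D₁ p) (_ : PerfectRing D₁ p)
      (φ : D →+* D₁), GoodExt t φ ∧ ∃ s : List D₁, f.map (untiltMap p φ rfl) =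
        (s.map fun y => Polynomial.X - Polynomial.C (tau p (φ t) y)).prod := by
  obtain ⟨n, hn⟩ : ∃ n, f.natDegree = n := ⟨_, rfl⟩
  induction n generalizing D with
  | zero =>
    refine ⟨D, _, ‹_›, ‹_›, RingHom.id D, GoodExt.id t, [], ?_⟩
    rw [hf.natDegree_eq_zero.mp hn]
    simp
  | succ n ih =>
    obtain ⟨D₁, _, _, _, _, φ, rfl, y, a1, a2, a3, -⟩ := exists_adjoin_tau (p := p) t ht hf
      (by omega)
    have hg : GoodExt t φ := ⟨a2, a3⟩
    have ht₁ : span {φ t} ≠ ⊤ := by simpa using hg.ne_top [] (by simpa using ht)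
    have : Nontrivial (Untilt p (φ t)) := by
      have : Nontrivial (D₁ ⧸ span {φ t}) := Ideal.Quotient.nontrivial_iff.mpr ht₁
      exact (untiltRed p (φ t)).domain_nontrivial
    have hdvd : Polynomial.X - Polynomial.C (tau p (φ t) y) ∣ f.map (untiltMap p φ rfl) := by
      rw [Polynomial.dvd_iff_isRoot, Polynomial.IsRoot, Polynomial.eval_map, a1]
    obtain ⟨f', hf'⟩ := hdvd
    have hm := hf.map (untiltMap p φ rfl)
    rw [hf'] at hm
    have hm' := (Polynomial.monic_X_sub_C _).of_mul_monic_left hm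
    have hdeg : f'.natDegree = n := by
      have h1 := hf.natDegree_map (untiltMap p φ rfl)
      rw [hf', (Polynomial.monic_X_sub_C _).natDegree_mul hm', Polynomial.natDegree_X_sub_C] at h1
      omega
    obtain ⟨D₂, _, _, _, φ₂, hg₂, s, hs⟩ := ih (φ t) ht₁ hm' hdeg
    refine ⟨D₂, inferInstance, inferInstance, inferInstance, φ₂.comp φ, hg₂.comp hg,
      φ₂ y :: s, ?_⟩
    have := congrArg (Polynomial.map (untiltMap p φ₂ rfl)) hf'
    rw [Polynomial.map_map, untiltMap_comp, Polynomial.map_mul, hs, Polynomial.map_sub,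
      Polynomial.map_X, Polynomial.map_C, untiltMap_tau] at this
    rw [List.map_cons, List.prod_cons]
    exact this

theorem exists_splits_list {D : Type u} [CommRing D] [CharP D p] [PerfectRing D p] (t : D)
    (ht : span {t} ≠ ⊤) (L : List (Polynomial (Untilt p t))) (hL : ∀ f ∈ L, f.Monic) :
    ∃ (D₁ : Type u) (_ : CommRing D₁) (_ : CharP D₁ p) (_ : PerfectRing D₁ p)
      (φ : D →+* D₁), GoodExt t φ ∧ ∀ f ∈ L, ∃ s : List D₁, f.map (untiltMap p φ rfl) =
        (s.map fun y => Polynomial.X - Polynomial.C (tau p (φ t) y)).prod := by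
  induction L with
  | nil => exact ⟨D, _, ‹_›, ‹_›, RingHom.id D, GoodExt.id t, by simp⟩
  | cons f L ih =>
    obtain ⟨D₁, _, _, _, φ, hg, h1⟩ := ih fun q' hq' => hL q' (List.mem_cons_of_mem _ hq')
    have ht₁ : span {φ t} ≠ ⊤ := by simpa using hg.ne_top [] (by simpa using ht)
    obtain ⟨D₂, _, _, _, φ₂, hg₂, s, hs⟩ := exists_splits (φ t) ht₁
      ((hL f List.mem_cons_self).map (untiltMap p φ rfl))
    rw [Polynomial.map_map, untiltMap_comp] at hs
    refine ⟨D₂, inferInstance, inferInstance, inferInstance, φ₂.comp φ, hg₂.comp hg, ?_⟩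
    intro q hq
    rcases List.mem_cons.mp hq with rfl | hq
    · exact ⟨s, hs⟩
    · obtain ⟨s', hs'⟩ := h1 q hq
      refine ⟨s'.map φ₂, ?_⟩
      have := congrArg (Polynomial.map (untiltMap p φ₂ rfl)) hs'
      rw [Polynomial.map_map, untiltMap_comp, Polynomial.map_list_prod, List.map_map] at this
      refine this.trans ?_
      rw [List.map_map]
      congr 2
      ext1 y
      simp only [Function.comp_apply, Polynomial.map_sub, Polynomial.map_X, Polynomial.map_C,
        untiltMap_tau]
      rfl

/-- Finitely many elements become sharp over some good extension. -/
theorem exists_tau_list {D : Type u} [CommRing D] [CharP D p] [PerfectRing D p] (t : D)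
    (ht : span {t} ≠ ⊤) (L : List (Untilt p t)) :
    ∃ (D₁ : Type u) (_ : CommRing D₁) (_ : CharP D₁ p) (_ : PerfectRing D₁ p)
      (φ : D →+* D₁), GoodExt t φ ∧ ∀ c ∈ L, ∃ y, untiltMap p φ rfl c = tau p (φ t) y := by
  induction L with
  | nil => exact ⟨D, _, ‹_›, ‹_›, RingHom.id D, GoodExt.id t, by simp⟩
  | cons c L ih =>
    obtain ⟨D₁, _, _, _, φ, hg, h1⟩ := ih
    have ht₁ : span {φ t} ≠ ⊤ := by simpa using hg.ne_top [] (by simpa using ht)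
    have : Nontrivial (Untilt p (φ t)) := by
      have : Nontrivial (D₁ ⧸ span {φ t}) := Ideal.Quotient.nontrivial_iff.mpr ht₁
      exact (untiltRed p (φ t)).domain_nontrivial
    obtain ⟨D₂, _, _, _, _, φ₂, rfl, y, a1, a2, a3, -⟩ := exists_adjoin_tau (p := p) (φ t) ht₁
      (Polynomial.monic_X_sub_C (untiltMap p φ rfl c)) (by rw [Polynomial.natDegree_X_sub_C]; simp)
    have hg₂ : GoodExt (φ t) φ₂ := ⟨a2, a3⟩
    refine ⟨D₂, inferInstance, inferInstance, inferInstance, φ₂.comp φ, hg₂.comp hg, ?_⟩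
    intro q hq
    rcases List.mem_cons.mp hq with rfl | hq
    · refine ⟨y, ?_⟩
      rw [Polynomial.eval₂_sub, Polynomial.eval₂_X, Polynomial.eval₂_C, sub_eq_zero] at a1
      rw [← untiltMap_comp φ φ₂ rfl]
      exact a1.symm
    · obtain ⟨z, hz⟩ := h1 q hq
      refine ⟨φ₂ z, ?_⟩
      have := congrArg (untiltMap p φ₂ rfl) hz
      rw [untiltMap_untiltMap, untiltMap_tau] at this
      exact this

end Extensions

end BigCM

namespace BigCM

open Ideal WittVector

section PolyData

open Polynomial

/-- Auxiliary polynomials attached to an integral fraction `a / e`. -/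
lemma exists_poly_data {F : Type*} [CommRing F] [Nontrivial F] (e a : F) {χ : F[X]}
    (hm : χ.Monic) (hd : χ.natDegree ≠ 0) (h : (χ.scaleRoots e).eval a = 0) :
    ∃ (G c : F[X]) (n : ℕ), G.Monic ∧ G.natDegree ≠ 0 ∧
      c * (C e * X - C a) = C (e ^ n) * G ∧
      (∀ (K : Type u) [Field K] (k : F →+* K), k e ≠ 0 → G.eval₂ k (k a / k e) = 0) ∧
      ∀ (T : Type u) [CommRing T] (k : F →+* T) (ζ : T), k e * ζ = k a →
        c.eval₂ k ζ = k e ^ n := by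
  obtain ⟨v, hv⟩ := dvd_iff_isRoot.mpr h
  have hcomp : C e ^ χ.natDegree * χ = (C e * X - C a) * v.eval₂ C (C e * X) := by
    have h1 := scaleRoots_eval₂_mul (p := χ) (f := (C : F →+* F[X])) X e
    rw [eval₂_C_X, hv, eval₂_mul, eval₂_sub, eval₂_X, eval₂_C] at h1
    exact h1.symm
  have hdeg : (C e * X - C a).degree < (χ ^ 2).degree := by
    have h1 : (C e * X - C a).degree ≤ 1 := by
      rw [sub_eq_add_neg, ← C_neg]
      exact degree_linear_le
    refine h1.trans_lt ?_
    rw [degree_eq_natDegree (hm.pow 2).ne_zero, hm.natDegree_pow]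
    exact_mod_cast (by omega : 1 < 2 * χ.natDegree)
  refine ⟨χ ^ 2 + (C e * X - C a), (C e * X - C a) * v.eval₂ C (C e * X) ^ 2 +
    C e ^ (2 * χ.natDegree), 2 * χ.natDegree, (hm.pow 2).add_of_left hdeg, ?_, ?_, ?_, ?_⟩
  · rw [natDegree_add_eq_left_of_degree_lt hdeg, hm.natDegree_pow]
    omega
  · rw [C_pow]
    linear_combination (-(C e ^ χ.natDegree * χ) - (C e * X - C a) * v.eval₂ C (C e * X)) * hcomp
  · intro K _ k hk
    have h1 := scaleRoots_eval₂_mul (p := χ) (f := k) (k a / k e) e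
    rw [mul_div_cancel₀ _ hk, eval₂_at_apply, h, map_zero] at h1
    have h2 : χ.eval₂ k (k a / k e) = 0 :=
      (mul_eq_zero.mp h1.symm).resolve_left (pow_ne_zero _ hk)
    simp [eval₂_add, eval₂_pow, h2, eval₂_sub, eval₂_mul, mul_div_cancel₀ _ hk]
  · intro T _ k ζ hζ
    simp [eval₂_add, eval₂_pow, eval₂_sub, eval₂_mul, hζ]

end PolyData

section Sharp

variable {p : ℕ} [hp : Fact p.Prime]

lemma exists_split_sharp {D : Type u} [CommRing D] [CharP D p] [PerfectRing D p] (t : D)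
    (ht : span {t} ≠ ⊤) {F : Type*} [CommRing F] (δ : F →+* Untilt p t) (e : F)
    (L : List (Polynomial F × Polynomial F)) (hL : ∀ q ∈ L, q.1.Monic) :
    ∃ (D₁ : Type u) (_ : CommRing D₁) (_ : CharP D₁ p) (_ : PerfectRing D₁ p)
      (φ : D →+* D₁), GoodExt t φ ∧ (∃ y, untiltMap p φ rfl (δ e) = tau p (φ t) y) ∧
      ∀ q ∈ L, ∃ s : List D₁, q.1.map ((untiltMap p φ rfl).comp δ) =
        (s.map fun y => Polynomial.X - Polynomial.C (tau p (φ t) y)).prod ∧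
        ∀ y ∈ s, ∃ y', q.2.eval₂ ((untiltMap p φ rfl).comp δ) (tau p (φ t) y) =
          tau p (φ t) y' := by
  obtain ⟨D₁, _, _, _, φ, hg, h1⟩ := exists_splits_list t ht (L.map fun q => q.1.map δ) (by
    intro f hf
    obtain ⟨q, hq, rfl⟩ := List.mem_map.mp hf
    exact (hL q hq).map δ)
  have ht₁ : span {φ t} ≠ ⊤ := by simpa using hg.ne_top [] (by simpa using ht)
  have h2 : ∀ q : Polynomial F × Polynomial F, ∃ s : List D₁, q ∈ L →
      (q.1.map δ).map (untiltMap p φ rfl) =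
        (s.map fun y => Polynomial.X - Polynomial.C (tau p (φ t) y)).prod := by
    intro q
    by_cases hq : q ∈ L
    · obtain ⟨s, hs⟩ := h1 _ (List.mem_map.mpr ⟨q, hq, rfl⟩)
      exact ⟨s, fun _ => hs⟩
    · exact ⟨[], fun h => absurd h hq⟩
  choose s hs using h2
  obtain ⟨D₂, _, _, _, φ₂, hg₂, h3⟩ := exists_tau_list (φ t) ht₁ (untiltMap p φ rfl (δ e) ::
    L.flatMap fun q => (s q).map fun y =>
      q.2.eval₂ ((untiltMap p φ rfl).comp δ) (tau p (φ t) y))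
  refine ⟨D₂, inferInstance, inferInstance, inferInstance, φ₂.comp φ, hg₂.comp hg, ?_, ?_⟩
  · obtain ⟨y, hy⟩ := h3 _ List.mem_cons_self
    rw [untiltMap_untiltMap] at hy
    exact ⟨y, hy⟩
  · intro q hq
    refine ⟨(s q).map φ₂, ?_, ?_⟩
    · have := congrArg (Polynomial.map (untiltMap p φ₂ rfl)) (hs q hq)
      rw [Polynomial.map_map, Polynomial.map_map, untiltMap_comp, Polynomial.map_list_prod,
        List.map_map] at this
      refine this.trans ?_
      rw [List.map_map]
      congr 2
      ext1 y
      simp only [Function.comp_apply, Polynomial.map_sub, Polynomial.map_X, Polynomial.map_C,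
        untiltMap_tau]
      rfl
    · intro y hy
      obtain ⟨z, hz, rfl⟩ := List.mem_map.mp hy
      obtain ⟨w, hw⟩ := h3 _ (List.mem_cons_of_mem _ (List.mem_flatMap.mpr
        ⟨q, hq, List.mem_map.mpr ⟨z, hz, rfl⟩⟩))
      rw [Polynomial.hom_eval₂, ← RingHom.comp_assoc, untiltMap_comp, untiltMap_tau] at hw
      exact ⟨w, hw⟩

end Sharp

end BigCM

namespace BigCM

open Ideal WittVector

section Target

variable {p : ℕ} [hp : Fact p.Prime]

/-- A family in which the only element of `A'` infinitely close to zero is zero. -/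
def Separates (p : ℕ) {A' : Type u} [CommRing A'] (ws : List A') : Prop :=
  ∀ (E : Type u) [CommRing E] (k : A' →+* E), PReg ((p : E) :: ws.map k) →
    ofList ((p : E) :: ws.map k) ≠ ⊤ →
    ∀ a, (∀ N, k a ∈ ofList ((p : E) :: ws.map k) ^ N) → a = 0

lemma preg_good {D₀ D : Type u} [CommRing D₀] [CommRing D] [CharP D p] [PerfectRing D p]
    {t₀ : D₀} {φ : D₀ →+* D} (hφ : GoodExt t₀ φ) {xs : List D₀}
    (h : ∀ l', l'.Perm xs → WReg ⊥ (t₀ :: l')) :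
    PReg ((p : Untilt p (φ t₀)) :: (xs.map φ).map (tau p (φ t₀))) := by
  refine preg_untilt fun l' hl' => ?_
  obtain ⟨l, h1, h2⟩ : ∃ l : List D₀, l.Perm xs ∧ l.map φ = l' := by
    obtain ⟨l, hl, h1⟩ := (congrFun (congrFun (List.eq_map_comp_perm (⇑φ)) l') xs).mpr hl'
    exact ⟨l, h1, hl.symm⟩
  rw [← h2]
  exact hφ.wreg _ (h l h1)

theorem exists_target {A' F R D₀ : Type u} [CommRing A'] [IsDomain A'] [CommRing F]
    [CommRing D₀] [CharP D₀ p] [PerfectRing D₀ p] {h : Polynomial A'} (hm : h.Monic)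
    (hd : h.natDegree ≠ 0) [IsDomain (AdjoinRoot h)] (π : F →+* AdjoinRoot h) (e : F)
    (he : π e ≠ 0) (S : Finset R) (G c : R → Polynomial F) (a : R → F)
    (hG : ∀ r ∈ S, (G r).Monic)
    (hGr : ∀ r ∈ S, ∀ (K : Type u) [Field K] (k : F →+* K), k e ≠ 0 →
      (G r).eval₂ k (k (a r) / k e) = 0)
    (hc : ∀ r ∈ S, ∃ n : ℕ, ∀ (T : Type u) [CommRing T] (k : F →+* T) (ζ : T),
      k e * ζ = k (a r) → (c r).eval₂ k ζ = k e ^ n)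
    (t : D₀) (κ : A' →+* Untilt p t) (xs : List D₀) (ws : List A')
    (hws : ws.map κ = xs.map (tau p t)) (hreg : ∀ l', l'.Perm xs → WReg ⊥ (t :: l'))
    (hne : ofList (t :: xs) ≠ ⊤) (hH : Separates p ws) :
    ∃ (D : Type u) (_ : CommRing D) (_ : CharP D p) (_ : PerfectRing D p) (φ : D₀ →+* D)
      (δ : AdjoinRoot h →+* Untilt p (φ t)) (yh ye : D) (y yc : R → D), GoodExt t φ ∧
      δ.comp (AdjoinRoot.of h) = (untiltMap p φ rfl).comp κ ∧
      δ (AdjoinRoot.root h) = tau p (φ t) yh ∧ δ (π e) = tau p (φ t) ye ∧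
      (∀ r ∈ S, (G r).eval₂ (δ.comp π) (tau p (φ t) (y r)) = 0) ∧
      (∀ r ∈ S, (c r).eval₂ (δ.comp π) (tau p (φ t) (y r)) = tau p (φ t) (yc r)) ∧
      ∀ n, ∃ k, (δ (π e) * ∏ r ∈ S, (c r).eval₂ (δ.comp π) (tau p (φ t) (y r))) ^ n ∉
        ofList ((p : Untilt p (φ t)) :: ws.map (δ.comp (AdjoinRoot.of h))) ^ k := by
  classical
  have htop : ∀ (D : Type u) [CommRing D] (φ : D₀ →+* D), GoodExt t φ → span {φ t} ≠ ⊤ := by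
    intro D _ φ hφ h1
    refine hφ.ne_top xs hne (top_le_iff.mp (h1 ▸ ?_))
    rw [Ideal.span_singleton_le_iff_mem]
    exact mem_ofList List.mem_cons_self
  have ht : span {t} ≠ ⊤ := htop D₀ (RingHom.id D₀) (GoodExt.id t)
  have hnt : ∀ (D : Type u) [CommRing D] [CharP D p] [PerfectRing D p] (φ : D₀ →+* D), GoodExt t φ →
      Nontrivial (Untilt p (φ t)) := by
    intro D _ _ _ φ hφ
    have : Nontrivial (D ⧸ span {φ t}) := Ideal.Quotient.nontrivial_iff.mpr (htop D φ hφ)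
    exact (untiltRed p (φ t)).domain_nontrivial
  have : Nontrivial (Untilt p t) := hnt D₀ (RingHom.id D₀) (GoodExt.id t)
  obtain ⟨D₁, _, _, _, _, φ₁, rfl, y₁, a1, a2, a3, -⟩ := exists_adjoin_tau (p := p) t ht
    (hm.map κ) (by rwa [hm.natDegree_map])
  have hφ₁ : GoodExt t φ₁ := ⟨a2, a3⟩
  rw [Polynomial.eval₂_map] at a1
  let δ₁ : AdjoinRoot h →+* Untilt p (φ₁ t) :=
    AdjoinRoot.lift ((untiltMap p φ₁ rfl).comp κ) (tau p (φ₁ t) y₁) a1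
  obtain ⟨D, _, _, _, φ₂, hφ₂, ⟨ye, hye⟩, hsp⟩ := exists_split_sharp (φ₁ t) (htop _ _ hφ₁)
    (δ₁.comp π) e (S.toList.map fun r => (G r, c r)) (by
      intro q hq
      obtain ⟨r, hr, rfl⟩ := List.mem_map.mp hq
      exact hG r (Finset.mem_toList.mp hr))
  have hφ : GoodExt t (φ₂.comp φ₁) := hφ₂.comp hφ₁
  let δ : AdjoinRoot h →+* Untilt p ((φ₂.comp φ₁) t) := (untiltMap p φ₂ rfl).comp δ₁
  have hδof : δ.comp (AdjoinRoot.of h) = (untiltMap p (φ₂.comp φ₁) rfl).comp κ := by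
    have h1 : δ₁.comp (AdjoinRoot.of h) = (untiltMap p φ₁ rfl).comp κ :=
      AdjoinRoot.lift_comp_of a1
    rw [RingHom.comp_assoc, h1, ← RingHom.comp_assoc, untiltMap_comp]
  have hδroot : δ (AdjoinRoot.root h) = tau p _ (φ₂ y₁) := by
    simp only [δ, RingHom.comp_apply, δ₁, AdjoinRoot.lift_root, untiltMap_tau]
  let E := Untilt p ((φ₂.comp φ₁) t)
  set J : Ideal E := ofList ((p : E) :: ws.map (δ.comp (AdjoinRoot.of h))) with hJ
  have hwsE : ws.map (δ.comp (AdjoinRoot.of h)) = (xs.map (φ₂.comp φ₁)).map (tau p _) := by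
    have h1 : ws.map (δ.comp (AdjoinRoot.of h)) =
        (ws.map κ).map (untiltMap p (φ₂.comp φ₁) rfl) := by
      rw [List.map_map, hδof]
      rfl
    rw [h1, hws, List.map_map, List.map_map]
    congr 1
    ext1 x
    exact untiltMap_tau ..
  have hinj : ∀ b : A', (∀ N, δ (AdjoinRoot.of h b) ∈ J ^ N) → b = 0 := by
    refine hH E (δ.comp (AdjoinRoot.of h)) ?_ ?_
    · rw [hwsE]
      exact preg_good hφ hreg
    · rw [hwsE]
      exact ofList_untilt_ne_top (by simpa using hφ.ne_top xs hne)
  let M : Submonoid E := (nonZeroDivisors A').map (δ.comp (AdjoinRoot.of h))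
  obtain ⟨P, hP, hHP, hPM⟩ := Ideal.exists_le_prime_disjoint (⨅ N, J ^ N) M (by
    rw [Set.disjoint_left]
    rintro _ hx ⟨b, hb, rfl⟩
    exact nonZeroDivisors.ne_zero hb (hinj b fun N => (Ideal.mem_iInf.mp hx) N))
  have heP : δ (π e) ∉ P := by
    intro h1
    have : Algebra.IsIntegral A' (AdjoinRoot h) := by
      have := hm.finite_adjoinRoot
      infer_instance
    have h2 : (P.comap δ).comap (algebraMap A' (AdjoinRoot h)) ≠ ⊥ :=
      Ideal.comap_ne_bot_of_integral_mem he h1 (Algebra.IsIntegral.isIntegral _)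
    obtain ⟨b, hb, hb0⟩ := Submodule.exists_mem_ne_zero_of_ne_bot h2
    exact Set.disjoint_left.mp hPM hb ⟨b, mem_nonZeroDivisors_of_ne_zero hb0, rfl⟩
  let K := FractionRing (E ⧸ P)
  let k : E →+* K := (algebraMap (E ⧸ P) K).comp (Ideal.Quotient.mk P)
  have hk : ∀ x, k x = 0 ↔ x ∈ P := by
    intro x
    rw [RingHom.comp_apply, map_eq_zero_iff _ (IsFractionRing.injective (E ⧸ P) K),
      Ideal.Quotient.eq_zero_iff_mem]
  have hke : k (δ (π e)) ≠ 0 := fun h1 => heP ((hk _).mp h1)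
  have key : ∀ r, ∃ y yc : D, r ∈ S →
      (G r).eval₂ (δ.comp π) (tau p _ y : E) = 0 ∧
      (c r).eval₂ (δ.comp π) (tau p _ y : E) = tau p _ yc ∧
      (c r).eval₂ (δ.comp π) (tau p _ y : E) ∉ P := by
    intro r
    by_cases hr : r ∈ S
    swap
    · exact ⟨0, 0, fun h1 => absurd h1 hr⟩
    obtain ⟨s, hs, hsc⟩ := hsp _ (List.mem_map.mpr ⟨r, Finset.mem_toList.mpr hr, rfl⟩)
    have hs' : (G r).map (δ.comp π) =
        (s.map fun y => Polynomial.X - Polynomial.C (tau p ((φ₂.comp φ₁) t) y)).prod := hs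
    have h1 := hGr r hr K (k.comp (δ.comp π)) hke
    rw [← Polynomial.eval₂_map, hs', ← Polynomial.coe_eval₂RingHom, map_list_prod,
      List.prod_eq_zero_iff, List.map_map, List.mem_map] at h1
    obtain ⟨y, hy, hy0⟩ := h1
    obtain ⟨yc, hyc⟩ := hsc y hy
    refine ⟨y, yc, fun _ => ⟨?_, hyc, ?_⟩⟩
    · rw [← Polynomial.eval_map, hs', ← Polynomial.coe_evalRingHom, map_list_prod,
        List.map_map]
      refine List.prod_eq_zero (List.mem_map.mpr ⟨y, hy, ?_⟩)
      simp
    · obtain ⟨n, hn⟩ := hc r hr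
      simp only [Function.comp_apply, Polynomial.coe_eval₂RingHom, Polynomial.eval₂_sub,
        Polynomial.eval₂_X, Polynomial.eval₂_C, sub_eq_zero] at hy0
      have h2 := hn K (k.comp (δ.comp π)) (k (tau p _ y)) (by
        rw [← hy0]
        exact mul_div_cancel₀ _ hke)
      rw [← Polynomial.hom_eval₂] at h2
      rw [← hk, h2]
      exact pow_ne_zero _ hke
  choose y yc hy using key
  refine ⟨D, inferInstance, inferInstance, inferInstance, φ₂.comp φ₁, δ, φ₂ y₁, ye, y, yc, hφ,
    hδof, hδroot, hye, fun r hr => (hy r hr).1, fun r hr => (hy r hr).2.1, fun n => ?_⟩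
  by_contra! hcon
  have h1 := hHP (Ideal.mem_iInf.mpr hcon)
  rcases hP.mem_or_mem (hP.mem_of_pow_mem _ h1) with h2 | h2
  · exact heP h2
  · obtain ⟨r, hr, h3⟩ := (hP.prod_mem_iff).mp h2
    exact (hy r hr).2.2 h3

end Target

end BigCM

namespace BigCM

open Ideal WittVector

section Source

variable {p : ℕ} [hp : Fact p.Prime]

lemma exists_tau_roots {D : Type u} [CommRing D] [CharP D p] [PerfectRing D p] (t y : D) :
    ∃ γ : ℕ → Untilt p t, ∀ k, γ k ^ p ^ k = tau p t y := by
  refine ⟨fun k => tau p t ((iterateFrobeniusEquiv D p k).symm y), fun k => ?_⟩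
  rw [← map_pow, ← iterateFrobeniusEquiv_def, RingEquiv.apply_symm_apply]

lemma map_untiltMap_tau {D D' : Type*} [CommRing D] [CommRing D'] {t : D} {t' : D'} (φ : D →+* D')
    (h : φ t = t') (l : List D) :
    (l.map (tau p t)).map (untiltMap p φ h) = (l.map φ).map (tau p t') := by
  rw [List.map_map, List.map_map]
  congr 1
  ext1 x
  exact untiltMap_tau ..

theorem exists_adjoin_family {ι D D' : Type u} [CommRing D] [CharP D p] [PerfectRing D p]
    [CommRing D'] [CharP D' p] [PerfectRing D' p] (t : D) (ht : span {t} ≠ ⊤) (t' : D')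
    (g : D →+* D') (hg : g t = t') (S : Finset ι) (P : ι → Polynomial (Untilt p t)) (y : ι → D')
    (hP : ∀ i ∈ S, (P i).Monic ∧ (P i).natDegree ≠ 0 ∧
      (P i).eval₂ (untiltMap p g hg) (tau p t' (y i)) = 0) :
    ∃ (D₁ : Type u) (_ : CommRing D₁) (_ : CharP D₁ p) (_ : PerfectRing D₁ p) (t₁ : D₁)
      (φ : D →+* D₁) (hφ : φ t = t₁) (θ : D₁ →+* D') (hθ : θ t₁ = t') (z : ι → D₁),
      GoodExt t φ ∧ (untiltMap p θ hθ).comp (untiltMap p φ hφ) = untiltMap p g hg ∧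
      span {t₁} ≠ ⊤ ∧
      ∀ i ∈ S, (P i).eval₂ (untiltMap p φ hφ) (tau p t₁ (z i)) = 0 ∧ θ (z i) = y i := by
  obtain ⟨D₁, _, _, _, φ, θ, hφ, hθφ, hr⟩ := exists_adjoin_list (p := p) t' t ht
    g hg (S.toList.map fun i => (P i, y i)) (by
      intro q hq
      obtain ⟨r, hr, rfl⟩ := List.mem_map.mp hq
      exact hP r (Finset.mem_toList.mp hr))
  have hr' : ∀ i, ∃ z, i ∈ S → (P i).eval₂ (untiltMap p φ rfl) (tau p (φ t) z) = 0 ∧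
      θ z = y i := by
    intro i
    by_cases hi : i ∈ S
    · obtain ⟨z, hz⟩ := hr _ (List.mem_map.mpr ⟨i, Finset.mem_toList.mpr hi, rfl⟩)
      exact ⟨z, fun _ => hz⟩
    · exact ⟨0, fun h1 => absurd h1 hi⟩
  choose z hz using hr'
  subst hθφ
  exact ⟨D₁, inferInstance, inferInstance, inferInstance, φ t, φ, rfl, θ, hg, z, hφ,
    untiltMap_comp φ θ hg, by simpa using hφ.ne_top [] (by simpa using ht), hz⟩

theorem exists_sharp_family {ι D D' : Type u} [CommRing D] [CharP D p] [PerfectRing D p]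
    [CommRing D'] [CharP D' p] [PerfectRing D' p] (t : D) (ht : span {t} ≠ ⊤) (t' : D')
    (g : D →+* D') (hg : g t = t') (S : Finset ι) (u : ι → Untilt p t) (y : ι → D')
    (hu : ∀ i ∈ S, untiltMap p g hg (u i) = tau p t' (y i)) :
    ∃ (D₁ : Type u) (_ : CommRing D₁) (_ : CharP D₁ p) (_ : PerfectRing D₁ p) (t₁ : D₁)
      (φ : D →+* D₁) (hφ : φ t = t₁) (θ : D₁ →+* D') (hθ : θ t₁ = t') (z : ι → D₁),
      GoodExt t φ ∧ (untiltMap p θ hθ).comp (untiltMap p φ hφ) = untiltMap p g hg ∧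
      span {t₁} ≠ ⊤ ∧
      ∀ i ∈ S, untiltMap p φ hφ (u i) = tau p t₁ (z i) := by
  have : Nontrivial (Untilt p t) := by
    have : Nontrivial (D ⧸ span {t}) := Ideal.Quotient.nontrivial_iff.mpr ht
    exact (untiltRed p t).domain_nontrivial
  obtain ⟨D₁, _, _, _, t₁, φ, hφ, θ, hθ, z, h1, h2, h3, h4⟩ := exists_adjoin_family t ht t' g hg S
    (fun i => Polynomial.X - Polynomial.C (u i)) y (fun i hi =>
      ⟨Polynomial.monic_X_sub_C _, by rw [Polynomial.natDegree_X_sub_C]; simp, by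
        rw [Polynomial.eval₂_sub, Polynomial.eval₂_X, Polynomial.eval₂_C, hu i hi, sub_self]⟩)
  refine ⟨D₁, inferInstance, inferInstance, inferInstance, t₁, φ, hφ, θ, hθ, z, h1, h2, h3, ?_⟩
  intro i hi
  have h5 := (h4 i hi).1
  rw [Polynomial.eval₂_sub, Polynomial.eval₂_X, Polynomial.eval₂_C, sub_eq_zero] at h5
  exact h5.symm

lemma GoodExt.comp_of_eq {D D₁ D₂ : Type*} [CommRing D] [CommRing D₁] [CommRing D₂] {t : D}
    {t₁ : D₁} {φ : D →+* D₁} {φ' : D₁ →+* D₂} (hφ : φ t = t₁) (h' : GoodExt t₁ φ')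
    (h : GoodExt t φ) : GoodExt t (φ'.comp φ) := by
  subst hφ
  exact h'.comp h

lemma untiltMap_comp_of_eq {D D₁ D₂ : Type*} [CommRing D] [CommRing D₁] [CommRing D₂] {t : D}
    {t₁ : D₁} {t₂ : D₂} (φ : D →+* D₁) (φ' : D₁ →+* D₂) (h : φ t = t₁) (h' : φ' t₁ = t₂)
    (h'' : (φ'.comp φ) t = t₂) :
    (untiltMap p φ' h').comp (untiltMap p φ h) = untiltMap p (φ'.comp φ) h'' := by
  subst h
  exact untiltMap_comp φ φ' h'

theorem exists_source {A R D₀ D' : Type u} [CommRing A] [CommRing D₀] [CharP D₀ p]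
    [PerfectRing D₀ p] [CommRing D'] [CharP D' p] [PerfectRing D' p]
    {f : Polynomial A} (hfm : f.Monic) (hfd : f.natDegree ≠ 0) (t : D₀) (ht : span {t} ≠ ⊤)
    (κ : A →+* Untilt p t) (t' : D') (g : D₀ →+* D') (hg : g t = t')
    (δ' : AdjoinRoot f →+* Untilt p t')
    (hδ' : δ'.comp (AdjoinRoot.of f) = (untiltMap p g hg).comp κ) (yh ye : D')
    (hyh : δ' (AdjoinRoot.root f) = tau p t' yh) (e : AdjoinRoot f) (hye : δ' e = tau p t' ye)
    (S : Finset R) (G c : R → Polynomial (AdjoinRoot f)) (y' yc' : R → D')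
    (hG : ∀ r ∈ S, (G r).Monic ∧ (G r).natDegree ≠ 0 ∧ (G r).eval₂ δ' (tau p t' (y' r)) = 0)
    (hc : ∀ r ∈ S, (c r).eval₂ δ' (tau p t' (y' r)) = tau p t' (yc' r)) :
    ∃ (D : Type u) (_ : CommRing D) (_ : CharP D p) (_ : PerfectRing D p) (t₁ : D) (φ : D₀ →+* D)
      (hφt : φ t = t₁) (θ : D →+* D') (hθt : θ t₁ = t') (δ : AdjoinRoot f →+* Untilt p t₁)
      (we : D) (z w : R → D), GoodExt t φ ∧
      δ.comp (AdjoinRoot.of f) = (untiltMap p φ hφt).comp κ ∧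
      (untiltMap p θ hθt).comp δ = δ' ∧ δ e = tau p t₁ we ∧
      ∀ r ∈ S, (G r).eval₂ δ (tau p t₁ (z r)) = 0 ∧ (c r).eval₂ δ (tau p t₁ (z r)) = tau p t₁ (w r)
        ∧ untiltMap p θ hθt (tau p t₁ (z r)) = tau p t' (y' r) := by
  have hnt : ∀ (D : Type u) [CommRing D] [CharP D p] [PerfectRing D p] (t : D), span {t} ≠ ⊤ →
      Nontrivial (Untilt p t) := by
    intro D _ _ _ t ht
    have : Nontrivial (D ⧸ span {t}) := Ideal.Quotient.nontrivial_iff.mpr ht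
    exact (untiltRed p t).domain_nontrivial
  have : Nontrivial (Untilt p t) := hnt D₀ t ht
  have hf' : f.eval₂ ((untiltMap p g hg).comp κ) (tau p _ yh) = 0 := by
    have h1 := Polynomial.hom_eval₂ f (AdjoinRoot.of f) δ' (AdjoinRoot.root f)
    rw [AdjoinRoot.eval₂_root, map_zero, hyh, hδ'] at h1
    exact h1.symm
  obtain ⟨D₁, _, _, _, t₁, φ₁, hφt₁, θ₁, hθt₁, z₁, hφ₁, hθφ₁, ht₁, hr₁⟩ :=
    exists_adjoin_family (p := p) (ι := PUnit) t ht t' g hg Finset.univ (fun _ => f.map κ)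
      (fun _ => yh) (by
      intro _ _
      refine ⟨hfm.map _, by rwa [hfm.natDegree_map], ?_⟩
      rw [Polynomial.eval₂_map]
      exact hf')
  obtain ⟨hy₁, hy₁'⟩ := hr₁ PUnit.unit (Finset.mem_univ _)
  rw [Polynomial.eval₂_map] at hy₁
  obtain ⟨δ₁, hδ₁of, hδ₁r⟩ : ∃ δ₁ : AdjoinRoot f →+* Untilt p t₁,
      δ₁.comp (AdjoinRoot.of f) = (untiltMap p φ₁ hφt₁).comp κ ∧
      δ₁ (AdjoinRoot.root f) = tau p t₁ (z₁ PUnit.unit) :=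
    ⟨_, AdjoinRoot.lift_comp_of hy₁, AdjoinRoot.lift_root hy₁⟩
  have hδ₁ : (untiltMap p θ₁ hθt₁).comp δ₁ = δ' := by
    refine AdjoinRoot.ringHom_ext ?_ ?_
    · rw [RingHom.comp_assoc, hδ₁of, ← RingHom.comp_assoc, hθφ₁, hδ']
    · rw [RingHom.comp_apply, hδ₁r, hyh, untiltMap_tau, hy₁']
  have := hnt _ _ ht₁
  obtain ⟨D₂, _, _, _, t₂, φ₂, hφt₂, θ₂, hθt₂, z₂, hφ₂, hθφ₂, ht₂, hr₂⟩ :=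
    exists_adjoin_family (p := p) t₁ ht₁ t' θ₁ hθt₁ S (fun r => (G r).map δ₁) y' (by
      intro r hr
      refine ⟨(hG r hr).1.map _, by
        rw [(hG r hr).1.natDegree_map]; exact (hG r hr).2.1, ?_⟩
      rw [Polynomial.eval₂_map, hδ₁]
      exact (hG r hr).2.2)
  obtain ⟨δ₂, hδ₂e⟩ : ∃ δ₂, δ₂ = (untiltMap p φ₂ hφt₂).comp δ₁ := ⟨_, rfl⟩
  have hδ₂ : (untiltMap p θ₂ hθt₂).comp δ₂ = δ' := by
    rw [hδ₂e, ← RingHom.comp_assoc, hθφ₂, hδ₁]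
  have hz₂ : ∀ r ∈ S, untiltMap p θ₂ hθt₂ (tau p t₂ (z₂ r)) = tau p t' (y' r) := by
    intro r hr
    rw [untiltMap_tau, (hr₂ r hr).2]
  have hcz : ∀ r ∈ S, untiltMap p θ₂ hθt₂ ((c r).eval₂ δ₂ (tau p _ (z₂ r))) =
      tau p t' (yc' r) := by
    intro r hr
    refine (Polynomial.hom_eval₂ _ _ _ _).trans ?_
    rw [hδ₂, hz₂ r hr, hc r hr]
  obtain ⟨D₃, _, _, _, t₃, φ₃, hφt₃, θ₃, hθt₃, w, hφ₃, hθφ₃, ht₃, hr₃⟩ :=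
    exists_sharp_family (p := p) t₂ ht₂ t' θ₂ hθt₂ S _ _ hcz
  obtain ⟨D, _, _, _, t₄, φ₄, hφt₄, θ, hθt, we, hφ₄, hθφ₄, ht₄, hr₄⟩ :=
    exists_sharp_family (p := p) (ι := PUnit) t₃ ht₃ t' θ₃ hθt₃ Finset.univ
      (fun _ => untiltMap p φ₃ hφt₃ (δ₂ e)) (fun _ => ye) (by
      intro _ _
      refine (RingHom.congr_fun hθφ₃ (δ₂ e)).trans ((RingHom.congr_fun hδ₂ e).trans hye))
  have hφ' : ((φ₄.comp φ₃).comp (φ₂.comp φ₁)) t = t₄ := by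
    simp only [RingHom.comp_apply, hφt₁, hφt₂, hφt₃, hφt₄]
  have hφ₂₁ : (φ₂.comp φ₁) t = t₂ := by simp only [RingHom.comp_apply, hφt₁, hφt₂]
  have hφ₄₃ : (φ₄.comp φ₃) t₂ = t₄ := by simp only [RingHom.comp_apply, hφt₃, hφt₄]
  obtain ⟨δ, hδe⟩ : ∃ δ, δ = (untiltMap p (φ₄.comp φ₃) hφ₄₃).comp δ₂ := ⟨_, rfl⟩
  have hφφ := untiltMap_comp_of_eq (p := p) φ₃ φ₄ hφt₃ hφt₄ hφ₄₃
  have hevz : ∀ (P : Polynomial (AdjoinRoot f)) x, P.eval₂ δ (tau p t₄ ((φ₄.comp φ₃) x)) =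
      untiltMap p (φ₄.comp φ₃) hφ₄₃ (P.eval₂ δ₂ (tau p t₂ x)) := by
    intro P x
    rw [hδe]
    refine Eq.trans ?_ (Polynomial.hom_eval₂ _ _ _ _).symm
    rw [untiltMap_tau]
  have hφφ' : ∀ x, untiltMap p (φ₄.comp φ₃) hφ₄₃ x =
      untiltMap p φ₄ hφt₄ (untiltMap p φ₃ hφt₃ x) := fun x => (RingHom.congr_fun hφφ x).symm
  refine ⟨D, inferInstance, inferInstance, inferInstance, t₄, _, hφ', θ, hθt, δ,
    we PUnit.unit, fun r => (φ₄.comp φ₃) (z₂ r), fun r => φ₄ (w r),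
    (hφ₄.comp_of_eq hφt₃ hφ₃).comp_of_eq hφ₂₁ (hφ₂.comp_of_eq hφt₁ hφ₁), ?_, ?_, ?_, ?_⟩
  · rw [hδe, RingHom.comp_assoc, hδ₂e, RingHom.comp_assoc, hδ₁of, ← RingHom.comp_assoc,
      ← RingHom.comp_assoc, RingHom.comp_assoc (untiltMap p φ₁ hφt₁),
      untiltMap_comp_of_eq φ₁ φ₂ hφt₁ hφt₂ hφ₂₁, untiltMap_comp_of_eq _ _ hφ₂₁ hφ₄₃ hφ']
  · rw [hδe, ← hφφ, ← RingHom.comp_assoc, ← RingHom.comp_assoc, hθφ₄, hθφ₃, hδ₂]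
  · rw [← hr₄ PUnit.unit (Finset.mem_univ _), hδe]
    exact hφφ' _
  · intro r hr
    refine ⟨?_, ?_, ?_⟩
    · have h1 := (hr₂ r hr).1
      rw [Polynomial.eval₂_map, ← hδ₂e] at h1
      rw [hevz, h1, map_zero]
    · rw [hevz, hφφ', hr₃ r hr, untiltMap_tau]
    · rw [← hz₂ r hr, ← hθφ₃, ← hθφ₄]
      simp only [RingHom.comp_apply, untiltMap_tau]

set_option maxHeartbeats 1000000 in
-- a long chain of successive extensions
theorem exists_bigCM_of_package {A A' R L L' D₀ D₀' : Type u} [CommRing A] [CommRing A']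
    [IsDomain A'] [CommRing R] [CommRing L] [CommRing L'] [CommRing D₀] [CharP D₀ p]
    [PerfectRing D₀ p] [CommRing D₀'] [CharP D₀' p] [PerfectRing D₀' p] [Algebra A R]
    [Module.Finite A R] (πA : A →+* A') {f : Polynomial A} (hfm : f.Monic)
    (hfd : f.natDegree ≠ 0) [IsDomain (AdjoinRoot f)] {h : Polynomial A'} (hm : h.Monic)
    (hd : h.natDegree ≠ 0) [IsDomain (AdjoinRoot h)] (π : AdjoinRoot f →+* AdjoinRoot h)
    (hπ : π.comp (AdjoinRoot.of f) = (AdjoinRoot.of h).comp πA)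
    (hπr : π (AdjoinRoot.root f) = AdjoinRoot.root h) (e : AdjoinRoot f) (he : π e ≠ 0)
    [Algebra (AdjoinRoot f) L] [Algebra (AdjoinRoot h) L'] [IsLocalization.Away e L]
    [IsLocalization.Away (π e) L'] (τ : L →+* L')
    (hτ : ∀ x, τ (algebraMap _ L x) = algebraMap _ L' (π x)) (ψ : R →+* L)
    (hψ : ∀ a, ψ (algebraMap A R a) = algebraMap _ L (AdjoinRoot.of f a)) (Q : Ideal R)
    (hQ : ∀ r ∈ Q, τ (ψ r) = 0)
    (S : Finset R) (hS : Algebra.adjoin A (S : Set R) = ⊤) (a : R → AdjoinRoot f)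
    (ha : ∀ r ∈ S, algebraMap _ L e * ψ r = algebraMap _ L (a r))
    (t : D₀) (κ : A →+* Untilt p t) (t' : D₀') (κ' : A' →+* Untilt p t') (θ₀ : D₀ →+* D₀')
    (hθ₀ : θ₀ t = t') (hκ : (untiltMap p θ₀ hθ₀).comp κ = κ'.comp πA) (xs : List D₀) (xn : D₀)
    (ws : List A) (s : A) (hws : ws.map κ = xs.map (tau p t)) (hs : κ s = tau p t xn)
    (hreg : WReg ⊥ (t :: (xs ++ [xn])))
    (hreg' : ∀ l', l'.Perm (xs.map θ₀) → WReg ⊥ (t' :: l'))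
    (hne : ofList (t' :: xs.map θ₀) ≠ ⊤) (hH : Separates p (ws.map πA)) :
    ∃ (B C : Type u) (_ : CommRing B) (_ : CommRing C) (ρ : R →+* B) (ρ' : R ⧸ Q →+* C)
      (G : B →+* C), (∀ r, G (ρ r) = ρ' (Ideal.Quotient.mk Q r)) ∧
      WReg ⊥ ((((p : A) :: ws) ++ [s]).map (ρ ∘ algebraMap A R)) ∧
      WReg ⊥ (((p : A) :: ws).map (G ∘ ρ ∘ algebraMap A R)) ∧
      ofList (((p : A) :: ws).map (G ∘ ρ ∘ algebraMap A R)) ≠ ⊤ := by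
  classical
  have he0 : e ≠ 0 := by
    rintro rfl
    exact he (map_zero π)
  have hLinj : Function.Injective (algebraMap (AdjoinRoot f) L) :=
    IsLocalization.injective L (M := Submonoid.powers e)
      (powers_le_nonZeroDivisors_of_noZeroDivisors he0)
  have hdata : ∀ r, ∃ (G c : Polynomial (AdjoinRoot f)) (n : ℕ), r ∈ S → (G.Monic ∧
      G.natDegree ≠ 0 ∧
      c * (Polynomial.C e * Polynomial.X - Polynomial.C (a r)) = Polynomial.C (e ^ n) * G ∧
      (∀ (K : Type u) [Field K] (k : AdjoinRoot f →+* K), k e ≠ 0 →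
        G.eval₂ k (k (a r) / k e) = 0) ∧
      ∀ (T : Type u) [CommRing T] (k : AdjoinRoot f →+* T) (ζ : T), k e * ζ = k (a r) →
        c.eval₂ k ζ = k e ^ n) := by
    intro r
    by_cases hr : r ∈ S
    swap
    · exact ⟨0, 0, 0, fun h1 => absurd h1 hr⟩
    obtain ⟨χ, hχm, hχ⟩ := Algebra.IsIntegral.isIntegral (R := A) r
    have hχm' : ((Polynomial.X * χ).map (AdjoinRoot.of f)).Monic :=
      (Polynomial.monic_X.mul hχm).map _
    have hA : Nontrivial A := (AdjoinRoot.of f).domain_nontrivial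
    obtain ⟨G, c, n, h1⟩ := exists_poly_data.{u} e (a r) hχm' (by
      rw [(Polynomial.monic_X.mul hχm).natDegree_map, Polynomial.monic_X.natDegree_mul hχm,
        Polynomial.natDegree_X]
      omega) (by
      apply hLinj
      rw [map_zero, ← Polynomial.eval₂_at_apply, ← ha r hr, Polynomial.scaleRoots_eval₂_mul,
        Polynomial.eval₂_map]
      have h2 : (algebraMap (AdjoinRoot f) L).comp (AdjoinRoot.of f) =
          ψ.comp (algebraMap A R) := RingHom.ext fun x => (hψ x).symm
      rw [h2, ← Polynomial.hom_eval₂, Polynomial.eval₂_mul, hχ, mul_zero, map_zero, mul_zero])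
    exact ⟨G, c, n, fun _ => h1⟩
  choose G c n hdat using hdata
  subst hθ₀
  obtain ⟨D', _, _, _, φ', δ', yh, ye, y', yc', hφ', hδ'of, hδ'r, hδ'e, hG', hc', hsep⟩ :=
    exists_target hm hd π e he S G c a (fun r hr => (hdat r hr).1)
      (fun r hr => (hdat r hr).2.2.2.1)
      (fun r hr => ⟨n r, (hdat r hr).2.2.2.2⟩) _ κ' (xs.map θ₀) (ws.map πA) (by
        rw [List.map_map, ← RingHom.coe_comp, ← hκ, RingHom.coe_comp, ← List.map_map, hws,
          map_untiltMap_tau]) hreg' hne hH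
  have ht : span {t} ≠ ⊤ := by
    intro h1
    refine hne (top_le_iff.mp ?_)
    have h2 := congrArg (Ideal.map θ₀) h1
    rw [Ideal.map_span, Set.image_singleton, Ideal.map_top] at h2
    rw [← h2, Ideal.span_singleton_le_iff_mem]
    exact mem_ofList List.mem_cons_self
  have hδπ : (δ'.comp π).comp (AdjoinRoot.of f) =
      (untiltMap p (φ'.comp θ₀) (t := t) rfl).comp κ := by
    rw [RingHom.comp_assoc, hπ, ← RingHom.comp_assoc, hδ'of, RingHom.comp_assoc, ← hκ,
      ← RingHom.comp_assoc, untiltMap_comp]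
  obtain ⟨D, _, _, _, t₁, φ, hφt, θ, hθt, δ, we, z, w, hφ, hδof, hδ, hwe', hall⟩ :=
    exists_source hfm hfd t ht κ (φ' (θ₀ t)) (φ'.comp θ₀) rfl (δ'.comp π) hδπ yh ye
      (by rw [RingHom.comp_apply, hπr, hδ'r]) e hδ'e S G c y' yc'
      (fun r hr => ⟨(hdat r hr).1, (hdat r hr).2.1, hG' r hr⟩) hc'
  subst hφt
  have hgz : ∀ r ∈ S, untiltMap p θ hθt ((c r).eval₂ δ (tau p _ (z r))) =
      (c r).eval₂ (δ'.comp π) (tau p _ (y' r)) := by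
    intro r hr
    rw [Polynomial.hom_eval₂, hδ, (hall r hr).2.2]
  have hcc : δ e * ∏ r ∈ S, (c r).eval₂ δ (tau p _ (z r)) = tau p _ (we * ∏ r ∈ S, w r) := by
    rw [map_mul, map_prod, hwe', Finset.prod_congr rfl fun r hr => (hall r hr).2.1]
  obtain ⟨γ, hγ⟩ := exists_tau_roots (φ t) (we * ∏ r ∈ S, w r)
  have hws' : ((((p : A) :: ws) ++ [s]).map (δ ∘ AdjoinRoot.of f)) =
      (p : Untilt p (φ t)) ::
        ((xs ++ [xn]).map φ).map (tau p _) := by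
    rw [← RingHom.coe_comp, List.cons_append, List.map_cons, map_natCast, List.map_append, hδof,
      RingHom.coe_comp, ← List.map_map, ← List.map_map, hws, map_untiltMap_tau,
      List.map_singleton, List.map_singleton, hs, untiltMap_tau, List.map_append, List.map_append]
    rfl
  have hws'' : ((p : A) :: ws).map (δ' ∘ π ∘ AdjoinRoot.of f) =
      (p : Untilt p (φ' (θ₀ t))) :: (ws.map πA).map (δ'.comp (AdjoinRoot.of h)) := by
    have h1 : δ' ∘ π ∘ AdjoinRoot.of f = (δ'.comp (AdjoinRoot.of h)).comp πA := by
      rw [RingHom.comp_assoc, ← hπ]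
      rfl
    rw [h1, List.map_cons, map_natCast, RingHom.coe_comp, List.map_map]
  have hws₃ : (ws.map πA).map (δ'.comp (AdjoinRoot.of h)) =
      ((xs.map θ₀).map φ').map (tau p (φ' (θ₀ t))) := by
    rw [hδ'of, List.map_map, ← RingHom.coe_comp, RingHom.comp_assoc, ← hκ, RingHom.coe_comp,
      RingHom.coe_comp, ← List.map_map, ← List.map_map, hws, map_untiltMap_tau, map_untiltMap_tau]
  have hred : WReg ⊥ [t] := by
    refine ⟨hreg.1, trivial⟩
  have hred' : WReg ⊥ [θ₀ t] := ⟨(hreg' _ (List.Perm.refl _)).1, trivial⟩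
  have := isReduced_untilt (p := p) (by simpa using hφ.wreg [] hred)
  have := isReduced_untilt (p := p) (by simpa using hφ'.wreg [] hred')
  refine exists_wreg_of_roots π e τ hτ (AdjoinRoot.of f) ψ hψ Q hQ hS a ha δ δ'
    (untiltMap p θ hθt) (fun x => RingHom.congr_fun hδ x) (fun r => tau p _ (z r))
    (δ e * ∏ r ∈ S, (c r).eval₂ δ (tau p _ (z r))) (dvd_mul_right _ _) ?_ γ (fun k => p ^ k) ?_
    ((p : A) :: ws) s ?_ ?_ ?_
  · intro r hr
    have h1 := congrArg (Polynomial.eval₂ δ (tau p _ (z r))) (hdat r hr).2.2.1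
    simp only [Polynomial.eval₂_mul, Polynomial.eval₂_sub, Polynomial.eval₂_C,
      Polynomial.eval₂_X, (hall r hr).1, mul_zero] at h1
    rw [← Finset.mul_prod_erase S _ hr]
    linear_combination (δ e * ∏ r ∈ S.erase r, (c r).eval₂ δ (tau p _ (z r))) * h1
  · intro k
    rw [hγ, hcc]
  · rw [hws']
    exact wreg_p_tau (hφ.wreg _ hreg)
  · rw [hws'', hws₃]
    exact wreg_p_tau (hφ'.wreg _ (hreg' _ (List.Perm.refl _)))
  · intro m
    obtain ⟨k, hk⟩ := hsep m
    refine ⟨k, ?_⟩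
    have h1 : untiltMap p θ hθt (δ e) = δ' (π e) := RingHom.congr_fun hδ e
    rw [hws'', map_mul, map_prod, Finset.prod_congr rfl hgz, h1]
    exact fun h1 => hk (Ideal.pow_le_pow_right (Nat.lt_pow_self hp.out.one_lt).le h1)

end Source

end BigCM

namespace BigCM

open Ideal

section LocalGenerator

open Polynomial

lemma aeval_sub_aeval_mem {V O : Type*} [CommRing V] [CommRing O] [Algebra V O] (I : Ideal O)
    (g : V[X]) {z z' : O} (h : z - z' ∈ I) : aeval z g - aeval z' g ∈ I := by
  obtain ⟨w, hw⟩ := (g.map (algebraMap V O)).evalSubFactor z z'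
  rw [eval_map_algebraMap, eval_map_algebraMap] at hw
  rw [hw]
  exact I.mul_mem_left _ h

lemma exists_generator_mod_sq {V O : Type*} [CommRing V] [CommRing O] [IsDedekindDomain O]
    [Algebra V O] [Module.Finite V O] (m : Ideal V) [m.IsMaximal] (P : Ideal O) [P.IsPrime]
    [P.LiesOver m] (hP : P ≠ ⊥) [CharZero (V ⧸ m)] :
    ∃ (z : O) (H : V[X]), z ∉ P ∧ (∀ y : O, ∃ g : V[X], y - aeval z g ∈ P) ∧
      aeval z H ∈ P ∧ aeval z H ∉ P ^ 2 := by
  let _ : Field (V ⧸ m) := Ideal.Quotient.field m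
  have hPm : P.IsMaximal := ‹P.IsPrime›.isMaximal hP
  let _ : Field (O ⧸ P) := Ideal.Quotient.field P
  have hfin : Module.Finite (V ⧸ m) (O ⧸ P) := inferInstance
  have hsep : Algebra.IsSeparable (V ⧸ m) (O ⧸ P) := inferInstance
  have hmap : ∀ (g : V[X]) (z : O), Ideal.Quotient.mk P (aeval z g) =
      aeval (Ideal.Quotient.mk P z) (g.map (Ideal.Quotient.mk m)) := by
    intro g z
    rw [aeval_def, aeval_def, hom_eval₂, eval₂_map]
    rfl
  obtain ⟨α, hα0, hα⟩ : ∃ α : O ⧸ P, α ≠ 0 ∧ IntermediateField.adjoin (V ⧸ m) {α} = ⊤ := by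
    obtain ⟨α, hα⟩ := Field.exists_primitive_element (V ⧸ m) (O ⧸ P)
    by_cases h0 : α = 0
    · refine ⟨1, one_ne_zero, ?_⟩
      rw [← hα, h0, IntermediateField.adjoin_zero, IntermediateField.adjoin_one]
    · exact ⟨α, h0, hα⟩
  have hintegral : IsIntegral (V ⧸ m) α := Algebra.IsIntegral.isIntegral α
  have hsurj : ∀ y : O ⧸ P, ∃ g : V[X], y = aeval α (g.map (Ideal.Quotient.mk m)) := by
    intro y
    have hy : y ∈ (IntermediateField.adjoin (V ⧸ m) {α}).toSubalgebra := by
      rw [hα]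
      trivial
    rw [IntermediateField.adjoin_simple_toSubalgebra_of_isAlgebraic hintegral.isAlgebraic,
      Algebra.adjoin_singleton_eq_range_aeval] at hy
    obtain ⟨g, rfl⟩ := hy
    obtain ⟨g, rfl⟩ := map_surjective _ (Ideal.Quotient.mk_surjective (I := m)) g
    exact ⟨g, rfl⟩
  obtain ⟨H, hH⟩ := map_surjective _ (Ideal.Quotient.mk_surjective (I := m)) (minpoly (V ⧸ m) α)
  obtain ⟨z, hz⟩ := Ideal.Quotient.mk_surjective α
  obtain ⟨w, hwP, hwP2⟩ := P.exists_mem_pow_notMem_pow_succ hP hPm.ne_top 1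
  rw [pow_one] at hwP
  have hkey : ∃ z : O, Ideal.Quotient.mk P z = α ∧ aeval z H ∉ P ^ 2 := by
    by_cases h1 : aeval z H ∈ P ^ 2
    swap
    · exact ⟨z, hz, h1⟩
    refine ⟨z + w, by rw [map_add, hz, Ideal.Quotient.eq_zero_iff_mem.mpr hwP, add_zero], ?_⟩
    intro h2
    obtain ⟨k, hk⟩ := (H.map (algebraMap V O)).binomExpansion z w
    rw [eval_map_algebraMap, eval_map_algebraMap, derivative_map, eval_map_algebraMap] at hk
    have h3 : aeval z (derivative H) * w ∈ P ^ 2 := by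
      have : aeval z (derivative H) * w = aeval (z + w) H - aeval z H - k * w ^ 2 := by
        rw [hk]; ring
      rw [this]
      exact Ideal.sub_mem _ (Ideal.sub_mem _ h2 h1)
        (Ideal.mul_mem_left _ _ (Ideal.pow_mem_pow hwP 2))
    have h4 : aeval z (derivative H) ∉ P := by
      rw [← Ideal.Quotient.eq_zero_iff_mem, hmap, hz, ← derivative_map, hH]
      exact (Algebra.IsSeparable.isSeparable (V ⧸ m) α).aeval_derivative_ne_zero
        (minpoly.aeval _ _)
    have h5 : IsCoprime (P ^ 2) (span {aeval z (derivative H)}) := by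
      refine IsCoprime.pow_left ?_
      rw [Ideal.isCoprime_iff_sup_eq]
      by_contra h
      have h6 := hPm.eq_of_le h le_sup_left
      exact h4 (h6 ▸ Ideal.mem_sup_right (Ideal.mem_span_singleton_self _))
    obtain ⟨i, hi, j, hj, hij⟩ := Ideal.isCoprime_iff_exists.mp h5
    obtain ⟨c, rfl⟩ := Ideal.mem_span_singleton'.mp hj
    refine hwP2 ?_
    have : w = i * w + c * (aeval z (derivative H) * w) := by linear_combination -w * hij
    rw [this]
    exact Ideal.add_mem _ (Ideal.mul_mem_right _ _ hi) (Ideal.mul_mem_left _ _ h3)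
  obtain ⟨z, hz, hzH⟩ := hkey
  refine ⟨z, H, ?_, ?_, ?_, hzH⟩
  · rwa [← Ideal.Quotient.eq_zero_iff_mem, hz]
  · intro y
    obtain ⟨g, hg⟩ := hsurj (Ideal.Quotient.mk P y)
    refine ⟨g, ?_⟩
    rw [← Ideal.Quotient.eq_zero_iff_mem, map_sub, hmap, hz, hg, sub_self]
  · rw [← Ideal.Quotient.eq_zero_iff_mem, hmap, hz, hH, minpoly.aeval]

lemma exists_coprime_ideal {O : Type*} [CommRing O] [IsDedekindDomain O] (P : Ideal O)
    [P.IsMaximal] (hP : P ≠ ⊥) {x : O} (hxP : x ∈ P) (hx : x ≠ 0) :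
    ∃ I : Ideal O, IsCoprime I P ∧ ∀ b ∈ P, b ∉ P ^ 2 → P * I ≤ span {b, x} := by
  have hcop : ∀ I : Ideal O, ¬ P ∣ I → IsCoprime I P := by
    intro I hI
    rw [Ideal.isCoprime_iff_sup_eq]
    by_contra h
    have := (‹P.IsMaximal›).eq_of_le h le_sup_right
    exact hI (Ideal.dvd_iff_le.mpr (this ▸ le_sup_left))
  have hprime : Prime P := Ideal.prime_of_isPrime hP inferInstance
  have hx' : span {x} ≠ (0 : Ideal O) := by
    rwa [Ne, Ideal.zero_eq_bot, Ideal.span_singleton_eq_bot]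
  obtain ⟨I, hxI, hI⟩ := (FiniteMultiplicity.of_prime_left hprime hx').exists_eq_pow_mul_and_not_dvd
  refine ⟨I, hcop I hI, fun b hb hb2 => ?_⟩
  obtain ⟨c, hc⟩ : P ∣ span {b} := Ideal.dvd_iff_le.mpr (by
    rwa [Ideal.span_singleton_le_iff_mem])
  have hcP : ¬ P ∣ c := by
    rintro ⟨d, rfl⟩
    refine hb2 ?_
    rw [← Ideal.span_singleton_le_iff_mem, hc, ← mul_assoc, ← sq]
    exact Ideal.mul_le_left
  obtain ⟨a, ha⟩ : ∃ a, multiplicity P (span {x}) = a + 1 := by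
    refine Nat.exists_eq_add_one.mpr (Nat.pos_of_ne_zero fun h => hI ?_)
    rw [h, pow_zero, one_mul] at hxI
    rw [← hxI]
    exact Ideal.dvd_iff_le.mpr (by rwa [Ideal.span_singleton_le_iff_mem])
  have h1 : c ⊔ P ^ a = ⊤ := Ideal.isCoprime_iff_sup_eq.mp ((hcop c hcP).pow_right)
  calc P * I = P * I * (c ⊔ P ^ a) := by rw [h1, Ideal.mul_top]
    _ = P * I * c ⊔ P * I * P ^ a := Ideal.mul_sup _ _ _
    _ ≤ span {b} ⊔ span {x} := by
      refine sup_le_sup ?_ (le_of_eq ?_)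
      · rw [hc, mul_right_comm]
        exact Ideal.mul_le_left
      · rw [hxI, ha, pow_succ]
        ring
    _ = span {b, x} := (Ideal.span_insert b {x}).symm

theorem exists_local_generator {V O : Type u} [CommRing V] [CommRing O] [IsDedekindDomain O]
    [Algebra V O] [Module.Finite V O] (m : Ideal V) [m.IsMaximal] (P : Ideal O) [P.IsPrime]
    [P.LiesOver m] [CharZero (V ⧸ m)] {x : V} (hxm : x ∈ m) (hx : algebraMap V O x ≠ 0) :
    ∃ z : O, ∃ e ∈ Algebra.adjoin V {z}, e ∉ P ∧ ∀ y, e * y ∈ Algebra.adjoin V {z} := by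
  have hxP : algebraMap V O x ∈ P := by
    rwa [← Ideal.mem_comap, ← Ideal.under_def, ← Ideal.LiesOver.over (P := P) (p := m)]
  have hP : P ≠ ⊥ := by
    rintro rfl
    exact hx hxP
  have hPm : P.IsMaximal := ‹P.IsPrime›.isMaximal hP
  obtain ⟨z₀, H, hz₀, hsurj, hH, hH2⟩ := exists_generator_mod_sq m P hP
  obtain ⟨I, hI, hIP⟩ := exists_coprime_ideal P hP hxP hx
  obtain ⟨i, hi, j, hj, hij⟩ := Ideal.isCoprime_iff_exists.mp (hI.pow_right (n := 2))
  obtain ⟨z, hz⟩ : ∃ z, z = i * z₀ := ⟨_, rfl⟩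
  have hzI : z ∈ I := hz ▸ I.mul_mem_right _ hi
  have hzz : z - z₀ ∈ P ^ 2 := by
    have : z - z₀ = - (j * z₀) := by rw [hz]; linear_combination z₀ * hij
    rw [this]
    exact neg_mem (Ideal.mul_mem_right _ _ hj)
  have hzP : z - z₀ ∈ P := Ideal.pow_le_self two_ne_zero hzz
  have hz0 : z ∉ P := fun h => hz₀ (by simpa using Ideal.sub_mem _ h hzP)
  have hbP : aeval z H ∈ P := by
    simpa using Ideal.add_mem _ (aeval_sub_aeval_mem P H hzP) hH
  have hbP2 : aeval z H ∉ P ^ 2 := fun h => hH2 (by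
    simpa using Ideal.sub_mem _ h (aeval_sub_aeval_mem _ H hzz))
  have hsurj' : ∀ y : O, ∃ g : V[X], y - aeval z g ∈ P := by
    intro y
    obtain ⟨g, hg⟩ := hsurj y
    refine ⟨g, ?_⟩
    simpa using Ideal.sub_mem _ hg (aeval_sub_aeval_mem P g hzP)
  obtain ⟨B, hB⟩ : ∃ B, B = Algebra.adjoin V {z} := ⟨_, rfl⟩
  refine ⟨z, ?_⟩
  rw [← hB]
  have haev : ∀ g : V[X], aeval z g ∈ B := by
    intro g
    rw [hB]
    exact aeval_mem_adjoin_singleton V z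
  have hzB : z ∈ B := by simpa using haev Polynomial.X
  obtain ⟨q, hq⟩ : ∃ q : Ideal B, q = P.comap (algebraMap B O) := ⟨_, rfl⟩
  have hqp : q.IsPrime := by rw [hq]; infer_instance
  have hfin : Module.Finite B O := Module.Finite.of_restrictScalars_finite V B O
  let M := O ⧸ (1 : Submodule B O)
  have hrange : LinearMap.range (LinearMap.lsmul B M ⟨z, hzB⟩) ≤ q • ⊤ := by
    rintro _ ⟨y, rfl⟩
    obtain ⟨y, rfl⟩ := Submodule.Quotient.mk_surjective _ y
    obtain ⟨g, hg⟩ := hsurj' y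
    have h1 : z * (y - aeval z g) ∈ span {aeval z H, algebraMap V O x} :=
      hIP _ hbP hbP2 (mul_comm z _ ▸ Ideal.mul_mem_mul hg hzI)
    obtain ⟨c, d, hcd⟩ := Ideal.mem_span_pair.mp h1
    have h2 : (LinearMap.lsmul B M ⟨z, hzB⟩) (Submodule.Quotient.mk y) =
        (⟨aeval z H, haev H⟩ : B) • (Submodule.Quotient.mk c : M) +
        (algebraMap V B x) • (Submodule.Quotient.mk d : M) := by
      rw [LinearMap.lsmul_apply, ← Submodule.Quotient.mk_smul, ← Submodule.Quotient.mk_smul,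
        ← Submodule.Quotient.mk_smul, ← Submodule.Quotient.mk_add, Submodule.Quotient.eq,
        Submodule.mem_one]
      refine ⟨⟨z * aeval z g, mul_mem hzB (haev g)⟩, ?_⟩
      change z * aeval z g = z * y - (aeval z H * c + algebraMap V O x * d)
      linear_combination hcd
    rw [h2]
    refine Submodule.add_mem _ (Submodule.smul_mem_smul ?_ trivial)
      (Submodule.smul_mem_smul ?_ trivial)
    · rw [hq]; exact hbP
    · rw [hq]; exact hxP
  obtain ⟨g, hgm, -, hgc, hg⟩ :=
    LinearMap.exists_monic_and_natDegree_eq_and_coeff_mem_pow_and_aeval_eq_zero B _ q hrange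
  have hkill : ∀ m : M, g.eval (⟨z, hzB⟩ : B) • m = 0 := by
    intro m
    have h1 : LinearMap.lsmul B M ⟨z, hzB⟩ = algebraMap B (Module.End B M) ⟨z, hzB⟩ := by
      ext; rfl
    rw [h1, Polynomial.aeval_algebraMap_apply_eq_algebraMap_eval] at hg
    exact LinearMap.congr_fun hg m
  refine ⟨algebraMap B O (g.eval (⟨z, hzB⟩ : B)), Subtype.property _, ?_, ?_⟩
  · intro h1
    have h2 : g.eval (⟨z, hzB⟩ : B) ∈ q := by rw [hq]; exact h1
    have h3 : (⟨z, hzB⟩ : B) ^ g.natDegree ∈ q := by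
      rw [Polynomial.eval_eq_sum_range, Finset.sum_range_succ, hgm.coeff_natDegree, one_mul] at h2
      refine (Ideal.add_mem_iff_right _ (Ideal.sum_mem _ fun i hi => ?_)).mp h2
      refine Ideal.mul_mem_right _ _ (Ideal.pow_le_self ?_ (hgc i))
      have := Finset.mem_range.mp hi
      omega
    have h4 := hqp.mem_of_pow_mem _ h3
    rw [hq] at h4
    exact hz0 h4
  · intro y
    have h1 := hkill (Submodule.Quotient.mk y)
    rw [← Submodule.Quotient.mk_smul, Submodule.Quotient.mk_eq_zero, Submodule.mem_one] at h1
    obtain ⟨b, hb⟩ := h1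
    have h2 : algebraMap B O (g.eval (⟨z, hzB⟩ : B)) * y = algebraMap B O b := hb.symm
    change algebraMap B O (g.eval (⟨z, hzB⟩ : B)) * y ∈ B
    rw [h2]
    exact b.2

end LocalGenerator

end BigCM

namespace BigCM

open Ideal

section Generator

open Polynomial

lemma exists_adjoinRoot_hom {A O : Type*} [CommRing A] [IsDomain A] [IsIntegrallyClosed A]
    [CommRing O] [IsDomain O] [Algebra A O] [FaithfulSMul A O] {z : O} (hz : IsIntegral A z) :
    ∃ f : A[X], f.Monic ∧ f.natDegree ≠ 0 ∧ ∃ ev : AdjoinRoot f →ₐ[A] O,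
      Function.Injective ev ∧ ev (AdjoinRoot.root f) = z := by
  have : Module.IsTorsionFree A O := inferInstance
  have h0 : eval₂ (↑(Algebra.ofId A O) : A →+* O) z (minpoly A z) = 0 := minpoly.aeval A z
  refine ⟨minpoly A z, minpoly.monic hz, (minpoly.natDegree_pos hz).ne',
    AdjoinRoot.liftAlgHom _ (Algebra.ofId A O) z h0, ?_, AdjoinRoot.liftAlgHom_root _ _ _ h0⟩
  refine (injective_iff_map_eq_zero _).2 fun x hx => ?_
  obtain ⟨P, rfl⟩ := AdjoinRoot.mk_surjective x
  rw [AdjoinRoot.mk_eq_zero, ← minpoly.isIntegrallyClosed_dvd_iff hz]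
  rw [AdjoinRoot.liftAlgHom_mk] at hx
  exact hx

lemma range_adjoinRoot_hom {A O : Type*} [CommRing A] [CommRing O] [Algebra A O] {f : A[X]}
    (ev : AdjoinRoot f →ₐ[A] O) : ev.range = Algebra.adjoin A {ev (AdjoinRoot.root f)} := by
  rw [← Algebra.map_top, ← AdjoinRoot.adjoinRoot_eq_top, AlgHom.map_adjoin, Set.image_singleton]

lemma exists_lift_of_range {R L M : Type*} [CommRing R] [CommRing L] [CommRing M] (g : L →+* M)
    (hg : Function.Injective g) (φ : R →+* M) (h : ∀ r, φ r ∈ g.range) :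
    ∃ ψ : R →+* L, ∀ r, g (ψ r) = φ r := by
  refine ⟨(RingEquiv.ofBijective g.rangeRestrict ⟨?_, g.rangeRestrict_surjective⟩).symm.toRingHom.comp
    (φ.codRestrict g.range h), fun r => ?_⟩
  · intro a b hab
    exact hg (congrArg Subtype.val hab)
  · have := RingEquiv.apply_symm_apply (RingEquiv.ofBijective g.rangeRestrict
      ⟨fun a b hab => hg (congrArg Subtype.val hab), g.rangeRestrict_surjective⟩)
      (φ.codRestrict g.range h r)
    exact congrArg Subtype.val this

theorem exists_psi {A R O T L : Type*} [CommRing A] [CommRing R] [CommRing O] [IsDomain O]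
    [CommRing T] [Algebra A R] [Algebra A O] [Algebra A T] (ι : R →ₐ[A] O) (ev : T →ₐ[A] O)
    (hev : Function.Injective ev) (e : T) (he : e ≠ 0) [CommRing L] [Algebra T L]
    [IsLocalization.Away e L] (S : Set R) (hS : Algebra.adjoin A S = ⊤) (a : R → T)
    (ha : ∀ r ∈ S, ev e * ι r = ev (a r)) :
    ∃ ψ : R →+* L, (∀ x, ψ (algebraMap A R x) = algebraMap T L (algebraMap A T x)) ∧
      (∀ r ∈ S, algebraMap T L e * ψ r = algebraMap T L (a r)) ∧
      ∀ r b n, algebraMap T L b = ψ r * algebraMap T L e ^ n → ev b = ι r * ev e ^ n := by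
  have he0 : ev e ≠ 0 := fun h => he (hev (by rw [h, map_zero]))
  obtain ⟨M, hM⟩ : ∃ M, M = Localization.Away (ev e) := ⟨_, rfl⟩
  let _ : CommRing M := hM ▸ inferInstance
  obtain ⟨alg, loc⟩ : ∃ alg : Algebra O M, IsLocalization.Away (ev e) M := by
    subst hM; exact ⟨inferInstance, inferInstance⟩
  have hinj : Function.Injective (algebraMap O M) :=
    IsLocalization.injective M (powers_le_nonZeroDivisors_of_noZeroDivisors he0)
  let g : L →+* M := IsLocalization.Away.lift e (g := (algebraMap O M).comp ev.toRingHom)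
    (IsLocalization.Away.algebraMap_isUnit (ev e))
  have hg : ∀ x, g (algebraMap T L x) = algebraMap O M (ev x) := fun x =>
    IsLocalization.Away.lift_eq e _ x
  have heu : IsUnit (algebraMap T L e) := IsLocalization.Away.algebraMap_isUnit e
  have hginj : Function.Injective g := by
    refine (injective_iff_map_eq_zero _).2 fun x hx => ?_
    obtain ⟨n, b, hb⟩ := IsLocalization.Away.surj e x
    have h1 := congrArg g hb
    rw [map_mul, hx, zero_mul, hg] at h1
    have h2 : b = 0 := hev (hinj (by rw [← h1, map_zero, map_zero]))
    rw [h2, map_zero] at hb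
    exact ((heu.pow n).mul_left_eq_zero).1 (by simpa using hb)
  obtain ⟨ψ, hψ⟩ := exists_lift_of_range g hginj ((algebraMap O M).comp ι.toRingHom) (by
    have hsub : ∀ r ∈ Algebra.adjoin A S, ((algebraMap O M).comp ι.toRingHom) r ∈ g.range := by
      intro r hr
      induction hr using Algebra.adjoin_induction with
      | mem r hr =>
        refine ⟨algebraMap T L (a r) * ↑(heu.unit⁻¹), ?_⟩
        have h3 : g (algebraMap T L e) * g ↑(heu.unit⁻¹) = 1 := by
          rw [← map_mul, IsUnit.mul_val_inv, map_one]
        rw [hg] at h3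
        have h4 := congrArg (algebraMap O M) (ha r hr)
        rw [map_mul] at h4
        rw [map_mul, hg, ← h4, mul_right_comm, h3, one_mul]
        rfl
      | algebraMap x =>
        refine ⟨algebraMap T L (algebraMap A T x), ?_⟩
        rw [hg, AlgHom.commutes]
        exact congrArg (algebraMap O M) (ι.commutes x).symm
      | add x y _ _ hx hy => rw [map_add]; exact add_mem hx hy
      | mul x y _ _ hx hy => rw [map_mul]; exact mul_mem hx hy
    intro r
    exact hsub r (hS ▸ Algebra.mem_top))
  refine ⟨ψ, fun x => hginj ?_, fun r hr => hginj ?_, fun r b n h => hinj ?_⟩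
  · rw [hψ, hg, AlgHom.commutes]
    exact congrArg (algebraMap O M) (ι.commutes x)
  · rw [map_mul, hψ, hg, hg]
    exact (map_mul _ _ _).symm.trans (congrArg (algebraMap O M) (ha r hr))
  · have := congrArg g h
    rw [map_mul, map_pow, hψ, hg, hg] at this
    rw [this, map_mul, map_pow]
    rfl

end Generator

end BigCM

namespace BigCM

open Ideal

section Package

open Polynomial

lemma exists_pi {A A' O : Type*} [CommRing A] [IsDomain A] [IsIntegrallyClosed A] [CommRing A']
    [IsDomain A'] [IsIntegrallyClosed A'] [CommRing O] [IsDomain O] [Algebra A O]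
    [FaithfulSMul A O] (πA : A →+* A') (hπA : Function.Surjective πA) (P : Ideal O) [P.IsPrime]
    (hP : ∀ a, algebraMap A O a ∈ P ↔ πA a = 0) {z : O} (hz : IsIntegral A z) :
    ∃ (f : A[X]) (h : A'[X]) (ev : AdjoinRoot f →ₐ[A] O) (ev' : AdjoinRoot h →+* O ⧸ P)
      (π : AdjoinRoot f →+* AdjoinRoot h), f.Monic ∧ f.natDegree ≠ 0 ∧ h.Monic ∧ h.natDegree ≠ 0 ∧
      Function.Injective ev ∧ Function.Injective ev' ∧ ev (AdjoinRoot.root f) = z ∧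
      π.comp (AdjoinRoot.of f) = (AdjoinRoot.of h).comp πA ∧
      π (AdjoinRoot.root f) = AdjoinRoot.root h ∧
      ∀ x, ev' (π x) = Ideal.Quotient.mk P (ev x) := by
  obtain ⟨f, hf, hfd, ev, hev, hevz⟩ := exists_adjoinRoot_hom hz
  let j : A' →+* O ⧸ P := RingHom.liftOfSurjective πA hπA
    ⟨(Ideal.Quotient.mk P).comp (algebraMap A O), fun a ha =>
      Ideal.Quotient.eq_zero_iff_mem.2 ((hP a).2 ha)⟩
  have hj : ∀ a, j (πA a) = Ideal.Quotient.mk P (algebraMap A O a) := fun a =>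
    RingHom.liftOfSurjective_comp_apply πA hπA _ a
  have hjinj : Function.Injective j := by
    refine (injective_iff_map_eq_zero _).2 fun x hx => ?_
    obtain ⟨a, rfl⟩ := hπA x
    rw [hj, Ideal.Quotient.eq_zero_iff_mem] at hx
    exact (hP a).1 hx
  let _ : Algebra A' (O ⧸ P) := j.toAlgebra
  have : FaithfulSMul A' (O ⧸ P) := (faithfulSMul_iff_algebraMap_injective _ _).2 hjinj
  have hz' : IsIntegral A' (Ideal.Quotient.mk P z) := by
    obtain ⟨q, hq, hq0⟩ := hz
    refine ⟨q.map πA, hq.map _, ?_⟩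
    have h1 := congrArg (Ideal.Quotient.mk P) hq0
    rw [hom_eval₂, map_zero] at h1
    rw [eval₂_map]
    have h2 : (algebraMap A' (O ⧸ P)).comp πA = (Ideal.Quotient.mk P).comp (algebraMap A O) :=
      RingHom.ext hj
    rw [h2]
    exact h1
  obtain ⟨h, hm, hd, ev', hev', hevz'⟩ := exists_adjoinRoot_hom hz'
  have hcomp : (ev' : AdjoinRoot h →+* O ⧸ P).comp ((AdjoinRoot.of h).comp πA) =
      ((Ideal.Quotient.mk P).comp (ev : AdjoinRoot f →+* O)).comp (AdjoinRoot.of f) := by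
    ext a
    have h1 : ev' (AdjoinRoot.of h (πA a)) = j (πA a) := ev'.commutes _
    have h2 : ev (AdjoinRoot.of f a) = algebraMap A O a := ev.commutes _
    exact h1.trans ((hj a).trans (congrArg _ h2.symm))
  have h0 : f.eval₂ ((AdjoinRoot.of h).comp πA) (AdjoinRoot.root h) = 0 := by
    apply hev'
    have h1 := hom_eval₂ f ((AdjoinRoot.of h).comp πA) (ev' : AdjoinRoot h →+* O ⧸ P)
      (AdjoinRoot.root h)
    rw [hcomp] at h1
    have h2 := hom_eval₂ f (AdjoinRoot.of f) ((Ideal.Quotient.mk P).comp (ev : AdjoinRoot f →+* O))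
      (AdjoinRoot.root f)
    rw [AdjoinRoot.eval₂_root, map_zero] at h2
    have h3 : (ev' : AdjoinRoot h →+* O ⧸ P) (AdjoinRoot.root h) =
        ((Ideal.Quotient.mk P).comp (ev : AdjoinRoot f →+* O)) (AdjoinRoot.root f) :=
      hevz'.trans (congrArg _ hevz.symm)
    rw [h3] at h1
    exact (h1.trans h2.symm).trans (map_zero ev').symm
  refine ⟨f, h, ev, ev', AdjoinRoot.lift ((AdjoinRoot.of h).comp πA) (AdjoinRoot.root h) h0,
    hf, hfd, hm, hd, hev, hev', hevz, AdjoinRoot.lift_comp_of h0, AdjoinRoot.lift_root h0, ?_⟩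
  have key : (ev' : AdjoinRoot h →+* O ⧸ P).comp
      (AdjoinRoot.lift ((AdjoinRoot.of h).comp πA) (AdjoinRoot.root h) h0) =
      (Ideal.Quotient.mk P).comp (ev : AdjoinRoot f →+* O) := by
    refine AdjoinRoot.ringHom_ext ?_ ?_
    · rw [RingHom.comp_assoc, AdjoinRoot.lift_comp_of, hcomp]
    · rw [RingHom.comp_apply, AdjoinRoot.lift_root]
      exact hevz'.trans (congrArg _ hevz.symm)
  exact fun x => RingHom.congr_fun key x

variable {p : ℕ} [hp : Fact p.Prime]

theorem exists_bigCM_of_generator {A A' R O D₀ D₀' : Type u} [CommRing A] [IsDomain A]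
    [IsIntegrallyClosed A] [CommRing A'] [IsDomain A'] [IsIntegrallyClosed A'] [CommRing R]
    [CommRing O] [IsDomain O] [CommRing D₀] [CharP D₀ p]
    [PerfectRing D₀ p] [CommRing D₀'] [CharP D₀' p] [PerfectRing D₀' p] [Algebra A R]
    [Module.Finite A R] [Algebra A O] [FaithfulSMul A O] (πA : A →+* A')
    (hπA : Function.Surjective πA) (P : Ideal O) [P.IsPrime]
    (hP : ∀ a, algebraMap A O a ∈ P ↔ πA a = 0) (ι : R →ₐ[A] O) (Q : Ideal R)
    (hQ : ∀ r ∈ Q, ι r ∈ P) {z : O} (hz : IsIntegral A z) {e : O} (he : e ∈ Algebra.adjoin A {z})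
    (heP : e ∉ P) (S : Finset R) (hS : Algebra.adjoin A (S : Set R) = ⊤)
    (hSe : ∀ r ∈ S, e * ι r ∈ Algebra.adjoin A {z})
    (t : D₀) (κ : A →+* Untilt p t) (t' : D₀') (κ' : A' →+* Untilt p t') (θ₀ : D₀ →+* D₀')
    (hθ₀ : θ₀ t = t') (hκ : (untiltMap p θ₀ hθ₀).comp κ = κ'.comp πA) (xs : List D₀) (xn : D₀)
    (ws : List A) (s : A) (hws : ws.map κ = xs.map (tau p t)) (hs : κ s = tau p t xn)
    (hreg : WReg ⊥ (t :: (xs ++ [xn])))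
    (hreg' : ∀ l', l'.Perm (xs.map θ₀) → WReg ⊥ (t' :: l'))
    (hne : ofList (t' :: xs.map θ₀) ≠ ⊤) (hH : Separates p (ws.map πA)) :
    ∃ (B C : Type u) (_ : CommRing B) (_ : CommRing C) (ρ : R →+* B) (ρ' : R ⧸ Q →+* C)
      (G : B →+* C), (∀ r, G (ρ r) = ρ' (Ideal.Quotient.mk Q r)) ∧
      WReg ⊥ ((((p : A) :: ws) ++ [s]).map (ρ ∘ algebraMap A R)) ∧
      WReg ⊥ (((p : A) :: ws).map (G ∘ ρ ∘ algebraMap A R)) ∧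
      ofList (((p : A) :: ws).map (G ∘ ρ ∘ algebraMap A R)) ≠ ⊤ := by
  obtain ⟨f, h, ev, ev', π, hf, hfd, hm, hd, hev, hev', hevz, hπ, hπr, hπev⟩ :=
    exists_pi πA hπA P hP hz
  have hrange : ∀ y ∈ Algebra.adjoin A {z}, ∃ b, ev b = y := by
    intro y hy
    rw [← hevz, ← range_adjoinRoot_hom] at hy
    exact hy
  have : IsDomain (AdjoinRoot f) := hev.isDomain (ev : AdjoinRoot f →+* O)
  have : IsDomain (AdjoinRoot h) := hev'.isDomain ev'
  obtain ⟨e₀, rfl⟩ := hrange e he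
  have ha : ∀ r : R, ∃ b : AdjoinRoot f, r ∈ S → ev e₀ * ι r = ev b := by
    intro r
    by_cases hr : r ∈ S
    · obtain ⟨b, hb⟩ := hrange _ (hSe r hr)
      exact ⟨b, fun _ => hb.symm⟩
    · exact ⟨0, fun h1 => absurd h1 hr⟩
  choose a ha using ha
  have hπe : π e₀ ≠ 0 := by
    intro h0
    apply heP
    rw [← Ideal.Quotient.eq_zero_iff_mem, ← hπev, h0, map_zero]
  have he₀ : e₀ ≠ 0 := by
    rintro rfl
    exact hπe (map_zero π)
  obtain ⟨L, hL⟩ : ∃ L, L = Localization.Away e₀ := ⟨_, rfl⟩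
  let _ : CommRing L := hL ▸ inferInstance
  obtain ⟨alg, loc⟩ : ∃ alg : Algebra (AdjoinRoot f) L, IsLocalization.Away e₀ L := by
    subst hL; exact ⟨inferInstance, inferInstance⟩
  obtain ⟨L', hL'⟩ : ∃ L, L = Localization.Away (π e₀) := ⟨_, rfl⟩
  let _ : CommRing L' := hL' ▸ inferInstance
  obtain ⟨alg', loc'⟩ : ∃ alg : Algebra (AdjoinRoot h) L', IsLocalization.Away (π e₀) L' := by
    subst hL'; exact ⟨inferInstance, inferInstance⟩
  obtain ⟨ψ, hψ1, hψ2, hψ3⟩ := exists_psi (L := L) ι ev hev e₀ he₀ (S : Set R) hS a ha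
  let τ : L →+* L' := IsLocalization.Away.lift e₀ (g := (algebraMap (AdjoinRoot h) L').comp π)
    (IsLocalization.Away.algebraMap_isUnit (π e₀))
  have hτ : ∀ x, τ (algebraMap _ L x) = algebraMap _ L' (π x) := fun x =>
    IsLocalization.Away.lift_eq e₀ _ x
  refine exists_bigCM_of_package πA hf hfd hm hd π hπ hπr e₀ hπe τ hτ ψ hψ1 Q ?_ S hS a hψ2 t κ t'
    κ' θ₀ hθ₀ hκ xs xn ws s hws hs hreg hreg' hne hH
  intro r hr
  obtain ⟨n, b, hb⟩ := IsLocalization.Away.surj e₀ (ψ r)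
  have h1 := hψ3 r b n hb.symm
  have h2 : π b = 0 := by
    apply hev'
    rw [hπev, map_zero, Ideal.Quotient.eq_zero_iff_mem, h1]
    exact P.mul_mem_right _ (hQ r hr)
  have h3 := congrArg τ hb
  rw [map_mul, map_pow, hτ, hτ, h2, map_zero] at h3
  exact (((IsLocalization.Away.algebraMap_isUnit (S := L') (π e₀)).pow n).mul_left_eq_zero).1 h3

end Package

end BigCM

namespace BigCM

open Ideal

section Descend

lemma exists_smul_mem_adjoin {A V O : Type*} [CommRing A] [CommRing V] [CommRing O] [Algebra A V]
    [Algebra V O] [Algebra A O] [IsScalarTower A V O] (M : Submonoid A) [IsLocalization M V] {z : O}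
    {y : O} (hy : y ∈ Algebra.adjoin V {z}) : ∃ c ∈ M, c • y ∈ Algebra.adjoin A {z} := by
  induction hy using Algebra.adjoin_induction with
  | mem y hy => exact ⟨1, M.one_mem, by rw [one_smul]; exact Algebra.subset_adjoin hy⟩
  | algebraMap v =>
    obtain ⟨⟨a, c⟩, h⟩ := IsLocalization.surj M v
    refine ⟨c, c.2, ?_⟩
    have h1 := congrArg (algebraMap V O) h
    rw [map_mul, ← IsScalarTower.algebraMap_apply, ← IsScalarTower.algebraMap_apply] at h1
    rw [Algebra.smul_def, mul_comm, h1]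
    exact Subalgebra.algebraMap_mem _ a
  | add x y _ _ hx hy =>
    obtain ⟨c, hc, hx⟩ := hx
    obtain ⟨d, hd, hy⟩ := hy
    refine ⟨c * d, M.mul_mem hc hd, ?_⟩
    rw [smul_add, mul_smul, mul_comm c, mul_smul, smul_comm c d, ← mul_smul d c y, mul_comm d c,
      mul_smul c d y]
    exact add_mem (Subalgebra.smul_mem _ hx d) (Subalgebra.smul_mem _ hy c)
  | mul x y _ _ hx hy =>
    obtain ⟨c, hc, hx⟩ := hx
    obtain ⟨d, hd, hy⟩ := hy
    refine ⟨c * d, M.mul_mem hc hd, ?_⟩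
    rw [← smul_mul_smul_comm]
    exact mul_mem hx hy

theorem exists_generator_descend {A V O : Type*} [CommRing A] [CommRing V] [CommRing O]
    [Algebra A V] [Algebra V O] [Algebra A O] [IsScalarTower A V O] [Algebra.IsIntegral V O]
    (q : Ideal A) [q.IsPrime] [IsLocalization.AtPrime V q] (P : Ideal O) [P.IsPrime]
    (hP : ∀ a, algebraMap A O a ∈ P → a ∈ q) {z e : O} (he : e ∈ Algebra.adjoin V {z}) (heP : e ∉ P)
    (hze : ∀ y, e * y ∈ Algebra.adjoin V {z}) (S : Finset O) :
    ∃ z' e' : O, IsIntegral A z' ∧ e' ∈ Algebra.adjoin A {z'} ∧ e' ∉ P ∧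
      ∀ y ∈ S, e' * y ∈ Algebra.adjoin A {z'} := by
  obtain ⟨c, hc⟩ := IsIntegral.exists_multiple_integral_of_isLocalization q.primeCompl z
    (Algebra.IsIntegral.isIntegral (R := V) z)
  have hadj : Algebra.adjoin V {z} ≤ Algebra.adjoin V {c • z} := by
    have h1 : z = IsLocalization.mk' V 1 c • (c • z) := by
      rw [Submonoid.smul_def, ← algebraMap_smul V (c : A) z, smul_smul, IsLocalization.mk'_spec,
        map_one, one_smul]
    have h2 : z ∈ Algebra.adjoin V {c • z} := by
      have h3 := Subalgebra.smul_mem (Algebra.adjoin V {c • z})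
        (Algebra.subset_adjoin (Set.mem_singleton (c • z))) (IsLocalization.mk' V 1 c)
      rwa [← h1] at h3
    exact Algebra.adjoin_le (Set.singleton_subset_iff.2 h2)
  have hex : ∀ y ∈ Algebra.adjoin V {z}, ∃ d ∈ q.primeCompl, d • y ∈ Algebra.adjoin A {c • z} :=
    fun y hy => exists_smul_mem_adjoin _ (hadj hy)
  obtain ⟨d₀, hd₀, hde⟩ := hex e he
  choose d hd hdy using fun y => hex _ (hze y)
  have hprod : d₀ * ∏ y ∈ S, d y ∈ q.primeCompl :=
    mul_mem hd₀ (prod_mem fun y _ => hd y)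
  refine ⟨c • z, (d₀ * ∏ y ∈ S, d y) • e, hc, ?_, ?_, fun y hy => ?_⟩
  · rw [mul_comm, mul_smul]
    exact Subalgebra.smul_mem _ hde _
  · rw [Algebra.smul_def]
    intro h
    rcases ‹P.IsPrime›.mem_or_mem h with h | h
    · exact hprod (hP _ h)
    · exact heP h
  · obtain ⟨w, hw⟩ := Finset.dvd_prod_of_mem d hy
    rw [hw, smul_mul_assoc, show d₀ * (d y * w) = (d₀ * w) * d y by ring, mul_smul]
    exact Subalgebra.smul_mem _ (hdy y) _

end Descend

section Over

lemma exists_prime_over {A R V K : Type*} [CommRing A] [CommRing R] [IsDomain R] [CommRing V]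
    [Field K] [Algebra A R] [Algebra A V] [Algebra R K] [IsFractionRing R K] [Algebra V K]
    [Algebra A K] [IsScalarTower A R K] [IsScalarTower A V K] (q : Ideal A) [q.IsPrime]
    [IsLocalization.AtPrime V q] (Q : Ideal R) [Q.IsPrime] (hQ : Q.comap (algebraMap A R) = q)
    (ι : R →ₐ[A] integralClosure V K) (hι : ∀ r, (ι r : K) = algebraMap R K r) :
    ∃ P : Ideal (integralClosure V K), P.IsPrime ∧ (∀ r ∈ Q, ι r ∈ P) ∧
      ∀ a, algebraMap A (integralClosure V K) a ∈ P ↔ a ∈ q := by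
  obtain ⟨P₀, hP₀, hP₀Q⟩ := Ideal.exists_ideal_over_prime_of_isIntegral_of_isDomain
    (S := integralClosure R K) Q (by
      rw [(RingHom.injective_iff_ker_eq_bot _).1
        (FaithfulSMul.algebraMap_injective R (integralClosure R K))]
      exact bot_le)
  have key : ∀ y ∈ Q.map (ι : R →+* integralClosure V K), ∃ c ∈ q.primeCompl, ∃ w ∈ P₀,
      algebraMap A K c * (y : K) = (w : K) := by
    intro y hy
    induction hy using Submodule.span_induction with
    | mem y hy =>
      obtain ⟨r, hr, rfl⟩ := hy
      refine ⟨1, q.primeCompl.one_mem, algebraMap R _ r, ?_, ?_⟩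
      · rw [← Ideal.mem_comap, hP₀Q]
        exact hr
      · rw [map_one, one_mul]
        exact hι r
    | zero => exact ⟨1, q.primeCompl.one_mem, 0, zero_mem _, by simp⟩
    | add x y _ _ hx hy =>
      obtain ⟨c, hc, w, hw, h1⟩ := hx
      obtain ⟨d, hd, v, hv, h2⟩ := hy
      refine ⟨c * d, mul_mem hc hd, algebraMap R _ (algebraMap A R d) * w +
        algebraMap R _ (algebraMap A R c) * v, add_mem (P₀.mul_mem_left _ hw)
        (P₀.mul_mem_left _ hv), ?_⟩
      push_cast
      rw [← IsScalarTower.algebraMap_apply A R K, ← IsScalarTower.algebraMap_apply A R K, ← h1,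
        ← h2]
      ring
    | smul o y _ hy =>
      obtain ⟨c, hc, w, hw, h1⟩ := hy
      obtain ⟨d, hd⟩ := IsIntegral.exists_multiple_integral_of_isLocalization q.primeCompl (o : K)
        o.2
      have hd' : IsIntegral R (d • (o : K)) := hd.tower_top
      refine ⟨d * c, mul_mem d.2 hc, ⟨_, hd'⟩ * w, P₀.mul_mem_left _ hw, ?_⟩
      change algebraMap A K (d * c) * ((o : K) * (y : K)) = (d • (o : K)) * (w : K)
      rw [← h1, map_mul, Submonoid.smul_def, Algebra.smul_def]
      ring
  obtain ⟨P, hP, hQP, hdis⟩ := Ideal.exists_le_prime_disjoint (Q.map (ι : R →+* _))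
    (q.primeCompl.map (algebraMap A (integralClosure V K))) (by
      rw [Set.disjoint_left]
      rintro _ hy ⟨a, ha, rfl⟩
      obtain ⟨c, hc, w, hw, h1⟩ := key _ hy
      have h2 : w = algebraMap R _ (algebraMap A R (c * a)) := by
        apply Subtype.ext
        rw [← h1]
        have h3 : ((algebraMap A (integralClosure V K) a : integralClosure V K) : K) =
          algebraMap A K a := rfl
        have h4 : ((algebraMap R (integralClosure R K) (algebraMap A R (c * a)) :
          integralClosure R K) : K) = algebraMap A K (c * a) :=
          (IsScalarTower.algebraMap_apply A R K _).symm
        rw [h3, h4, map_mul]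
      rw [h2, ← Ideal.mem_comap, hP₀Q, ← Ideal.mem_comap, hQ] at hw
      exact (mul_mem hc ha : c * a ∈ q.primeCompl) hw)
  refine ⟨P, hP, fun r hr => hQP (Ideal.mem_map_of_mem _ hr), fun a => ⟨fun h => ?_, fun h => ?_⟩⟩
  · by_contra ha
    exact Set.disjoint_left.1 hdis h ⟨a, ha, rfl⟩
  · have h1 : ι (algebraMap A R a) = algebraMap A (integralClosure V K) a := ι.commutes a
    rw [← hQ] at h
    have h2 : (ι : R →+* integralClosure V K) (algebraMap A R a) ∈ Q.map (ι : R →+* _) :=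
      Ideal.mem_map_of_mem _ h
    rw [← h1]
    exact hQP h2

end Over

end BigCM

namespace BigCM

open Ideal

section Setup

lemma isDedekindDomain_of_principal {A V : Type*} [CommRing A] [IsDomain A] [IsNoetherianRing A]
    [CommRing V] [IsDomain V] [Algebra A V] (x : A) [hq : (span {x}).IsPrime]
    [IsLocalization.AtPrime V (span {x})] : IsDedekindDomain V := by
  have : IsLocalRing V := IsLocalization.AtPrime.isLocalRing V (span {x})
  have : IsNoetherianRing V := IsLocalization.isNoetherianRing (span {x}).primeCompl V inferInstance
  have h := tfae_of_isNoetherianRing_of_isLocalRing_of_isDomain V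
  refine (h.out 4 2).1 ?_
  rw [← IsLocalization.AtPrime.map_eq_maximalIdeal (span {x}) V, Ideal.map_span,
    Set.image_singleton]
  exact ⟨⟨_, rfl⟩⟩

theorem exists_generator_aux {A A' R V F K : Type u} [CommRing A] [IsDomain A] [IsNoetherianRing A]
    [CommRing A'] [IsDomain A'] [CharZero A'] [CommRing R] [IsDomain R]
    [Algebra A R] [Module.Finite A R] [FaithfulSMul A R] (πA : A →+* A') (x : A)
    (hx : x ≠ 0) (hπA : RingHom.ker πA = span {x}) (Q : Ideal R) [Q.IsPrime]
    (hQ : Q.comap (algebraMap A R) = span {x}) [CommRing V] [IsDomain V] [Field F] [Field K]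
    [CharZero F] [Algebra A V]
    [Algebra V F] [IsFractionRing V F] [Algebra R K] [IsFractionRing R K] [Algebra V K]
    [Algebra A K] [Algebra F K] [IsScalarTower V F K] [FiniteDimensional F K]
    [IsScalarTower A R K] [IsScalarTower A V K] [hq : (span {x}).IsPrime]
    [IsLocalization.AtPrime V (span {x})] (S : Finset R) :
    ∃ (O : Type u) (_ : CommRing O) (_ : IsDomain O) (_ : Algebra A O) (_ : FaithfulSMul A O)
      (P : Ideal O) (_ : P.IsPrime) (ι : R →ₐ[A] O) (z e : O),
      (∀ a, algebraMap A O a ∈ P ↔ πA a = 0) ∧ (∀ r ∈ Q, ι r ∈ P) ∧ IsIntegral A z ∧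
      e ∈ Algebra.adjoin A {z} ∧ e ∉ P ∧ ∀ r ∈ S, e * ι r ∈ Algebra.adjoin A {z} := by
  classical
  have : IsDedekindDomain V := isDedekindDomain_of_principal x
  have : IsDedekindDomain (integralClosure V K) := integralClosure.isDedekindDomain V F K
  have : Module.Finite V (integralClosure V K) := IsIntegralClosure.finite V F K _
  have hAK : Function.Injective (algebraMap A K) := by
    rw [IsScalarTower.algebraMap_eq A R K]
    exact (IsFractionRing.injective R K).comp (FaithfulSMul.algebraMap_injective A R)
  have hintegral : ∀ r, IsIntegral V (algebraMap R K r) := fun r =>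
    ((Algebra.IsIntegral.isIntegral (R := A) r).map (IsScalarTower.toAlgHom A R K)).tower_top
  let ι : R →ₐ[A] integralClosure V K :=
    { toFun := fun r => ⟨algebraMap R K r, hintegral r⟩
      map_one' := Subtype.ext (map_one _)
      map_mul' := fun a b => Subtype.ext (map_mul _ _ _)
      map_zero' := Subtype.ext (map_zero _)
      map_add' := fun a b => Subtype.ext (map_add _ _ _)
      commutes' := fun a => Subtype.ext (IsScalarTower.algebraMap_apply A R K a).symm }
  obtain ⟨P, hP, hQP, hPq⟩ := exists_prime_over (span {x}) Q hQ ι fun _ => rfl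
  have : IsLocalRing V := IsLocalization.AtPrime.isLocalRing V (span {x})
  have hker : ∀ a, a ∈ span {x} ↔ πA a = 0 := fun a => by rw [← hπA, RingHom.mem_ker]
  have hxm : algebraMap A V x ∈ IsLocalRing.maximalIdeal V := by
    rw [← IsLocalization.AtPrime.map_eq_maximalIdeal (span {x}) V]
    exact Ideal.mem_map_of_mem _ (mem_span_singleton_self x)
  have hlies : P.LiesOver (IsLocalRing.maximalIdeal V) := by
    refine ⟨(IsLocalRing.maximalIdeal.isMaximal V).eq_of_le (IsPrime.ne_top inferInstance) ?_⟩
    rw [← IsLocalization.AtPrime.map_eq_maximalIdeal (span {x}) V, Ideal.map_span,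
      Set.image_singleton, Ideal.span_le, Set.singleton_subset_iff]
    change algebraMap V (integralClosure V K) (algebraMap A V x) ∈ P
    rw [← IsScalarTower.algebraMap_apply A V (integralClosure V K), hPq]
    exact mem_span_singleton_self x
  have hchar : CharZero (V ⧸ IsLocalRing.maximalIdeal V) := by
    refine charZero_of_inj_zero fun n hn => ?_
    have h1 : algebraMap A V (n : A) ∈ IsLocalRing.maximalIdeal V := by
      rw [map_natCast, ← Ideal.Quotient.eq_zero_iff_mem, map_natCast, hn]
    rw [← Ideal.mem_comap, ← Ideal.under_def, IsLocalization.AtPrime.under_maximalIdeal V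
      (span {x}), hker, map_natCast] at h1
    exact_mod_cast h1
  have hx0 : algebraMap V (integralClosure V K) (algebraMap A V x) ≠ 0 := by
    rw [← IsScalarTower.algebraMap_apply A V (integralClosure V K)]
    intro h
    exact hx (hAK (by simpa using congrArg Subtype.val h))
  obtain ⟨z, e, he, heP, hze⟩ := exists_local_generator (IsLocalRing.maximalIdeal V) P hxm hx0
  have : Algebra.IsIntegral V (integralClosure V K) := inferInstance
  obtain ⟨z', e', hz', he', heP', hS⟩ := exists_generator_descend (span {x}) P
    (fun a => (hPq a).1) he heP hze (S.image ι)
  refine ⟨integralClosure V K, inferInstance, inferInstance, inferInstance,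
    (faithfulSMul_iff_algebraMap_injective _ _).2 fun a b hab => hAK (congrArg Subtype.val hab),
    P, hP, ι, z', e', fun a => (hPq a).trans (hker a), hQP, hz', he', heP', fun r hr =>
    hS _ (Finset.mem_image_of_mem _ hr)⟩

theorem exists_generator {A A' R : Type u} [CommRing A] [IsDomain A] [IsNoetherianRing A]
    [CharZero A] [CommRing A'] [IsDomain A'] [CharZero A'] [CommRing R] [IsDomain R]
    [Algebra A R] [Module.Finite A R] [FaithfulSMul A R] (πA : A →+* A') (x : A)
    (hx : x ≠ 0) (hπA : RingHom.ker πA = span {x}) (Q : Ideal R) [Q.IsPrime]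
    (hQ : Q.comap (algebraMap A R) = span {x}) (S : Finset R) :
    ∃ (O : Type u) (_ : CommRing O) (_ : IsDomain O) (_ : Algebra A O) (_ : FaithfulSMul A O)
      (P : Ideal O) (_ : P.IsPrime) (ι : R →ₐ[A] O) (z e : O),
      (∀ a, algebraMap A O a ∈ P ↔ πA a = 0) ∧ (∀ r ∈ Q, ι r ∈ P) ∧ IsIntegral A z ∧
      e ∈ Algebra.adjoin A {z} ∧ e ∉ P ∧ ∀ r ∈ S, e * ι r ∈ Algebra.adjoin A {z} := by
  have hq : (span {x}).IsPrime := by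
    rw [← hπA]
    exact RingHom.ker_isPrime _
  let F := FractionRing A
  let K := FractionRing R
  let _ : Algebra F K := FractionRing.liftAlgebra A K
  have : FiniteDimensional F K := .of_isLocalization A R (nonZeroDivisors A)
  have hle : (span {x}).primeCompl ≤ nonZeroDivisors A :=
    Ideal.primeCompl_le_nonZeroDivisors _
  have : CharZero F := charZero_of_injective_algebraMap (IsFractionRing.injective A F)
  exact exists_generator_aux (V := Localization.subalgebra.ofField F (span {x}).primeCompl hle)
    (F := F) (K := K) πA x hx hπA Q hQ S

end Setup

end BigCM

namespace BigCM

open Ideal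

section PowerSeriesIntegrallyClosed

open PowerSeries

lemma dvd_of_forall_pow_dvd {K : Type*} [Field K] {g h r : K⟦X⟧} (hr : r ≠ 0)
    (hd : ∀ n, h ^ n ∣ r * g ^ n) : h ∣ g := by
  by_cases hg : g = 0
  · rw [hg]; exact dvd_zero h
  have hh : h ≠ 0 := by
    rintro rfl
    have := hd 1
    rw [pow_one, zero_dvd_iff, pow_one] at this
    exact mul_ne_zero hr hg this
  have ho : ∀ n : ℕ, n * h.order.toNat ≤ r.order.toNat + n * g.order.toNat := by
    intro n
    have h1 : X ^ (n * h.order.toNat) ∣ r * g ^ n := by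
      refine dvd_trans ?_ (hd n)
      rw [mul_comm, pow_mul]
      exact pow_dvd_pow_of_dvd X_pow_order_dvd n
    have h2 := nat_le_order _ _ (X_pow_dvd_iff.1 h1)
    rw [order_mul, order_pow, ← ENat.natCast_toNat (order_eq_top.not.2 hr),
      ← ENat.natCast_toNat (order_eq_top.not.2 hg), nsmul_eq_mul] at h2
    exact_mod_cast h2
  have hle : h.order.toNat ≤ g.order.toNat := by
    by_contra! hlt
    have h1 := ho (r.order.toNat + 1)
    nlinarith
  have h1 : h ∣ X ^ h.order.toNat := by
    refine ⟨((Unit_of_divided_by_X_pow_order h)⁻¹ : K⟦X⟧ˣ), ?_⟩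
    have h2 := Unit_of_divided_by_X_pow_order_nonzero hh
    have h3 := X_pow_order_mul_divXPowOrder (f := h)
    have h4 : h * (((Unit_of_divided_by_X_pow_order h)⁻¹ : K⟦X⟧ˣ) : K⟦X⟧) = X ^ h.order.toNat *
        (divXPowOrder h * (((Unit_of_divided_by_X_pow_order h)⁻¹ : K⟦X⟧ˣ) : K⟦X⟧)) := by
      rw [← mul_assoc, h3]
    rw [h4, ← h2, Units.mul_inv, mul_one]
  exact h1.trans ((pow_dvd_pow _ hle).trans X_pow_order_dvd)

lemma coeff_self_X_pow_mul {B : Type*} [CommRing B] (m : ℕ) (g : B⟦X⟧) :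
    coeff m (X ^ m * g) = constantCoeff g := by
  have := coeff_X_pow_mul g m 0
  rwa [zero_add, coeff_zero_eq_constantCoeff_apply] at this

lemma exists_coeff_of_almost {A K : Type*} [CommRing A] [IsDomain A] [Field K] [Algebra A K]
    [FaithfulSMul A K] {r : A⟦X⟧} (hr : r ≠ 0) {v : K⟦X⟧}
    (hv : ∀ n, ∃ w : A⟦X⟧, PowerSeries.map (algebraMap A K) w = PowerSeries.map (algebraMap A K) r * v ^ n) :
    IsAlmostIntegral A (coeff 0 v) := by
  set m := r.order.toNat
  have hm : coeff m r ≠ 0 := coeff_order hr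
  refine ⟨coeff m r, mem_nonZeroDivisors_of_ne_zero hm, fun n => ?_⟩
  obtain ⟨w, hw⟩ := hv n
  refine ⟨coeff m w, ?_⟩
  obtain ⟨r', hr'⟩ : X ^ m ∣ r := X_pow_order_dvd
  have h1 : PowerSeries.map (algebraMap A K) r * v ^ n =
      X ^ m * (PowerSeries.map (algebraMap A K) r' * v ^ n) := by
    rw [← mul_assoc]
    congr 1
    conv_lhs => rw [hr', map_mul, map_pow, PowerSeries.map_X]
  have h2 : coeff m r = constantCoeff r' := by
    conv_lhs => rw [hr', coeff_self_X_pow_mul]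
  rw [← coeff_map, hw, h1, h2, coeff_self_X_pow_mul, map_mul, map_pow, Algebra.smul_def,
    coeff_zero_eq_constantCoeff_apply, ← coeff_zero_eq_constantCoeff_apply (PowerSeries.map _ r'),
    coeff_map, coeff_zero_eq_constantCoeff_apply]

lemma exists_map_of_almost {A K : Type*} [CommRing A] [IsDomain A] [Field K] [Algebra A K]
    [FaithfulSMul A K] (hA : ∀ x : K, IsAlmostIntegral A x → x ∈ (algebraMap A K).range)
    {r : A⟦X⟧} (hr : r ≠ 0) {u : K⟦X⟧}
    (hu : ∀ n, ∃ w : A⟦X⟧, PowerSeries.map (algebraMap A K) w = PowerSeries.map (algebraMap A K) r * u ^ n) :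
    ∃ w : A⟦X⟧, PowerSeries.map (algebraMap A K) w = u := by
  have key : ∀ i, ∃ (a : A⟦X⟧) (v : K⟦X⟧), u = PowerSeries.map (algebraMap A K) a + X ^ i * v := by
    intro i
    induction i with
    | zero => exact ⟨0, u, by simp⟩
    | succ i ih =>
      obtain ⟨a, v, hav⟩ := ih
      have hv : ∀ n, ∃ w : A⟦X⟧, PowerSeries.map (algebraMap A K) w = PowerSeries.map (algebraMap A K) r * v ^ n := by
        intro n
        choose w hw using hu
        have h1 : ∃ w' : A⟦X⟧, PowerSeries.map (algebraMap A K) w' =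
            PowerSeries.map (algebraMap A K) r * (X ^ i * v) ^ n := by
          have h2 : X ^ i * v = u + PowerSeries.map (algebraMap A K) (-a) := by rw [hav, map_neg]; ring
          refine ⟨∑ j ∈ Finset.range (n + 1), w j * (-a) ^ (n - j) * (n.choose j : A⟦X⟧), ?_⟩
          rw [h2, add_pow, Finset.mul_sum, map_sum]
          refine Finset.sum_congr rfl fun j _ => ?_
          rw [map_mul, map_mul, hw, map_pow, map_natCast]
          ring
        obtain ⟨w', hw'⟩ := h1
        rw [mul_pow, ← pow_mul, mul_left_comm] at hw'
        refine ⟨PowerSeries.mk fun j => coeff (j + i * n) w', ?_⟩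
        ext j
        rw [coeff_map, coeff_mk, ← coeff_map, hw', coeff_X_pow_mul]
      obtain ⟨c, hc⟩ := hA _ (exists_coeff_of_almost hr hv)
      obtain ⟨v', hv'⟩ : X ∣ v - PowerSeries.map (algebraMap A K) (C c) := by
        rw [X_dvd_iff, map_sub, map_C, constantCoeff_C, hc, coeff_zero_eq_constantCoeff_apply,
          sub_self]
      refine ⟨a + X ^ i * C c, v', ?_⟩
      rw [sub_eq_iff_eq_add] at hv'
      rw [hav, hv', map_add, map_mul, map_pow, map_X, pow_succ]
      ring
  choose a v hav using key
  refine ⟨PowerSeries.mk fun i => coeff i (a (i + 1)), ?_⟩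
  ext i
  rw [coeff_map, coeff_mk, ← coeff_map, hav (i + 1), map_add, coeff_X_pow_mul', if_neg (by omega),
    add_zero]

instance isIntegrallyClosed_powerSeries {A : Type*} [CommRing A] [IsDomain A] [IsNoetherianRing A]
    [IsIntegrallyClosed A] : IsIntegrallyClosed A⟦X⟧ := by
  let F := FractionRing A⟦X⟧
  let K := FractionRing A
  have hinj : Function.Injective (PowerSeries.map (algebraMap A K)) :=
    map_injective _ (IsFractionRing.injective A K)
  rw [isIntegrallyClosed_iff F]
  intro x hx
  obtain ⟨r, hr, hrx⟩ := hx.isAlmostIntegral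
  have hr0 : r ≠ 0 := nonZeroDivisors.ne_zero hr
  obtain ⟨g, h, hh, rfl⟩ := IsFractionRing.div_surjective A⟦X⟧ x
  have hh0 : h ≠ 0 := nonZeroDivisors.ne_zero hh
  have hhF : algebraMap A⟦X⟧ F h ≠ 0 := by
    rwa [Ne, FaithfulSMul.algebraMap_eq_zero_iff]
  have hw : ∀ n, ∃ w, h ^ n * w = r * g ^ n := by
    intro n
    obtain ⟨w, hw⟩ := hrx n
    refine ⟨w, IsFractionRing.injective A⟦X⟧ F ?_⟩
    rw [map_mul, hw, Algebra.smul_def, map_mul, map_pow, map_pow, div_pow,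
      mul_left_comm, mul_div_cancel₀ _ (pow_ne_zero n hhF)]
  have hd : PowerSeries.map (algebraMap A K) h ∣ PowerSeries.map (algebraMap A K) g := by
    refine dvd_of_forall_pow_dvd (r := PowerSeries.map (algebraMap A K) r)
      (fun h0 => hr0 (hinj (by rw [h0, map_zero]))) fun n => ?_
    obtain ⟨w, hw⟩ := hw n
    exact ⟨PowerSeries.map (algebraMap A K) w, by rw [← map_pow, ← map_pow, ← map_mul, ← map_mul, hw]⟩
  obtain ⟨u, hu⟩ := hd
  have hmh : PowerSeries.map (algebraMap A K) h ≠ 0 := fun h0 => hh0 (hinj (by rw [h0, map_zero]))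
  obtain ⟨w, hw'⟩ := exists_map_of_almost (A := A) (K := K) (r := r) (u := u) (fun y hy => by
    obtain ⟨z, hz⟩ := (isIntegrallyClosed_iff K).1 ‹_› hy.isIntegral
    exact ⟨z, hz⟩) hr0 (fun n => by
    obtain ⟨w, hw⟩ := hw n
    refine ⟨w, mul_left_cancel₀ (pow_ne_zero n hmh) ?_⟩
    have h1 := congrArg (PowerSeries.map (algebraMap A K)) hw
    rw [map_mul, map_pow, map_mul, map_pow, hu] at h1
    rw [h1]
    ring)
  have hg : g = h * w := hinj (by rw [map_mul, hw', hu])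
  refine ⟨w, ?_⟩
  rw [hg, map_mul, mul_div_cancel_left₀ _ hhF]

end PowerSeriesIntegrallyClosed

section PowerSeriesLocal

open PowerSeries

instance isLocalRing_powerSeries {A : Type*} [CommRing A] [IsLocalRing A] : IsLocalRing A⟦X⟧ :=
  inferInstance

lemma mem_maximalIdeal_powerSeries {A : Type*} [CommRing A] [IsLocalRing A] (f : A⟦X⟧) :
    f ∈ IsLocalRing.maximalIdeal A⟦X⟧ ↔ constantCoeff f ∈ IsLocalRing.maximalIdeal A := by
  rw [IsLocalRing.mem_maximalIdeal, IsLocalRing.mem_maximalIdeal, mem_nonunits_iff, mem_nonunits_iff,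
    isUnit_iff_constantCoeff]

lemma maximalIdeal_powerSeries {A : Type*} [CommRing A] [IsLocalRing A] (l : List A)
    (hl : IsLocalRing.maximalIdeal A = ofList l) :
    IsLocalRing.maximalIdeal A⟦X⟧ = ofList (l.map C ++ [X]) := by
  apply le_antisymm
  · intro f hf
    rw [mem_maximalIdeal_powerSeries, hl] at hf
    obtain ⟨g, hg⟩ : X ∣ f - C (constantCoeff f) := by
      rw [X_dvd_iff, map_sub, constantCoeff_C, sub_self]
    rw [sub_eq_iff_eq_add] at hg
    rw [hg, ofList_append]
    refine add_mem (Ideal.mem_sup_right ?_) (Ideal.mem_sup_left ?_)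
    · rw [mul_comm]
      exact Ideal.mul_mem_left _ _ (by simp)
    · rw [← map_ofList]
      exact Ideal.mem_map_of_mem _ hf
  · rw [ofList_append, sup_le_iff, ← map_ofList, ← hl]
    constructor
    · rw [Ideal.map_le_iff_le_comap]
      intro a ha
      rw [Ideal.mem_comap, mem_maximalIdeal_powerSeries, constantCoeff_C]
      exact ha
    · rw [ofList_singleton, Ideal.span_singleton_le_iff_mem, mem_maximalIdeal_powerSeries,
        constantCoeff_X]
      exact zero_mem _

end PowerSeriesLocal

end BigCM

namespace BigCM

open Ideal

section AdicFinite

lemma finite_of_adic {A R : Type*} [CommRing A] [CommRing R] (x : A) [IsAdicComplete (span {x}) A]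
    (φ : A →+* R) (hsep : ∀ r, (∀ n, φ x ^ n ∣ r) → r = 0) {ι : Type*} [Fintype ι] (s : ι → R)
    (hs : ∀ y, ∃ c : ι → A, φ x ∣ y - ∑ i, φ (c i) * s i) : φ.Finite := by
  choose c d hd using hs
  have key : ∀ y n, y = ∑ k ∈ Finset.range n, φ x ^ k * ∑ i, φ (c (d^[k] y) i) * s i +
      φ x ^ n * d^[n] y := by
    intro y n
    induction n with
    | zero => simp
    | succ n ih =>
      rw [Finset.sum_range_succ, Function.iterate_succ_apply']
      have := hd (d^[n] y)
      rw [sub_eq_iff_eq_add] at this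
      conv_lhs => rw [ih]
      conv_lhs => rw [this]
      rw [pow_succ]
      ring
  let := φ.toAlgebra
  refine Module.Finite.of_surjective (Fintype.linearCombination A s) fun y => ?_
  choose L hL using fun i => exists_adic_sum x fun k => c (d^[k] y) i
  refine ⟨L, ?_⟩
  rw [Fintype.linearCombination_apply, ← sub_eq_zero]
  refine hsep _ fun n => ?_
  have h1 : (∑ i, L i • s i) - y = ∑ i, φ (L i - ∑ k ∈ Finset.range n, x ^ k * c (d^[k] y) i) * s i
      - φ x ^ n * d^[n] y := by
    conv_lhs => rw [key y n]
    simp only [map_sub, map_sum, map_mul, map_pow, sub_mul, Finset.sum_sub_distrib, Finset.mul_sum,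
      Finset.sum_mul, Algebra.smul_def]
    rw [Finset.sum_comm (s := Finset.range n)]
    simp only [mul_assoc]
    rw [sub_add_eq_sub_sub]
    rfl
  rw [h1]
  refine dvd_sub (Finset.dvd_sum fun i _ => Dvd.dvd.mul_right ?_ _) (dvd_mul_right _ _)
  rw [← map_pow]
  exact map_dvd φ (hL i n)

lemma exists_approx {Λ R : Type*} [CommRing Λ] [CommRing R] (φ : Λ →+* R) (I : Ideal R)
    (hI : I.FG) (hφ : ∀ r, ∃ a, r - φ a ∈ I) (n : ℕ) :
    ∃ (k : ℕ) (s : Fin k → R), ∀ y, ∃ c : Fin k → Λ, y - ∑ i, φ (c i) * s i ∈ I ^ n := by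
  induction n with
  | zero => exact ⟨0, Fin.elim0, fun y => ⟨Fin.elim0, by simp⟩⟩
  | succ n ih =>
    obtain ⟨k, s, hs⟩ := ih
    obtain ⟨m, g, hg⟩ := Submodule.fg_iff_exists_fin_generating_family.mp (hI.pow (n := n))
    refine ⟨k + m, Fin.append s g, fun y => ?_⟩
    obtain ⟨c, hc⟩ := hs y
    rw [← hg, Submodule.mem_span_range_iff_exists_fun] at hc
    obtain ⟨d, hd⟩ := hc
    choose a ha using hφ
    refine ⟨Fin.append c fun j => a (d j), ?_⟩
    rw [Fin.sum_univ_add]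
    simp only [Fin.append_left, Fin.append_right]
    rw [← sub_sub, ← hd, ← Finset.sum_sub_distrib, pow_succ']
    refine Ideal.sum_mem _ fun j _ => ?_
    rw [smul_eq_mul, ← sub_mul]
    refine Ideal.mul_mem_mul (ha _) ?_
    rw [← hg]
    exact Submodule.subset_span ⟨j, rfl⟩

end AdicFinite

section WittLift

variable {p : ℕ} [Fact p.Prime]

open WittVector

variable {k R : Type*} [CommRing k] [CharP k p] [PerfectRing k p] [CommRing R]
variable (I : Ideal R) (e : k →+* R ⧸ I)

lemma ghostComponent_mem_pow (hp : (p : R) ∈ I) (n : ℕ) {x : WittVector p R}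
    (hx : WittVector.map (Ideal.Quotient.mk I) x = 0) : ghostComponent n x ∈ I ^ (n + 1) := by
  rw [ghostComponent_apply, aeval_wittPolynomial]
  refine Ideal.sum_mem _ fun i hi => ?_
  have h1 : x.coeff i ∈ I := by
    rw [← Ideal.Quotient.eq_zero_iff_mem, ← WittVector.map_coeff, hx, WittVector.zero_coeff]
  have h2 := Ideal.mul_mem_mul (Ideal.pow_mem_pow hp i) (Ideal.pow_mem_pow h1 (p ^ (n - i)))
  rw [← pow_add] at h2
  refine Ideal.pow_le_pow_right ?_ h2
  have h3 : n - i < p ^ (n - i) := Nat.lt_pow_self (Fact.out : p.Prime).one_lt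
  have := Finset.mem_range.mp hi
  omega

noncomputable def ghostMod (hp : (p : R) ∈ I) (n : ℕ) :
    WittVector p (R ⧸ I) →+* R ⧸ I ^ (n + 1) :=
  RingHom.liftOfSurjective (WittVector.map (Ideal.Quotient.mk I))
    (WittVector.map_surjective _ Ideal.Quotient.mk_surjective)
    ⟨(Ideal.Quotient.mk (I ^ (n + 1))).comp (ghostComponent n), fun x hx => by
      rw [RingHom.mem_ker] at hx ⊢
      exact Ideal.Quotient.eq_zero_iff_mem.mpr (ghostComponent_mem_pow I hp n hx)⟩

lemma ghostMod_map (hp : (p : R) ∈ I) (n : ℕ) (x : WittVector p R) :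
    ghostMod I hp n (WittVector.map (Ideal.Quotient.mk I) x) =
      Ideal.Quotient.mk _ (ghostComponent n x) :=
  RingHom.liftOfSurjective_comp_apply ..

noncomputable def thetaMod (hp : (p : R) ∈ I) (n : ℕ) : WittVector p k →+* R ⧸ I ^ (n + 1) :=
  (ghostMod I hp n).comp ((WittVector.map e).comp
    (WittVector.map ((_root_.frobeniusEquiv k p).symm ^ n : k →+* k)))

lemma thetaMod_teichmuller (hp : (p : R) ∈ I) (n : ℕ) (a : k) (r : R)
    (hr : Ideal.Quotient.mk I r = e (((_root_.frobeniusEquiv k p).symm)^[n] a)) :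
    thetaMod I e hp n (teichmuller p a) = Ideal.Quotient.mk _ (r ^ p ^ n) := by
  have h1 : ((_root_.frobeniusEquiv k p).symm ^ n : k →+* k) a =
      ((_root_.frobeniusEquiv k p).symm)^[n] a := by
    rw [RingHom.coe_pow]
    rfl
  have h2 : thetaMod I e hp n (teichmuller p a) =
      ghostMod I hp n (teichmuller p (e (((_root_.frobeniusEquiv k p).symm)^[n] a))) := by
    rw [thetaMod, RingHom.comp_apply, RingHom.comp_apply, map_teichmuller, map_teichmuller, h1]
  rw [h2, ← hr, ← map_teichmuller, ghostMod_map, ghostComponent_teichmuller]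

lemma thetaMod_succ (hp : (p : R) ∈ I) (n : ℕ) :
    (Ideal.Quotient.factorPowSucc I (n + 1)).comp (thetaMod I e hp (n + 1)) =
      thetaMod I e hp n := by
  refine eq_of_apply_teichmuller_eq _ _ ⟨n + 1, ?_⟩ fun a => ?_
  · rw [← map_natCast (Ideal.Quotient.mk (I ^ (n + 1))), ← map_pow]
    exact Ideal.Quotient.eq_zero_iff_mem.mpr (Ideal.pow_mem_pow hp _)
  · obtain ⟨r, hr⟩ := Ideal.Quotient.mk_surjective
      (e (((_root_.frobeniusEquiv k p).symm)^[n + 1] a))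
    have h1 : Ideal.Quotient.mk I (r ^ p) = e (((_root_.frobeniusEquiv k p).symm)^[n] a) := by
      rw [map_pow, hr, ← map_pow, Function.iterate_succ_apply', frobeniusEquiv_symm_pow_p]
    rw [RingHom.comp_apply, thetaMod_teichmuller I e hp (n + 1) a r hr,
      thetaMod_teichmuller I e hp n a _ h1, ← pow_mul, ← pow_succ']
    rfl

lemma exists_witt_lift [IsAdicComplete I R] (hp : (p : R) ∈ I) :
    ∃ θ : WittVector p k →+* R, ∀ w, Ideal.Quotient.mk I (θ w) = e (w.coeff 0) := by
  refine ⟨IsAdicComplete.StrictMono.liftRingHom I Order.succ_strictMono (thetaMod I e hp)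
    (fun {m} => thetaMod_succ I e hp m), fun w => ?_⟩
  have h := IsAdicComplete.StrictMono.mk_liftRingHom I Order.succ_strictMono (thetaMod I e hp)
    (fun {m} => thetaMod_succ I e hp m) (n := 0) w
  obtain ⟨x, hx⟩ := WittVector.map_surjective _ Ideal.Quotient.mk_surjective (WittVector.map e w)
  have h2 : thetaMod I e hp 0 w = Ideal.Quotient.mk _ (x.coeff 0) := by
    have h3 : thetaMod I e hp 0 w = ghostMod I hp 0 (WittVector.map e w) := by
      rw [thetaMod, RingHom.comp_apply, RingHom.comp_apply]
      congr 2
    rw [h3, ← hx, ghostMod_map, ghostComponent_apply, aeval_wittPolynomial]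
    simp
  have h3 : Ideal.Quotient.mk I (x.coeff 0) = e (w.coeff 0) := by
    rw [← WittVector.map_coeff, hx, WittVector.map_coeff]
  rw [← h3]
  have h4 := h.trans h2
  have h5 := Ideal.Quotient.eq.mp h4
  rw [Ideal.Quotient.eq]
  simpa using h5

end WittLift

end BigCM

namespace BigCM

open Ideal

section PowerSeriesHom

open PowerSeries

lemma pow_dvd_eval₂_sub_eval₂_trunc {A E : Type*} [CommRing A] [CommRing E] (φ : A →+* E) (y : E)
    (P : Polynomial A) (n : ℕ) :
    y ^ n ∣ P.eval₂ φ y - (trunc n (P : A⟦X⟧)).eval₂ φ y := by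
  obtain ⟨q, hq⟩ : Polynomial.X ^ n ∣ P - trunc n (P : A⟦X⟧) := by
    rw [Polynomial.X_pow_dvd_iff]
    intro d hd
    rw [Polynomial.coeff_sub, coeff_trunc, if_pos hd, Polynomial.coeff_coe, sub_self]
  rw [← Polynomial.eval₂_sub, hq, Polynomial.eval₂_mul, Polynomial.eval₂_pow, Polynomial.eval₂_X]
  exact dvd_mul_right _ _

theorem exists_powerSeries_hom {A E : Type*} [CommRing A] [CommRing E] (φ : A →+* E) (y : E)
    (F : ℕ → Ideal E) (hF : ∀ n, y ^ n ∈ F n)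
    (hcomplete : ∀ e : ℕ → E, (∀ n, e (n + 1) - e n ∈ F n) → ∃ L, ∀ n, L - e n ∈ F n)
    (hsep : ∀ x, (∀ n, x ∈ F n) → x = 0) :
    ∃ Φ : A⟦X⟧ →+* E, (∀ a, Φ (C a) = φ a) ∧ Φ X = y ∧
      ∀ f n, Φ f - (trunc n f).eval₂ φ y ∈ F n := by
  have h1 : ∀ f : A⟦X⟧, ∃ L, ∀ n, L - (trunc n f).eval₂ φ y ∈ F n := by
    intro f
    refine hcomplete _ fun n => ?_
    rw [trunc_succ, Polynomial.eval₂_add, add_sub_cancel_left, Polynomial.eval₂_monomial]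
    exact Ideal.mul_mem_left _ _ (hF n)
  choose L hL using h1
  have uniq : ∀ f x, (∀ n, x - (trunc n f).eval₂ φ y ∈ F n) → L f = x := by
    intro f x hx
    refine sub_eq_zero.mp (hsep _ fun n => ?_)
    have := sub_mem (hL f n) (hx n)
    rwa [sub_sub_sub_cancel_right] at this
  have hcoe : ∀ P : Polynomial A, L P = P.eval₂ φ y := by
    refine fun P => uniq _ _ fun n => ?_
    exact Ideal.mem_of_dvd _ (pow_dvd_eval₂_sub_eval₂_trunc φ y P n) (hF n)
  refine ⟨{ toFun := L, map_one' := ?_, map_mul' := fun f g => ?_, map_zero' := ?_,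
            map_add' := fun f g => ?_ }, fun a => ?_, ?_, hL⟩
  · rw [← Polynomial.coe_one, hcoe, Polynomial.eval₂_one]
  · refine uniq _ _ fun n => ?_
    have h2 : (trunc n (f * g)).eval₂ φ y - (trunc n f).eval₂ φ y * (trunc n g).eval₂ φ y ∈ F n := by
      have := pow_dvd_eval₂_sub_eval₂_trunc φ y (trunc n f * trunc n g) n
      rw [Polynomial.coe_mul, trunc_trunc_mul_trunc, Polynomial.eval₂_mul] at this
      rw [← neg_mem_iff, neg_sub]
      exact Ideal.mem_of_dvd _ this (hF n)
    have h3 : L f * L g - (trunc n (f * g)).eval₂ φ y = L f * (L g - (trunc n g).eval₂ φ y) +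
        (L f - (trunc n f).eval₂ φ y) * (trunc n g).eval₂ φ y -
        ((trunc n (f * g)).eval₂ φ y - (trunc n f).eval₂ φ y * (trunc n g).eval₂ φ y) := by ring
    rw [h3]
    exact sub_mem (add_mem (Ideal.mul_mem_left _ _ (hL g n)) (Ideal.mul_mem_right _ _ (hL f n))) h2
  · rw [← Polynomial.coe_zero, hcoe, Polynomial.eval₂_zero]
  · refine uniq _ _ fun n => ?_
    rw [map_add, Polynomial.eval₂_add, add_sub_add_comm]
    exact add_mem (hL f n) (hL g n)
  · change L (C a) = φ a
    rw [← Polynomial.coe_C, hcoe, Polynomial.eval₂_C]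
  · change L X = y
    rw [← Polynomial.coe_X, hcoe, Polynomial.eval₂_X]

lemma exists_powerSeries_hom_of_isAdicComplete {A R : Type*} [CommRing A] [CommRing R]
    (I : Ideal R) [IsAdicComplete I R] (φ : A →+* R) {y : R} (hy : y ∈ I) :
    ∃ Φ : A⟦X⟧ →+* R, (∀ a, Φ (C a) = φ a) ∧ Φ X = y := by
  suffices h : _ ∧ _ from
    let ⟨Φ, h1, h2, _⟩ := exists_powerSeries_hom φ y (fun n => I ^ n)
      (fun n => Ideal.pow_mem_pow hy n) h.1 h.2
    ⟨Φ, h1, h2⟩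
  refine ⟨fun e he => ?_, fun x hx => ?_⟩
  · have hc : ∀ {m n : ℕ}, m ≤ n → e m ≡ e n [SMOD (I ^ m • ⊤ : Submodule R R)] := by
      intro m n hmn
      rw [SModEq.comm, SModEq.sub_mem, smul_eq_mul, mul_top]
      induction n, hmn using Nat.le_induction with
      | base => simp
      | succ n hmn ih =>
        have := add_mem (Ideal.pow_le_pow_right hmn (he n)) ih
        rwa [sub_add_sub_cancel] at this
    obtain ⟨L, hL⟩ := IsPrecomplete.prec' (I := I) e hc
    refine ⟨L, fun n => ?_⟩
    have := (hL n).symm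
    rwa [SModEq.sub_mem, smul_eq_mul, mul_top] at this
  · refine IsHausdorff.haus' (I := I) x fun n => ?_
    rw [SModEq.zero, smul_eq_mul, mul_top]
    exact hx n

variable {p : ℕ} [Fact p.Prime]

open WittVector

/-- The ideal of Witt vectors all of whose components are divisible by `X ^ n`. -/
noncomputable def wittFil (p : ℕ) [Fact p.Prime] (S : Type*) [CommRing S] (n : ℕ) : Ideal (WittVector p S⟦X⟧) :=
  RingHom.ker (WittVector.map (Ideal.Quotient.mk (span {(X : S⟦X⟧) ^ n})) :
    WittVector p S⟦X⟧ →+* WittVector p (S⟦X⟧ ⧸ span {(X : S⟦X⟧) ^ n}))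

lemma mem_wittFil {S : Type*} [CommRing S] {n : ℕ} {w : WittVector p S⟦X⟧} :
    w ∈ wittFil p S n ↔ ∀ i, X ^ n ∣ w.coeff i := by
  rw [wittFil, RingHom.mem_ker, WittVector.ext_iff]
  refine forall_congr' fun i => ?_
  rw [WittVector.map_coeff, WittVector.zero_coeff, Ideal.Quotient.eq_zero_iff_mem,
    mem_span_singleton]

lemma sub_mem_wittFil {S : Type*} [CommRing S] {n : ℕ} {v w : WittVector p S⟦X⟧} :
    v - w ∈ wittFil p S n ↔ ∀ i, X ^ n ∣ v.coeff i - w.coeff i := by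
  rw [wittFil, RingHom.mem_ker, map_sub, sub_eq_zero, WittVector.ext_iff]
  refine forall_congr' fun i => ?_
  rw [WittVector.map_coeff, WittVector.map_coeff, Ideal.Quotient.eq, mem_span_singleton]

lemma exists_witt_powerSeries_hom {A S : Type*} [CommRing A] [CommRing S]
    (σ : A →+* WittVector p S) :
    ∃ σ' : A⟦X⟧ →+* WittVector p S⟦X⟧,
      (∀ a, σ' (C a) = WittVector.map (C : S →+* S⟦X⟧) (σ a)) ∧ σ' X = teichmuller p X ∧
      (WittVector.map (constantCoeff : S⟦X⟧ →+* S)).comp σ' = σ.comp constantCoeff := by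
  suffices h : (∀ n, teichmuller p (X : S⟦X⟧) ^ n ∈ wittFil p S n) ∧
      (∀ e : ℕ → WittVector p S⟦X⟧, (∀ n, e (n + 1) - e n ∈ wittFil p S n) →
        ∃ L, ∀ n, L - e n ∈ wittFil p S n) ∧ ∀ x, (∀ n, x ∈ wittFil p S n) → x = 0 by
    obtain ⟨Φ, h1, h2, h3⟩ := exists_powerSeries_hom ((WittVector.map (C : S →+* S⟦X⟧)).comp σ)
      (teichmuller p (X : S⟦X⟧)) (wittFil p S) h.1 h.2.1 h.2.2
    refine ⟨Φ, h1, h2, RingHom.ext fun f => ?_⟩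
    have h4 := h3 f 1
    rw [sub_mem_wittFil] at h4
    have h5 : (trunc 1 f).eval₂ ((WittVector.map (C : S →+* S⟦X⟧)).comp σ)
        (teichmuller p (X : S⟦X⟧)) = WittVector.map (C : S →+* S⟦X⟧) (σ (constantCoeff f)) := by
      rw [trunc_one_left, Polynomial.eval₂_C]
      simp
    rw [h5] at h4
    ext i
    have h6 := h4 i
    rw [pow_one, X_dvd_iff, map_sub, sub_eq_zero, WittVector.map_coeff, constantCoeff_C] at h6
    rw [RingHom.comp_apply, WittVector.map_coeff, h6, RingHom.comp_apply]
  refine ⟨?_, ?_, ?_⟩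
  · intro n
    rw [← map_pow, mem_wittFil]
    intro i
    rcases i with _ | i
    · rw [teichmuller_coeff_zero]
    · rw [teichmuller_coeff_pos _ _ _ i.succ_pos]
      exact dvd_zero _
  · intro e he
    have he' : ∀ i n m, n ≤ m → X ^ n ∣ (e m).coeff i - (e n).coeff i := by
      intro i n m hnm
      induction m, hnm using Nat.le_induction with
      | base => simp
      | succ m hm ih =>
        have h4 := (pow_dvd_pow _ hm).trans (sub_mem_wittFil.mp (he m) i)
        have := dvd_add h4 ih
        rwa [sub_add_sub_cancel] at this
    refine ⟨WittVector.mk p fun i => PowerSeries.mk fun j => coeff j ((e (j + 1)).coeff i),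
      fun n => sub_mem_wittFil.mpr fun i => ?_⟩
    rw [X_pow_dvd_iff]
    intro j hj
    have h4 := he' i (j + 1) n hj
    rw [X_pow_dvd_iff] at h4
    have h5 := h4 j j.lt_succ_self
    rw [map_sub, sub_eq_zero] at h5
    rw [map_sub, h5, sub_eq_zero]
    exact PowerSeries.coeff_mk j fun j => coeff j ((e (j + 1)).coeff i)
  · intro w hw
    ext i : 1
    rw [WittVector.zero_coeff]
    ext j
    have := X_pow_dvd_iff.mp (mem_wittFil.mp (hw (j + 1)) i) j j.lt_succ_self
    rw [this, map_zero]

end PowerSeriesHom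

end BigCM

namespace BigCM

open Ideal

section Separated

lemma ofList_le_radical_pow {B : Type*} [CommRing B] (l : List B) (N : ℕ) :
    ofList l ≤ (ofList (l.map (· ^ N))).radical := by
  refine span_le.mpr fun z hz => ⟨N, mem_ofList (List.mem_map.mpr ⟨z, hz, rfl⟩)⟩

lemma exists_pow_le_ofList_pow {B : Type*} [CommRing B] (l : List B) (N : ℕ) :
    ∃ M, ofList l ^ M ≤ ofList (l.map (· ^ N)) := by
  refine Ideal.exists_pow_le_of_le_radical_of_fg (ofList_le_radical_pow l N) ?_
  exact ⟨(List.finite_toSet l).toFinset, by simp [ofList]⟩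

lemma ofList_pow_le {B : Type*} [CommRing B] (l : List B) (N : ℕ) :
    ofList (l.map (· ^ N)) ≤ ofList l ^ N := by
  refine span_le.mpr fun z hz => ?_
  obtain ⟨y, hy, rfl⟩ := List.mem_map.mp hz
  exact Ideal.pow_mem_pow (mem_ofList hy) N

lemma mem_sup_of_pow_mul_mem {B : Type*} [CommRing B] {l : List B} {x : B}
    (h : WReg ⊥ (l ++ [x])) {α : ℕ} {b : B}
    (hb : ∀ N, x ^ α * b ∈ ofList (l ++ [x]) ^ N) (N : ℕ) :
    b ∈ ofList l ^ N ⊔ span {x} := by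
  obtain ⟨N', hN', hα⟩ : ∃ N', N ≤ N' ∧ α + 1 ≤ N' := ⟨max N (α + 1), le_max_left _ _, le_max_right _ _⟩
  have h1 : WReg ⊥ (l.map (· ^ N') ++ [x]) := by
    have h2 := h.pow N'
    rw [List.map_append] at h2
    refine WReg.replace_last (N := 1) (c := x ^ (N' - 1)) h2 ?_
    have h3 : (x ^ N') ^ 1 - x ^ (N' - 1) * x = 0 := by
      rw [pow_one, ← pow_succ, Nat.sub_add_cancel (by omega), sub_self]
    rw [h3]
    exact zero_mem _
  rw [wreg_append, bot_sup_eq] at h1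
  have h4 : ∀ m c, x ^ m * c ∈ ofList (l.map (· ^ N')) → c ∈ ofList (l.map (· ^ N')) := by
    intro m
    induction m with
    | zero => simp
    | succ m ih =>
      intro c hc
      refine h1.2.1 _ (ih _ ?_)
      rwa [← mul_assoc, ← pow_succ]
  obtain ⟨M, hM⟩ := exists_pow_le_ofList_pow (l ++ [x]) N'
  have h5 := hM (hb M)
  rw [List.map_append, ofList_append, List.map_singleton, ofList_singleton,
    Submodule.mem_sup] at h5
  obtain ⟨y, hy, w, hw, hyw⟩ := h5
  obtain ⟨c, rfl⟩ := mem_span_singleton.mp hw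
  have h6 : x ^ α * (b - x ^ (N' - α) * c) ∈ ofList (l.map (· ^ N')) := by
    have : x ^ α * (b - x ^ (N' - α) * c) = y := by
      rw [mul_sub, ← hyw, ← mul_assoc, ← pow_add, Nat.add_sub_cancel' (by omega), add_sub_cancel_right]
    rwa [this]
  have h7 := h4 _ _ h6
  have h8 : b = (b - x ^ (N' - α) * c) + x ^ (N' - α) * c := by ring
  rw [h8]
  refine add_mem (Ideal.mem_sup_left ?_) (Ideal.mem_sup_right ?_)
  · exact Ideal.pow_le_pow_right hN' (ofList_pow_le l N' h7)
  · refine Ideal.mul_mem_right _ _ (Ideal.pow_mem_of_mem _ (mem_span_singleton_self x) _ (by omega))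

open PowerSeries

lemma separates_powerSeries {p : ℕ} {A : Type u} [CommRing A] {xs : List A}
    (h : Separates p xs) : Separates p (xs.map (C : A → A⟦X⟧) ++ [X]) := by
  intro E _ k hk hne a ha
  by_contra h0
  obtain ⟨b, hb⟩ : X ^ a.order.toNat ∣ a := X_pow_order_dvd
  have hb0 : constantCoeff b ≠ 0 := by
    intro h1
    have h2 : coeff a.order.toNat a = 0 :=
      (congrArg (coeff _) hb).trans (by rw [coeff_self_X_pow_mul, h1])
    exact coeff_order h0 h2
  apply hb0
  set x : E := k X
  set π := Ideal.Quotient.mk (span {x})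
  have hl : ((p : E) :: (xs.map (C : A → A⟦X⟧) ++ [X]).map k) =
      ((p : E) :: xs.map (k.comp C)) ++ [x] := by
    simp [x, Function.comp_def]
  rw [hl] at hk hne
  have hl' : ((p : E ⧸ span {x}) :: xs.map ((π.comp k).comp C)) =
      ((p : E) :: xs.map (k.comp C)).map π := by
    simp [Function.comp_def]
  refine h (E ⧸ span {x}) ((π.comp k).comp C) ?_ ?_ (constantCoeff b) fun N => ?_
  · rw [hl']
    intro l' hl'
    obtain ⟨l, h2, hl2⟩ := (congrFun (congrFun (List.eq_map_comp_perm (⇑π)) l') _).mpr hl'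
    rw [h2]
    have h1 := hk (x :: l) ((hl2.cons x).trans (List.perm_append_singleton _ _).symm)
    rw [← wreg_comap Ideal.Quotient.mk_surjective]
    have h2 : Ideal.comap π ⊥ = ⊥ ⊔ span {x} := by
      rw [bot_sup_eq, ← RingHom.ker_eq_comap_bot, Ideal.mk_ker]
    rw [h2]
    exact h1.2
  · rw [hl', ← map_ofList']
    intro h1
    apply hne
    rw [ofList_append, ofList_singleton]
    have h2 := congrArg (Ideal.comap π) h1
    rwa [comap_map_of_surjective π Ideal.Quotient.mk_surjective, Ideal.comap_top,
      ← RingHom.ker_eq_comap_bot, Ideal.mk_ker] at h2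
  · have h1 : ∀ N, x ^ a.order.toNat * k b ∈ ofList (((p : E) :: xs.map (k.comp C)) ++ [x]) ^ N := by
      intro N
      have := ha N
      rw [hl] at this
      rwa [hb, map_mul, map_pow] at this
    have h2 := mem_sup_of_pow_mul_mem (hk _ (List.Perm.refl _)) h1 N
    have h3 : ((π.comp k).comp C) (constantCoeff b) = π (k b) := by
      rw [RingHom.comp_apply, RingHom.comp_apply, Ideal.Quotient.eq, ← map_sub, mem_span_singleton]
      refine map_dvd k ?_
      rw [X_dvd_iff]
      simp
    rw [h3, hl', ← map_ofList', ← Ideal.map_pow]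
    have h4 := Ideal.mem_map_of_mem π h2
    rw [Ideal.map_sup] at h4
    have h5 : (span {x}).map π = ⊥ := Ideal.map_quotient_self _
    rwa [h5, sup_bot_eq] at h4

lemma separates_witt {p : ℕ} [Fact p.Prime] {K : Type u} [Field K] [CharP K p] [PerfectRing K p] :
    Separates p ([] : List (WittVector p K)) := by
  intro E _ k hk hne a ha
  by_contra h0
  obtain ⟨α, u, hu⟩ := WittVector.exists_eq_pow_p_mul' a h0
  have h1 := hk _ (List.Perm.refl _)
  simp only [List.map_nil, ofList_singleton] at h1 hne ha
  have h2 : ∀ m (c : E), (p : E) ^ m * c = 0 → c = 0 := by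
    intro m
    induction m with
    | zero => simp
    | succ m ih =>
      intro c hc
      rw [pow_succ, mul_assoc] at hc
      exact h1.1 c (by simpa using ih _ hc)
  have h3 := ha (α + 1)
  rw [span_singleton_pow, mem_span_singleton, hu, map_mul, map_pow, map_natCast] at h3
  obtain ⟨c, hc⟩ := h3
  have h4 : k u - p * c = 0 := h2 α _ (by rw [mul_sub, hc]; ring)
  apply hne
  rw [span_singleton_eq_top]
  refine isUnit_of_dvd_unit (Dvd.intro c (sub_eq_zero.mp h4).symm) (u.isUnit.map k)

end Separated

end BigCM

namespace BigCM

open Ideal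

section BaseRings

open PowerSeries

/-- `A` behaves like the power series ring in the variables `xs` over the Witt vectors of the
perfect field `K`, and `S` like the power series ring over `K` in the variables `t` and `ss`;
`σ` sends each variable of `A` to the Teichmüller lift of the corresponding variable of `S`. -/
structure IsBase (p : ℕ) [Fact p.Prime] (K : Type u) [Field K] (n : ℕ) (A : Type u) [CommRing A]
    (S : Type u) [CommRing S] (t : S) (ss : List S) (xs : List A) (σ : A →+* WittVector p S) :
    Prop where
  isDomain : IsDomain A
  isNoetherianRing : IsNoetherianRing A
  isIntegrallyClosed : IsIntegrallyClosed A
  charZero : CharZero A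
  exists_maximalIdeal : ∃ _ : IsLocalRing A, IsLocalRing.maximalIdeal A = ofList ((p : A) :: xs)
  length_eq : xs.length = n
  charP : CharP S p
  wreg : ∀ l' : List S, l'.Perm ss → WReg ⊥ (t :: l')
  exists_residue : ∃ ε : S →+* K, ε t = 0 ∧ ∀ s ∈ ss, ε s = 0
  map_eq : xs.map σ = ss.map (WittVector.teichmuller p)
  separates : Separates p xs
  exists_hom : ∀ (R : Type u) [CommRing R] (I : Ideal R) [IsAdicComplete I R] (e : K →+* R ⧸ I),
    (p : R) ∈ I → Function.Surjective e → ∀ ys : List R, ys.length = n → (∀ y ∈ ys, y ∈ I) →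
    ∃ φ : A →+* R, xs.map φ = ys ∧ ∀ r, ∃ a, r - φ a ∈ I
  finite : ∀ (R : Type u) [CommRing R] [IsNoetherianRing R] (I : Ideal R) (φ : A →+* R),
    I ≤ (⊥ : Ideal R).jacobson → (p : R) ∈ I → (∀ x ∈ xs, φ x ∈ I) → (∀ r, ∃ a, r - φ a ∈ I) →
    (∃ N, I ^ N ≤ ofList ((p : R) :: xs.map φ)) → φ.Finite

lemma wreg_insert {B : Type*} [CommRing B] {x : B} (hx : DC (⊥ : Ideal B) x) {a b : List B}
    (h : WReg ⊥ (x :: (a ++ b))) : WReg ⊥ (a ++ x :: b) := by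
  rw [← List.cons_append, wreg_append] at h
  have h2 := h.1.front_to_last hx
  have h1 : a ++ x :: b = (a ++ [x]) ++ b := by simp
  rw [h1, wreg_append]
  refine ⟨h2, ?_⟩
  have h3 : ofList (a ++ [x]) = ofList (x :: a) := by
    rw [ofList_append, ofList_cons, ofList_cons, ofList_nil, sup_bot_eq, sup_comm]
  rw [h3]
  exact h.2

lemma wreg_powerSeries {S : Type*} [CommRing S] {t : S} {ss : List S}
    (h : ∀ l' : List S, l'.Perm ss → WReg ⊥ (t :: l')) {l' : List S⟦X⟧}
    (hl : l'.Perm (ss.map C ++ [X])) : WReg ⊥ (C t :: l') := by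
  obtain ⟨a, b, rfl⟩ := List.append_of_mem (hl.symm.subset (by simp : X ∈ ss.map C ++ [X]))
  have h1 : (a ++ b).Perm (ss.map C) :=
    (List.perm_middle.symm.trans (hl.trans (List.perm_append_singleton _ _))).cons_inv
  obtain ⟨l, h2, hl2⟩ := (congrFun (congrFun (List.eq_map_comp_perm (⇑(C : S →+* S⟦X⟧))) _) _).mpr h1
  rw [← List.cons_append]
  refine wreg_insert dc_X ?_
  rw [List.cons_append, h2]
  refine ⟨fun b hb => ?_, ?_⟩
  · rw [Ideal.mem_bot] at hb ⊢
    ext n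
    have := congrArg (coeff (n + 1)) hb
    rwa [coeff_succ_X_mul, map_zero] at this
  · have h3 : ⊥ ⊔ span {(X : S⟦X⟧)} = Ideal.comap constantCoeff (⊥ : Ideal S) := by
      rw [bot_sup_eq]
      ext f
      rw [mem_span_singleton, X_dvd_iff, Ideal.mem_comap, Ideal.mem_bot]
    rw [h3, wreg_comap constantCoeff_surj]
    have h4 : (C t :: l.map C).map (constantCoeff : S⟦X⟧ →+* S) = t :: l := by
      simp [Function.comp_def]
    rw [h4]
    exact h l hl2

lemma charP_powerSeries {p : ℕ} (S : Type*) [CommRing S] [CharP S p] : CharP S⟦X⟧ p :=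
  charP_of_injective_ringHom C_injective p

variable {p : ℕ} [Fact p.Prime]

lemma iInf_pow_dvd_eq_zero {R : Type*} [CommRing R] [IsNoetherianRing R] {I : Ideal R}
    (hI : I ≤ (⊥ : Ideal R).jacobson) {y : R} (hy : y ∈ I) {r : R} (h : ∀ n, y ^ n ∣ r) :
    r = 0 := by
  have h1 := Ideal.iInf_pow_smul_eq_bot_of_le_jacobson (M := R) I hI
  rw [← Submodule.mem_bot (R := R), ← h1, Submodule.mem_iInf]
  intro n
  rw [smul_eq_mul, mul_top]
  exact Ideal.mem_of_dvd _ (h n) (Ideal.pow_mem_pow hy n)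

lemma charZero_witt (K : Type*) [Field K] [CharP K p] [PerfectRing K p] :
    CharZero (WittVector p K) := by
  obtain ⟨q, hq⟩ := CharP.exists (WittVector p K)
  rcases CharP.char_is_prime_or_zero (WittVector p K) q with h | rfl
  · exfalso
    have h1 : (q : K) = 0 := by
      have := congrArg WittVector.constantCoeff (CharP.cast_eq_zero (WittVector p K) q)
      rwa [map_natCast, map_zero] at this
    have h2 := (Nat.prime_dvd_prime_iff_eq Fact.out h).mp ((CharP.cast_eq_zero_iff K p q).mp h1)
    subst h2
    exact (WittVector.irreducible p (k := K)).ne_zero (CharP.cast_eq_zero _ p)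
  · exact CharP.charP_to_charZero _

theorem isBase_zero (K : Type u) [Field K] [CharP K p] [PerfectRing K p] :
    IsBase p K 0 (WittVector p K) K⟦X⟧ X [] []
      (WittVector.map (C : K →+* K⟦X⟧)) where
  isDomain := inferInstance
  isNoetherianRing := inferInstance
  isIntegrallyClosed := inferInstance
  charZero := charZero_witt K
  exists_maximalIdeal := ⟨inferInstance, by
    rw [ofList_singleton]
    exact (WittVector.irreducible p).maximalIdeal_eq⟩
  length_eq := rfl
  charP := charP_powerSeries K
  wreg l' hl := by
    rw [List.perm_nil] at hl
    subst hl
    refine ⟨fun b hb => ?_, trivial⟩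
    rw [Ideal.mem_bot] at hb ⊢
    exact (mul_eq_zero.mp hb).resolve_left X_ne_zero
  exists_residue := ⟨constantCoeff, constantCoeff_X, by simp⟩
  map_eq := rfl
  separates := separates_witt
  exists_hom R _ I _ e hp he ys hys _ := by
    obtain ⟨θ, hθ⟩ := exists_witt_lift I e hp
    refine ⟨θ, (List.length_eq_zero_iff.mp hys).symm, fun r => ?_⟩
    obtain ⟨a, ha⟩ := he (Ideal.Quotient.mk I r)
    refine ⟨WittVector.teichmuller p a, ?_⟩
    rw [← Ideal.Quotient.eq, hθ, WittVector.teichmuller_coeff_zero, ha]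
  finite R _ _ I φ hI hp _ hφ hN := by
    obtain ⟨N, hN⟩ := hN
    rw [List.map_nil, ofList_singleton] at hN
    obtain ⟨k, s, hs⟩ := exists_approx φ I (IsNoetherian.noetherian I) hφ N
    refine finite_of_adic (p : WittVector p K) φ (fun r hr => ?_) s fun y => ?_
    · rw [map_natCast] at hr
      exact iInf_pow_dvd_eq_zero hI hp hr
    · obtain ⟨c, hc⟩ := hs y
      refine ⟨c, ?_⟩
      rw [map_natCast]
      exact mem_span_singleton.mp (hN hc)

theorem IsBase.succ {K : Type u} [Field K] {n : ℕ} {A : Type u} [CommRing A] {S : Type u}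
    [CommRing S] {t : S} {ss : List S} {xs : List A} {σ : A →+* WittVector p S}
    (h : IsBase p K n A S t ss xs σ) {σ' : A⟦X⟧ →+* WittVector p S⟦X⟧}
    (hC : ∀ a, σ' (C a) = WittVector.map (C : S →+* S⟦X⟧) (σ a))
    (hX : σ' X = WittVector.teichmuller p X) :
    IsBase p K (n + 1) A⟦X⟧ S⟦X⟧ (C t) (ss.map C ++ [X]) (xs.map C ++ [X]) σ' := by
  have := h.isDomain
  have := h.isNoetherianRing
  have := h.isIntegrallyClosed
  have := h.charZero
  have := h.charP
  obtain ⟨hloc, hmax⟩ := h.exists_maximalIdeal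
  exact
  { isDomain := inferInstance
    isNoetherianRing := inferInstance
    isIntegrallyClosed := inferInstance
    charZero := charZero_of_injective_ringHom (C_injective (R := A))
    exists_maximalIdeal := ⟨inferInstance, by
      rw [maximalIdeal_powerSeries _ hmax]
      simp⟩
    length_eq := by simp [h.length_eq]
    charP := charP_powerSeries S
    wreg := fun l' hl => wreg_powerSeries h.wreg hl
    exists_residue := by
      obtain ⟨ε, h1, h2⟩ := h.exists_residue
      refine ⟨ε.comp constantCoeff, by simpa using h1, fun s hs => ?_⟩
      rw [List.mem_append, List.mem_map, List.mem_singleton] at hs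
      rcases hs with ⟨a, ha, rfl⟩ | rfl
      · simpa using h2 a ha
      · simp
    map_eq := by
      rw [List.map_append, List.map_append, List.map_singleton, List.map_singleton, hX,
        List.map_map, List.map_map]
      congr 1
      have h1 : ⇑σ' ∘ ⇑(C : A →+* A⟦X⟧) = ⇑(WittVector.map (C : S →+* S⟦X⟧)) ∘ ⇑σ := funext hC
      have h2 : ⇑(WittVector.teichmuller p) ∘ ⇑(C : S →+* S⟦X⟧) =
          ⇑(WittVector.map (C : S →+* S⟦X⟧)) ∘ ⇑(WittVector.teichmuller p) :=
        funext fun s => (WittVector.map_teichmuller ..).symm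
      rw [h1, h2, ← List.map_map, ← List.map_map, h.map_eq]
    separates := separates_powerSeries h.separates
    exists_hom := fun R _ I _ e hp he ys hys hI => by
      have hne : ys ≠ [] := by
        rintro rfl
        simp at hys
      obtain ⟨φ, h1, h2⟩ := h.exists_hom R I e hp he ys.dropLast (by simp [hys])
        fun y hy => hI y (List.mem_of_mem_dropLast hy)
      obtain ⟨Φ, h3, h4⟩ := exists_powerSeries_hom_of_isAdicComplete I φ
        (hI _ (List.getLast_mem hne))
      refine ⟨Φ, ?_, fun r => ?_⟩
      · have h5 : ⇑Φ ∘ ⇑(C : A →+* A⟦X⟧) = ⇑φ := funext h3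
        rw [List.map_append, List.map_map, h5, h1, List.map_singleton, h4,
          List.dropLast_append_getLast]
      · obtain ⟨a, ha⟩ := h2 r
        exact ⟨C a, by rwa [h3]⟩
    finite := fun R _ _ I φ hI hp hxs hφ hN => by
      have hX : φ X ∈ I := hxs _ (by simp)
      set π := Ideal.Quotient.mk (span {φ X})
      have hπ : Function.Surjective π := Ideal.Quotient.mk_surjective
      have hC : ∀ f : A⟦X⟧, ∃ r, φ f = φ (C (constantCoeff f)) + φ X * r := by
        intro f
        obtain ⟨g, hg⟩ : X ∣ f - C (constantCoeff f) := by
          rw [X_dvd_iff]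
          simp
        refine ⟨φ g, ?_⟩
        rw [← map_mul, ← hg, map_sub, add_sub_cancel]
      have hfin : ((π.comp φ).comp C).Finite := by
        refine h.finite _ (I.map π) _ ?_ ?_ ?_ ?_ ?_
        · intro x hx
          obtain ⟨y, hy, rfl⟩ := (Ideal.mem_map_iff_of_surjective π hπ).mp hx
          rw [Ideal.mem_jacobson_bot]
          intro z
          obtain ⟨w, rfl⟩ := hπ z
          rw [← map_mul, ← map_one π, ← map_add]
          exact (Ideal.mem_jacobson_bot.mp (hI hy) w).map π
        · rw [← map_natCast π]
          exact Ideal.mem_map_of_mem _ hp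
        · intro x hx
          exact Ideal.mem_map_of_mem _ (hxs _
            (List.mem_append_left _ (List.mem_map_of_mem hx)))
        · intro r
          obtain ⟨r, rfl⟩ := hπ r
          obtain ⟨f, hf⟩ := hφ r
          obtain ⟨r', hr'⟩ := hC f
          refine ⟨constantCoeff f, ?_⟩
          rw [RingHom.comp_apply, RingHom.comp_apply, ← map_sub]
          refine Ideal.mem_map_of_mem _ ?_
          have : r - φ (C (constantCoeff f)) = (r - φ f) + φ X * r' := by
            rw [hr']
            ring
          rw [this]
          exact add_mem hf (Ideal.mul_mem_right _ _ hX)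
        · obtain ⟨N, hN⟩ := hN
          refine ⟨N, ?_⟩
          rw [← Ideal.map_pow]
          refine (Ideal.map_mono hN).trans ?_
          rw [map_ofList']
          refine span_le.mpr fun z hz => ?_
          simp only [List.map_cons, List.map_append, List.map_map, Set.mem_ofPred_eq,
            List.mem_cons, List.mem_append, List.mem_map, List.map_nil, List.not_mem_nil,
            or_false] at hz
          rcases hz with rfl | ⟨x, hx, rfl⟩ | rfl
          · rw [map_natCast]
            exact mem_ofList List.mem_cons_self
          · exact mem_ofList (List.mem_cons_of_mem _ (List.mem_map.mpr ⟨x, hx, rfl⟩))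
          · rw [Ideal.Quotient.eq_zero_iff_mem.mpr (mem_span_singleton_self _)]
            exact zero_mem _
      let := ((π.comp φ).comp C).toAlgebra
      have hfin' : Module.Finite A (R ⧸ span {φ X}) := hfin
      obtain ⟨k, s, hs⟩ := Module.Finite.exists_fin (R := A) (M := R ⧸ span {φ X})
      choose s' hs' using fun i => hπ (s i)
      refine finite_of_adic (X : A⟦X⟧) φ (fun r hr => iInf_pow_dvd_eq_zero hI hX hr) s' fun y => ?_
      have h1 : π y ∈ Submodule.span A (Set.range s) := hs ▸ Submodule.mem_top
      obtain ⟨c, hc⟩ := (Submodule.mem_span_range_iff_exists_fun A).mp h1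
      refine ⟨fun i => C (c i), ?_⟩
      rw [← mem_span_singleton, ← Ideal.Quotient.eq]
      refine hc.symm.trans ?_
      rw [map_sum]
      refine Finset.sum_congr rfl fun i _ => ?_
      rw [map_mul, hs', Algebra.smul_def]
      rfl }

theorem exists_isBase (K : Type u) [Field K] [CharP K p] [PerfectRing K p] (n : ℕ) :
    ∃ (A : Type u) (_ : CommRing A) (S : Type u) (_ : CommRing S) (t : S) (ss : List S)
      (xs : List A) (σ : A →+* WittVector p S), IsBase p K n A S t ss xs σ := by
  induction n with
  | zero => exact ⟨_, _, _, _, _, _, _, _, isBase_zero K⟩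
  | succ n ih =>
    obtain ⟨A, _, S, _, t, ss, xs, σ, h⟩ := ih
    obtain ⟨σ', hC, hX, -⟩ := exists_witt_powerSeries_hom σ
    exact ⟨_, _, _, _, _, _, _, _, h.succ hC hX⟩

end BaseRings

end BigCM

namespace BigCM

open Ideal

section Assembly

open PowerSeries

variable {p : ℕ} [Fact p.Prime]

lemma exists_list_perm_map {α β : Type*} (f : α → β) {l : List α} {l' : List β}
    (h : l'.Perm (l.map f)) : ∃ k : List α, l' = k.map f ∧ k.Perm l := by
  obtain ⟨k, h1, h2⟩ := (congrFun (congrFun (List.eq_map_comp_perm f) l') l).mpr h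
  exact ⟨k, h1, h2⟩

lemma wreg_perfectClosure {S : Type*} [CommRing S] [CharP S p] {l : List S} (h : WReg ⊥ l) :
    WReg ⊥ (l.map (PerfectClosure.of S p)) :=
  wreg_of_isPerfectClosure p (PerfectClosure.of S p) (isPerfectClosure_of S).1
    (isPerfectClosure_of S).2 h

/-- Regular sequences in compatible algebras over a module-finite extension `R` of a power series
ring `A⟦X⟧` and over `R ⧸ Q`, where `Q` is a prime of `R` lying over `(X)`. -/
theorem IsBase.exists_wreg {K : Type u} [Field K] [CharP K p] [PerfectRing K p] {n : ℕ}
    {A S : Type u} [CommRing A] [CommRing S] {t : S} {ss : List S} {xs : List A}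
    {σ : A →+* WittVector p S} (h : IsBase p K n A S t ss xs σ) {R : Type u} [CommRing R]
    [IsDomain R] [Algebra A⟦X⟧ R] [Module.Finite A⟦X⟧ R] [FaithfulSMul A⟦X⟧ R] (Q : Ideal R)
    [Q.IsPrime] (hQ : Q.comap (algebraMap A⟦X⟧ R) = span {X}) :
    ∃ (B B' : Type u) (_ : CommRing B) (_ : CommRing B') (ρ : R →+* B) (ρ' : R ⧸ Q →+* B')
      (G : B →+* B'), (∀ r, G (ρ r) = ρ' (Ideal.Quotient.mk Q r)) ∧
      WReg ⊥ (((p : A⟦X⟧) :: xs.map C ++ [X]).map (ρ ∘ algebraMap A⟦X⟧ R)) ∧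
      WReg ⊥ (((p : A⟦X⟧) :: xs.map C).map (G ∘ ρ ∘ algebraMap A⟦X⟧ R)) ∧
      ofList (((p : A⟦X⟧) :: xs.map C).map (G ∘ ρ ∘ algebraMap A⟦X⟧ R)) ≠ ⊤ := by
  classical
  obtain ⟨σ', hC, hX, hσ'⟩ := exists_witt_powerSeries_hom σ
  have h' := h.succ hC hX
  have := h.isDomain
  have := h.isNoetherianRing
  have := h.isIntegrallyClosed
  have := h.charZero
  have := h.charP
  have := h'.isDomain
  have := h'.isNoetherianRing
  have := h'.isIntegrallyClosed
  have := h'.charZero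
  have := h'.charP
  have hker : RingHom.ker (constantCoeff : A⟦X⟧ →+* A) = span {X} := by
    ext a
    rw [RingHom.mem_ker, mem_span_singleton, X_dvd_iff]
  have hsurj : Function.Surjective (constantCoeff : A⟦X⟧ →+* A) := fun a =>
    ⟨C a, constantCoeff_C a⟩
  obtain ⟨T, hT⟩ := (inferInstance : Algebra.FiniteType A⟦X⟧ R).out
  obtain ⟨O, _, _, _, _, P, _, ι, z, e, hP, hιQ, hz, he, heP, hSe⟩ :=
    exists_generator (constantCoeff : A⟦X⟧ →+* A) X X_ne_zero hker Q hQ T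
  let ϑ : PerfectClosure S⟦X⟧ p →+* PerfectClosure S p := PerfectClosure.lift _ p _
    ((PerfectClosure.of S p).comp constantCoeff)
  have hϑ : ϑ.comp (PerfectClosure.of S⟦X⟧ p) = (PerfectClosure.of S p).comp constantCoeff :=
    (PerfectClosure.lift _ p _).symm_apply_apply _
  have hϑ' : ∀ s, ϑ (PerfectClosure.of S⟦X⟧ p s) = PerfectClosure.of S p (constantCoeff s) :=
    fun s => RingHom.congr_fun hϑ s
  have hxs : (((ss.map (C : S →+* S⟦X⟧)).map (PerfectClosure.of S⟦X⟧ p)).map ϑ) =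
      ss.map (PerfectClosure.of S p) := by
    simp [hϑ', Function.comp_def]
  refine exists_bigCM_of_generator (constantCoeff : A⟦X⟧ →+* A) hsurj P hP ι Q hιQ hz he heP T hT
    hSe (PerfectClosure.of S⟦X⟧ p (C t))
    ((Ideal.Quotient.mk _).comp ((WittVector.map (PerfectClosure.of S⟦X⟧ p)).comp σ'))
    (PerfectClosure.of S p t)
    ((Ideal.Quotient.mk _).comp ((WittVector.map (PerfectClosure.of S p)).comp σ)) ϑ
    (by rw [hϑ', constantCoeff_C]) ?_ ((ss.map C).map (PerfectClosure.of S⟦X⟧ p))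
    (PerfectClosure.of S⟦X⟧ p X) (xs.map C) X ?_ ?_ ?_ ?_ ?_ ?_
  · ext a
    have h1 := RingHom.congr_fun hσ' a
    simp only [RingHom.comp_apply] at h1 ⊢
    rw [untiltMap_mk, ← h1]
    exact congrArg _ (WittVector.ext fun i => by simp only [WittVector.map_coeff, hϑ'])
  · have h1 := congrArg (List.map ((WittVector.map (C : S →+* S⟦X⟧)))) h.map_eq
    rw [List.map_map, List.map_map] at h1
    have h2 : (xs.map (C : A →+* A⟦X⟧)).map σ' =
        (ss.map (C : S →+* S⟦X⟧)).map (WittVector.teichmuller p) := by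
      rw [List.map_map, List.map_map]
      refine Eq.trans (List.map_congr_left fun a _ => ?_) (h1.trans
        (List.map_congr_left fun a _ => ?_))
      · exact hC a
      · exact WittVector.map_teichmuller _ _ _
    have h3 := congrArg (List.map ((Ideal.Quotient.mk (span {(p : WittVector p
      (PerfectClosure S⟦X⟧ p)) - WittVector.teichmuller p
        (PerfectClosure.of S⟦X⟧ p (C t))})).comp (WittVector.map (PerfectClosure.of S⟦X⟧ p)))) h2
    rw [List.map_map] at h3
    refine h3.trans ?_
    rw [List.map_map]
    refine (List.map_congr_left fun a _ => ?_).trans List.map_map.symm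
    simp only [Function.comp_apply, RingHom.comp_apply, tau_apply]
    rw [WittVector.map_teichmuller]
  · simp only [RingHom.comp_apply, tau_apply]
    rw [hX, WittVector.map_teichmuller]
  · have h1 := wreg_perfectClosure (p := p) (h'.wreg _ (List.Perm.refl _))
    simpa using h1
  · rw [hxs]
    intro l' hl'
    obtain ⟨k, rfl, hk⟩ := exists_list_perm_map _ hl'
    exact wreg_perfectClosure (h.wreg k hk)
  · rw [hxs]
    obtain ⟨ε, hε, hε'⟩ := h.exists_residue
    have h1 : (PerfectClosure.lift _ p K ε).comp (PerfectClosure.of S p) = ε :=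
      (PerfectClosure.lift _ p K).symm_apply_apply ε
    have h2 : ∀ s, PerfectClosure.lift _ p K ε (PerfectClosure.of S p s) = ε s :=
      fun s => RingHom.congr_fun h1 s
    intro htop
    have h3 : ofList (PerfectClosure.of S p t :: ss.map (PerfectClosure.of S p)) ≤
        RingHom.ker (PerfectClosure.lift _ p K ε) := by
      refine span_le.mpr fun x hx => ?_
      rw [SetLike.mem_coe, RingHom.mem_ker]
      rcases List.mem_cons.mp hx with rfl | hx
      · rw [h2, hε]
      · obtain ⟨s, hs, rfl⟩ := List.mem_map.mp hx
        rw [h2, hε' s hs]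
    rw [htop, top_le_iff] at h3
    exact RingHom.ker_ne_top _ h3
  · have h1 : (xs.map (C : A →+* A⟦X⟧)).map (constantCoeff : A⟦X⟧ →+* A) = xs := by
      simp [Function.comp_def]
    rw [h1]
    exact h.separates

end Assembly

end BigCM

namespace BigCM

open Ideal IsLocalRing

open scoped Pointwise

section Dimension

lemma ringKrullDim_le_of_le_radical_map {A R : Type*} [CommRing A] [IsNoetherianRing A]
    [IsLocalRing A] [CommRing R] [IsNoetherianRing R] [IsLocalRing R] (f : A →+* R)
    (h : maximalIdeal A ≤ (maximalIdeal R).comap f)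
    (hrad : maximalIdeal R ≤ ((maximalIdeal A).map f).radical) :
    ringKrullDim R ≤ ringKrullDim A := by
  algebraize [f]
  have h1 : maximalIdeal A = (maximalIdeal R).comap f :=
    (maximalIdeal.isMaximal A).eq_of_le (comap_ne_top _ (maximalIdeal.isMaximal R).ne_top) h
  have : (maximalIdeal R).LiesOver (maximalIdeal A) := ⟨h1⟩
  have h2 := height_le_height_add_of_liesOver (maximalIdeal A) (maximalIdeal R)
  have hle : (maximalIdeal A).map (algebraMap A R) ≤ maximalIdeal R := map_le_iff_le_comap.mpr h
  have : ((maximalIdeal R).map (Ideal.Quotient.mk ((maximalIdeal A).map (algebraMap A R)))).IsPrime :=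
    isPrime_map_quotientMk_of_isPrime hle
  have h3 : ((maximalIdeal R).map
      (Ideal.Quotient.mk ((maximalIdeal A).map (algebraMap A R)))).height = 0 := by
    rw [height_eq_zero_iff]
    refine ⟨⟨inferInstance, bot_le⟩, fun J hJ _ => ?_⟩
    have := hJ.1
    refine map_le_iff_le_comap.mpr fun x hx => ?_
    obtain ⟨k, hk⟩ := hrad hx
    refine hJ.1.mem_of_pow_mem k ?_
    have hk' : Ideal.Quotient.mk ((maximalIdeal A).map (algebraMap A R)) (x ^ k) = 0 :=
      Ideal.Quotient.eq_zero_iff_mem.mpr hk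
    rw [← map_pow, hk']
    exact zero_mem _
  rw [h3, add_zero] at h2
  rw [← maximalIdeal_height_eq_ringKrullDim, ← maximalIdeal_height_eq_ringKrullDim]
  exact_mod_cast h2

lemma ringKrullDim_le_length {A : Type*} [CommRing A] [IsNoetherianRing A] [IsLocalRing A]
    {l : List A} (h : maximalIdeal A = ofList l) : ringKrullDim A ≤ (l.length : WithBot ℕ∞) := by
  classical
  refine (ringKrullDim_le_spanFinrank_maximalIdeal A).trans ?_
  rw [h]
  have h1 : ofList l = span (l.toFinset : Set A) := by
    rw [ofList, List.coe_toFinset]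
  have h2 := Submodule.spanFinrank_span_le_ncard_of_finite (R := A) (l.toFinset.finite_toSet)
  rw [Set.ncard_coe_finset] at h2
  rw [h1]
  exact_mod_cast h2.trans (List.toFinset_card_le l)

lemma ringKrullDim_quotient_span_singleton_succ_le {R : Type*} [CommRing R] [IsNoetherianRing R]
    {x : R} (hx : ∀ P ∈ minimalPrimes R, x ∉ P) :
    ringKrullDim (R ⧸ span {x}) + 1 ≤ ringKrullDim R := by
  have h : span {x} = x • (⊤ : Ideal R) := by simp [← Submodule.ideal_span_singleton_smul]
  have h0 : Module.annihilator R R = ⊥ := by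
    rw [Module.annihilator_eq_bot]
    infer_instance
  have h1 := Module.supportDim_quotSMulTop_succ_le_of_notMem_minimalPrimes (R := R) (M := R) (x := x)
    (by rw [h0]; exact hx)
  rw [Module.supportDim_self_eq_ringKrullDim] at h1
  rwa [ringKrullDim_eq_of_ringEquiv (quotientEquivAlgOfEq R h).toRingEquiv,
    ← Module.supportDim_quotient_eq_ringKrullDim]

/-- Lifting a system of parameters along a surjection. -/
lemma exists_lift_params {R R' : Type*} [CommRing R] [IsLocalRing R] [CommRing R']
    [IsNoetherianRing R'] [IsLocalRing R'] (f : R →+* R') (hf : Function.Surjective f) :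
    ∃ ys : List R, (∀ y ∈ ys, y ∈ maximalIdeal R) ∧
      (ys.length : WithBot ℕ∞) = ringKrullDim R' ∧
      maximalIdeal R ≤ (ofList ys ⊔ RingHom.ker f).radical := by
  obtain ⟨T, hT, hT'⟩ := exists_finset_card_eq_height_of_isNoetherianRing (maximalIdeal R')
  have hloc : IsLocalHom f := IsLocalHom.of_surjective f hf
  choose g hg using hf
  have hmap : (T.toList.map g).map f = T.toList := by simp [Function.comp_def, hg]
  refine ⟨T.toList.map g, fun y hy => ?_, ?_, fun x hx => ?_⟩
  · obtain ⟨b, hb, rfl⟩ := List.mem_map.mp hy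
    have h1 : b ∈ maximalIdeal R' := hT.1.2 (subset_span (by simpa using hb))
    rw [mem_maximalIdeal, mem_nonunits_iff] at h1 ⊢
    intro h2
    exact h1 (hg b ▸ h2.map f)
  · rw [← maximalIdeal_height_eq_ringKrullDim, ← hT']
    simp
  · have h1 : f x ∈ maximalIdeal R' := by
      rw [mem_maximalIdeal, mem_nonunits_iff] at hx ⊢
      exact fun h2 => hx (isUnit_of_map_unit f x h2)
    have h2 : f x ∈ (ofList T.toList).radical := by
      rw [radical_eq_sInf, Submodule.mem_sInf]
      rintro J ⟨hJ, hJ'⟩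
      refine hT.2 ⟨hJ', ?_⟩ (le_maximalIdeal hJ'.ne_top) h1
      simpa [ofList] using hJ
    obtain ⟨k, hk⟩ := h2
    refine ⟨k, ?_⟩
    rw [← hmap, ← map_ofList', ← map_pow] at hk
    have := mem_comap.mpr hk
    rwa [comap_map_of_surjective f (fun b => ⟨g b, hg b⟩), ← RingHom.ker_eq_comap_bot] at this

/-- A system of parameters starting with a given element outside the height one prime `Q` and
ending with an element of `Q`. -/
lemma exists_params {R : Type*} [CommRing R] [IsDomain R] [IsNoetherianRing R] [IsLocalRing R]
    (Q : Ideal R) [Q.IsPrime] (hht : Q.height = 1) {π : R} (hπ : π ∈ maximalIdeal R)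
    (hπQ : π ∉ Q) :
    ∃ (ys : List R) (s : R), s ∈ Q ∧ (∀ y ∈ ys, y ∈ maximalIdeal R) ∧
      (ys.length : WithBot ℕ∞) + 2 ≤ ringKrullDim R ∧
      maximalIdeal R ≤ (ofList ((π :: ys) ++ [s])).radical := by
  have hπ0 : π ≠ 0 := by
    rintro rfl
    exact hπQ (zero_mem _)
  obtain ⟨s, hsQ, hs⟩ : ∃ s ∈ Q, ∀ P ∈ (span {π}).minimalPrimes, s ∉ P := by
    by_contra! hcon
    have hfin := (span {π}).finite_minimalPrimes_of_isNoetherianRing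
    have hsub : (Q : Set R) ⊆ ⋃ P ∈ (span {π}).minimalPrimes, (P : Set R) := by
      intro s hs
      obtain ⟨P, hP, hsP⟩ := hcon s hs
      exact Set.mem_biUnion hP hsP
    obtain ⟨P, hP, hQP⟩ := (subset_union_prime_finite hfin ⊥ ⊥
      (fun P hP _ _ => hP.1.1)).mp hsub
    have := hP.1.1
    have h1 : P.height ≤ 1 := height_le_one_of_isPrincipal_of_mem_minimalPrimes (span {π}) P hP
    have h2 : Q = P := by
      have : Q.FiniteHeight := inferInstance
      exact eq_of_le_of_height_le _ hQP (by rw [hht]; exact h1)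
    exact hπQ (h2 ▸ hP.1.2 (mem_span_singleton_self π))
  have hsm : s ∈ maximalIdeal R := le_maximalIdeal (IsPrime.ne_top ‹Q.IsPrime›) hsQ
  let g := Ideal.Quotient.mk (span {π})
  let f : R →+* (R ⧸ span {π}) ⧸ span {g s} := (Ideal.Quotient.mk _).comp g
  have hf : Function.Surjective f :=
    Ideal.Quotient.mk_surjective.comp Ideal.Quotient.mk_surjective
  have hker : RingHom.ker f ≤ ofList [π, s] := by
    intro x hx
    rw [RingHom.mem_ker, RingHom.comp_apply, Ideal.Quotient.eq_zero_iff_mem,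
      mem_span_singleton'] at hx
    obtain ⟨a, ha⟩ := hx
    obtain ⟨a, rfl⟩ := Ideal.Quotient.mk_surjective a
    rw [← map_mul, Ideal.Quotient.eq, mem_span_singleton'] at ha
    obtain ⟨b, hb⟩ := ha
    have h1 : x = a * s - b * π := by rw [hb]; ring
    rw [h1]
    exact sub_mem (mul_mem_left _ _ (mem_ofList (by simp)))
      (mul_mem_left _ _ (mem_ofList (by simp)))
  have hker' : RingHom.ker f ≤ maximalIdeal R := by
    refine hker.trans (span_le.mpr fun x hx => ?_)
    simp only [Set.mem_ofPred_eq, List.mem_cons, List.not_mem_nil, or_false] at hx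
    rcases hx with rfl | rfl
    · exact hπ
    · exact hsm
  have : Nontrivial ((R ⧸ span {π}) ⧸ span {g s}) := by
    refine ⟨f 1, 0, fun h => ?_⟩
    exact (maximalIdeal.isMaximal R).ne_top ((eq_top_iff_one _).mpr (hker' h))
  have : IsLocalRing ((R ⧸ span {π}) ⧸ span {g s}) := IsLocalRing.of_surjective' f hf
  obtain ⟨ys, hys, hlen, hrad⟩ := exists_lift_params f hf
  refine ⟨ys, s, hsQ, hys, ?_, hrad.trans (radical_mono (sup_le ?_ (hker.trans ?_)))⟩
  · have h1 := ringKrullDim_quotient_span_singleton_succ_le (x := g s) (by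
      intro P hP hsP
      have h3 : P.comap g ∈ (span {π}).minimalPrimes := by
        have h4 := comap_minimalPrimes_eq_of_surjective
          (f := g) Ideal.Quotient.mk_surjective ⊥
        rw [← RingHom.ker_eq_comap_bot, mk_ker] at h4
        rw [h4]
        exact ⟨P, hP, rfl⟩
      exact hs _ h3 hsP)
    have h2 := ringKrullDim_quotient_succ_le_of_nonZeroDivisor
      (mem_nonZeroDivisors_of_ne_zero hπ0)
    rw [hlen]
    refine le_trans ?_ h2
    rw [← one_add_one_eq_two, ← add_assoc]
    gcongr
  · exact span_mono fun x hx => by simp at hx ⊢; tauto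
  · exact span_mono fun x hx => by simp at hx ⊢; tauto

end Dimension

end BigCM

namespace BigCM

open Ideal IsLocalRing

section Main

variable {p : ℕ} [Fact p.Prime]

lemma IsBase.ringKrullDim_le {K : Type u} [Field K] {n : ℕ} {A S : Type u} [CommRing A]
    [CommRing S] {t : S} {ss : List S} {xs : List A} {σ : A →+* WittVector p S}
    (h : IsBase p K n A S t ss xs σ) : ringKrullDim A ≤ n + 1 := by
  obtain ⟨_, hm⟩ := h.exists_maximalIdeal
  have := h.isNoetherianRing
  have h1 := ringKrullDim_le_length hm
  rw [List.length_cons, h.length_eq] at h1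
  exact_mod_cast h1

/-- A homomorphism from a base ring to a domain of the same dimension, sending the parameters to a
system of parameters, is injective. -/
lemma IsBase.injective {K : Type u} [Field K] {n : ℕ} {A S : Type u} [CommRing A]
    [CommRing S] {t : S} {ss : List S} {xs : List A} {σ : A →+* WittVector p S}
    (h : IsBase p K n A S t ss xs σ) {R : Type u} [CommRing R] [IsDomain R] [IsNoetherianRing R]
    [IsLocalRing R] (hdim : (n : WithBot ℕ∞) + 1 ≤ ringKrullDim R) (φ : A →+* R)
    (hφ : ∀ x ∈ (p : A) :: xs, φ x ∈ maximalIdeal R)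
    (hrad : maximalIdeal R ≤ (ofList (((p : A) :: xs).map φ)).radical) :
    Function.Injective φ := by
  obtain ⟨_, hm⟩ := h.exists_maximalIdeal
  have := h.isNoetherianRing
  have := h.isDomain
  rw [injective_iff_map_eq_zero]
  intro a ha
  by_contra ha0
  have hnt : Nontrivial (A ⧸ RingHom.ker φ) :=
    Ideal.Quotient.nontrivial_iff.mpr (RingHom.ker_ne_top φ)
  have : IsLocalRing (A ⧸ RingHom.ker φ) :=
    IsLocalRing.of_surjective' (Ideal.Quotient.mk _) Ideal.Quotient.mk_surjective
  have hmq : maximalIdeal (A ⧸ RingHom.ker φ) =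
      (maximalIdeal A).map (Ideal.Quotient.mk (RingHom.ker φ)) := by
    refine (eq_maximalIdeal ?_).symm
    refine (map_eq_top_or_isMaximal_of_surjective _ Ideal.Quotient.mk_surjective
      (maximalIdeal.isMaximal A)).resolve_left fun htop => ?_
    have h1 := comap_map_of_surjective (Ideal.Quotient.mk (RingHom.ker φ))
      Ideal.Quotient.mk_surjective (maximalIdeal A)
    rw [htop, comap_top, ← RingHom.ker_eq_comap_bot, mk_ker, sup_eq_left.mpr
      (le_maximalIdeal (RingHom.ker_ne_top φ))] at h1
    exact (maximalIdeal.isMaximal A).ne_top h1.symm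
  have h1 : ringKrullDim R ≤ ringKrullDim (A ⧸ RingHom.ker φ) := by
    refine ringKrullDim_le_of_le_radical_map (RingHom.kerLift φ) ?_ ?_
    · rw [hmq, hm, map_le_iff_le_comap, comap_comap]
      exact span_le.mpr hφ
    · rw [hmq, map_map]
      have h2 : (RingHom.kerLift φ).comp (Ideal.Quotient.mk (RingHom.ker φ)) = φ := by
        ext x
        rfl
      rw [h2, hm, map_ofList']
      exact hrad
  have h2 := ringKrullDim_succ_le_of_surjective (Ideal.Quotient.mk (RingHom.ker φ))
    Ideal.Quotient.mk_surjective (mem_nonZeroDivisors_of_ne_zero ha0)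
    (Ideal.Quotient.eq_zero_iff_mem.mpr ha)
  have h3 : (n : WithBot ℕ∞) + 1 + 1 ≤ n + 1 :=
    (add_le_add_left (hdim.trans h1) 1).trans (h2.trans h.ringKrullDim_le)
  have h4 : n + 1 + 1 ≤ n + 1 := by exact_mod_cast h3
  omega

open PowerSeries in
lemma ringKrullDim_powerSeries_le {A : Type*} [CommRing A] [IsNoetherianRing A⟦X⟧]
    [IsLocalRing A⟦X⟧] : ringKrullDim A⟦X⟧ ≤ ringKrullDim A + 1 := by
  have hX : (X : A⟦X⟧) ∈ maximalIdeal A⟦X⟧ := by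
    rw [mem_maximalIdeal, mem_nonunits_iff]
    intro h
    have h1 := h.map (constantCoeff : A⟦X⟧ →+* A)
    rw [constantCoeff_X] at h1
    have : Nontrivial A := 
      ⟨1, 0, fun h0 => one_ne_zero (α := A⟦X⟧) (by rw [← map_one C, h0, map_zero])⟩
    exact not_isUnit_zero h1
  have h1 := height_le_ringKrullDim_quotient_add_one hX
  rw [maximalIdeal_height_eq_ringKrullDim] at h1
  refine h1.trans ?_
  gcongr
  refine ringKrullDim_le_of_surjective ((Ideal.Quotient.mk (span {X})).comp C) fun x => ?_
  obtain ⟨a, rfl⟩ := Ideal.Quotient.mk_surjective x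
  refine ⟨constantCoeff a, ?_⟩
  rw [RingHom.comp_apply, Ideal.Quotient.eq, mem_span_singleton, X_dvd_iff]
  simp

open PowerSeries in
/-- The dimension of `R ⧸ Q` for a prime `Q` over `(X)` in a module-finite extension of a power
series ring over a normal domain. -/
lemma ringKrullDim_le_quotient_succ {A R : Type*} [CommRing A] [IsDomain A] [IsLocalRing A]
    [IsNoetherianRing A] [IsIntegrallyClosed A] [CommRing R] [IsNoetherianRing R] [IsLocalRing R]
    (φ : A⟦X⟧ →+* R) (hφ : φ.Finite) (Q : Ideal R) [Q.IsPrime] (hQ : Q.comap φ = span {X}) :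
    ringKrullDim A ≤ ringKrullDim (R ⧸ Q) := by
  let ψ : A →+* R ⧸ Q := (Ideal.Quotient.mk Q).comp (φ.comp C)
  have hψ : ψ.comp constantCoeff = (Ideal.Quotient.mk Q).comp φ := by
    ext a
    simp only [ψ, RingHom.comp_apply]
    rw [Ideal.Quotient.eq, ← map_sub, ← mem_comap, hQ, mem_span_singleton, X_dvd_iff]
    simp
  have hfin : ψ.Finite := by
    refine RingHom.Finite.of_comp_finite (f := (constantCoeff : A⟦X⟧ →+* A)) ?_
    rw [hψ]
    exact (RingHom.Finite.of_surjective _ Ideal.Quotient.mk_surjective).comp hφ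
  have hinj : Function.Injective ψ := by
    rw [injective_iff_map_eq_zero]
    intro a ha
    have h1 : C a ∈ Q.comap φ := mem_comap.mpr (Ideal.Quotient.eq_zero_iff_mem.mp ha)
    rw [hQ, mem_span_singleton, X_dvd_iff, constantCoeff_C] at h1
    exact h1
  have : IsLocalRing (R ⧸ Q) :=
    IsLocalRing.of_surjective' (Ideal.Quotient.mk Q) Ideal.Quotient.mk_surjective
  algebraize [ψ]
  have : FaithfulSMul A (R ⧸ Q) := (faithfulSMul_iff_algebraMap_injective A (R ⧸ Q)).mpr hinj
  have : Module.Finite A (R ⧸ Q) := hfin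
  have hmax : ((maximalIdeal (R ⧸ Q)).comap (algebraMap A (R ⧸ Q))).IsMaximal :=
    isMaximal_comap_of_isIntegral_of_isMaximal _
  have : (maximalIdeal (R ⧸ Q)).LiesOver (maximalIdeal A) := ⟨(eq_maximalIdeal hmax).symm⟩
  have h1 := height_eq_height_add_of_liesOver_of_hasGoingDown (maximalIdeal A)
    (maximalIdeal (R ⧸ Q))
  rw [← maximalIdeal_height_eq_ringKrullDim, ← maximalIdeal_height_eq_ringKrullDim, h1]
  exact_mod_cast le_self_add

lemma eq_natCast_of_add_one_eq {a : WithBot ℕ∞} {n : ℕ} (h : a + 1 = (n + 1 : ℕ)) : a = n := by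
  induction a with
  | bot =>
    rw [WithBot.bot_add] at h
    exact absurd h (WithBot.bot_ne_coe (a := ((n + 1 : ℕ) : ℕ∞)))
  | coe a =>
    induction a with
    | top =>
      have h1 : (⊤ : ℕ∞) + 1 = ((n + 1 : ℕ) : ℕ∞) := WithBot.coe_injective h
      rw [top_add] at h1
      exact absurd h1 (ENat.top_ne_natCast _)
    | coe a =>
      have h1 : a + 1 = n + 1 := by exact_mod_cast h
      rw [Nat.add_right_cancel h1]
      rfl

lemma isSOP_of_le_radical {R : Type*} [CommRing R] [IsLocalRing R] {l : List R}
    (hl : ∀ x ∈ l, x ∈ maximalIdeal R) (hdim : (l.length : WithBot ℕ∞) = ringKrullDim R)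
    (hrad : maximalIdeal R ≤ (ofList l).radical) : IsSOP R l :=
  ⟨hl, hdim, le_antisymm ((maximalIdeal.isMaximal R).isPrime.radical_le_iff.mpr
    (span_le.mpr hl)) hrad⟩

lemma isSOP_quotient {R : Type*} [CommRing R] [IsLocalRing R] {Q : Ideal R}
    [IsLocalRing (R ⧸ Q)] {l : List R} {s : R} (hs : s ∈ Q)
    (hl : ∀ x ∈ l, x ∈ maximalIdeal R) (hdim : (l.length : WithBot ℕ∞) = ringKrullDim (R ⧸ Q))
    (hrad : maximalIdeal R ≤ (ofList (l ++ [s])).radical) :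
    IsSOP (R ⧸ Q) (l.map (Ideal.Quotient.mk Q)) := by
  have hloc : IsLocalHom (Ideal.Quotient.mk Q) :=
    IsLocalHom.of_surjective _ Ideal.Quotient.mk_surjective
  refine isSOP_of_le_radical (fun x hx => ?_) (by simpa using hdim) fun x hx => ?_
  · obtain ⟨y, hy, rfl⟩ := List.mem_map.mp hx
    have h1 := hl y hy
    rw [mem_maximalIdeal, mem_nonunits_iff] at h1 ⊢
    exact fun h2 => h1 (isUnit_of_map_unit _ y h2)
  · obtain ⟨x, rfl⟩ := Ideal.Quotient.mk_surjective x
    have h1 : x ∈ maximalIdeal R := by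
      rw [mem_maximalIdeal, mem_nonunits_iff] at hx ⊢
      exact fun h2 => hx (h2.map _)
    obtain ⟨k, hk⟩ := hrad h1
    refine ⟨k, ?_⟩
    have h2 := mem_map_of_mem (Ideal.Quotient.mk Q) hk
    rw [map_ofList', List.map_append, ofList_append, List.map_singleton,
      Ideal.Quotient.eq_zero_iff_mem.mpr hs, map_pow] at h2
    simpa [ofList_singleton] using h2

lemma comap_eq_span_singleton {A R : Type*} [CommRing A] [IsDomain A] [IsIntegrallyClosed A]
    [IsNoetherianRing A] [CommRing R] [IsDomain R] [IsNoetherianRing R] [Algebra A R]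
    [FaithfulSMul A R] [Module.Finite A R] (Q : Ideal R) [Q.IsPrime] (hht : Q.height = 1) {x : A}
    (hx : x ≠ 0) [(span {x}).IsPrime] (hxQ : algebraMap A R x ∈ Q) :
    Q.comap (algebraMap A R) = span {x} := by
  have : Q.LiesOver (Q.comap (algebraMap A R)) := ⟨rfl⟩
  have h1 := height_eq_height_add_of_liesOver_of_hasGoingDown (Q.comap (algebraMap A R)) Q
  have h2 : (Q.comap (algebraMap A R)).height ≤ 1 := by
    rw [← hht, h1]
    exact le_self_add
  have h3 : span {x} ≤ Q.comap (algebraMap A R) :=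
    (span_singleton_le_iff_mem _).mpr hxQ
  exact (eq_of_le_of_height_le _ h3 (h2.trans (one_le_height_span_singleton_of_mem_nonZeroDivisors
    (mem_nonZeroDivisors_of_ne_zero hx)))).symm

open PowerSeries in
theorem exists_bigCM_of_charP (R : Type u) [CommRing R] [IsDomain R] [IsNoetherianRing R]
    [IsLocalRing R] [IsAdicComplete (maximalIdeal R) R] [IsAlgClosed (ResidueField R)]
    [CharP (ResidueField R) p] (Q : Ideal R) [Q.IsPrime] (hht : Q.height = 1) (hpQ : (p : R) ∉ Q)
    [IsLocalRing (R ⧸ Q)] :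
    ∃ (B : Type u) (C : Type u) (_ : CommRing B) (_ : CommRing C) (_ : Algebra R B)
      (_ : Algebra (R ⧸ Q) C) (f : B →+* C),
      IsBalancedBigCM R B ∧ IsBalancedBigCM (R ⧸ Q) C ∧
      ∀ r : R, f (algebraMap R B r) = algebraMap (R ⧸ Q) C (Ideal.Quotient.mk Q r) := by
  have hpm : (p : R) ∈ maximalIdeal R := by
    rw [← residue_eq_zero_iff, map_natCast, CharP.cast_eq_zero]
  obtain ⟨ys, s, hs, hys, hdim, hrad⟩ := exists_params Q hht hpm hpQ
  have hsm : s ∈ maximalIdeal R := le_maximalIdeal (IsPrime.ne_top ‹Q.IsPrime›) hs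
  have : PerfectRing (ResidueField R) p := PerfectField.toPerfectRing p
  obtain ⟨A, _, S, _, t, ss, xs, σ, h⟩ :=
    exists_isBase (p := p) (ResidueField R) ys.length
  obtain ⟨σ', hC, hX, -⟩ := exists_witt_powerSeries_hom σ
  have h' := h.succ hC hX
  obtain ⟨φ, hφ, hφ'⟩ := h'.exists_hom R (maximalIdeal R) (RingHom.id (R ⧸ maximalIdeal R)) hpm
    Function.surjective_id (ys ++ [s]) (by simp) (by
      intro y hy
      rcases List.mem_append.mp hy with hy | hy
      · exact hys y hy
      · rw [List.mem_singleton.mp hy]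
        exact hsm)
  have hlist : ((p : A⟦X⟧) :: (xs.map (C : A →+* A⟦X⟧) ++ [X])).map φ = ((p : R) :: ys) ++ [s] := by
    rw [List.map_cons, hφ, map_natCast, List.cons_append]
  have hmem : ∀ x ∈ (p : A⟦X⟧) :: (xs.map (C : A →+* A⟦X⟧) ++ [X]), φ x ∈ maximalIdeal R := by
    intro x hx
    have h1 : φ x ∈ ((p : R) :: ys) ++ [s] := hlist ▸ List.mem_map_of_mem hx
    simp only [List.mem_append, List.mem_cons, List.not_mem_nil, or_false] at h1
    rcases h1 with (h1 | h1) | h1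
    · rw [h1]
      exact hpm
    · exact hys _ h1
    · rw [h1]
      exact hsm
  have hfin : φ.Finite := by
    refine h'.finite R (maximalIdeal R) φ (maximalIdeal_le_jacobson _) hpm
      (fun x hx => hmem x (List.mem_cons_of_mem _ hx)) hφ' ?_
    rw [hφ]
    exact exists_pow_le_of_le_radical_of_fg hrad (IsNoetherian.noetherian _)
  have hinj : Function.Injective φ := by
    refine h'.injective ?_ φ hmem (by rw [hlist]; exact hrad)
    rw [Nat.cast_add, Nat.cast_one, add_assoc, one_add_one_eq_two]
    exact hdim
  obtain ⟨_, hmA⟩ := h.exists_maximalIdeal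
  obtain ⟨_, hmA'⟩ := h'.exists_maximalIdeal
  have := h.isDomain
  have := h.isNoetherianRing
  have := h.isIntegrallyClosed
  have := h'.isDomain
  have := h'.isNoetherianRing
  have := h'.isIntegrallyClosed
  have hrA : ringKrullDim R ≤ ringKrullDim A⟦X⟧ := by
    refine ringKrullDim_le_of_le_radical_map φ ?_ ?_
    · rw [hmA']
      exact span_le.mpr hmem
    · rw [hmA', map_ofList', hlist]
      exact hrad
  have hdimR : ((ys.length + 2 : ℕ) : WithBot ℕ∞) = ringKrullDim R := by
    refine le_antisymm (by exact_mod_cast hdim) (hrA.trans (h'.ringKrullDim_le.trans ?_))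
    exact_mod_cast le_rfl
  algebraize [φ]
  have : FaithfulSMul A⟦X⟧ R := (faithfulSMul_iff_algebraMap_injective A⟦X⟧ R).mpr hinj
  have : Module.Finite A⟦X⟧ R := hfin
  have hXprime : (span {(X : A⟦X⟧)}).IsPrime := span_X_isPrime
  have hφX : φ X = s := by
    have h1 := hlist
    rw [List.map_cons, List.map_append, ← List.cons_append] at h1
    have h2 := (List.append_inj' h1 rfl).2
    simpa using h2
  have hφC : (xs.map (C : A →+* A⟦X⟧)).map φ = ys := by
    rw [List.map_append] at hφ
    exact (List.append_inj' hφ rfl).1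
  have hQ : Q.comap (algebraMap A⟦X⟧ R) = span {X} :=
    comap_eq_span_singleton Q hht X_ne_zero (by
      rw [RingHom.algebraMap_toAlgebra, hφX]
      exact hs)
  have hdimQ : ringKrullDim (R ⧸ Q) = (ys.length + 1 : ℕ) := by
    have hs0 : s ≠ 0 := by
      rw [← hφX]
      exact (map_ne_zero_iff φ hinj).mpr X_ne_zero
    refine eq_natCast_of_add_one_eq (le_antisymm ?_ ?_)
    · rw [hdimR]
      exact ringKrullDim_succ_le_of_surjective (Ideal.Quotient.mk Q) Ideal.Quotient.mk_surjective
        (mem_nonZeroDivisors_of_ne_zero hs0) (Ideal.Quotient.eq_zero_iff_mem.mpr hs)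
    · rw [hdimR]
      refine hrA.trans (ringKrullDim_powerSeries_le.trans ?_)
      gcongr
      exact ringKrullDim_le_quotient_succ φ hfin Q hQ
  obtain ⟨B, B', _, _, ρ, ρ', G, hG, hB, hB', htop⟩ := h.exists_wreg Q hQ
  have e1 : ((p : A⟦X⟧) :: xs.map C ++ [X]).map (ρ ∘ algebraMap A⟦X⟧ R) =
      (((p : R) :: ys) ++ [s]).map ρ := by
    rw [← hlist, List.map_map]
    rfl
  have e2 : ((p : A⟦X⟧) :: xs.map C).map (G ∘ ρ ∘ algebraMap A⟦X⟧ R) =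
      ((p : R) :: ys).map (G ∘ ρ) := by
    rw [← hφC, ← map_natCast φ p, ← List.map_cons, List.map_map]
    rfl
  rw [e1] at hB
  rw [e2] at hB' htop
  refine exists_bigCM_of_wreg Q ((p : R) :: ys) s hs
    (isSOP_of_le_radical ?_ (by rw [← hdimR]; simp [add_assoc, one_add_one_eq_two]) hrad)
    (isSOP_quotient hs ?_ (by rw [hdimQ]; simp) hrad) B B' ρ ρ' G hG hB hB' htop
  · simpa [or_imp, forall_and] using ⟨hpm, hys, hsm⟩
  · simpa using ⟨hpm, hys⟩

end Main

end BigCM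

/-- Weakly functorial big Cohen-Macaulay algebras: if `(R, 𝔪, k)` is a complete Noetherian
local domain with `k` algebraically closed, `Q ⊆ R` is a height one prime, and both `R` and
`R ⧸ Q` have mixed characteristic, then there are balanced big Cohen-Macaulay algebras `B` for
`R` and `C` for `R ⧸ Q` fitting in a commutative square with `R → R ⧸ Q`. -/
theorem exists_weakly_functorial_bigCM (R : Type u) [CommRing R] [IsDomain R]
    [IsNoetherianRing R] [IsLocalRing R]
    (hcomplete : IsAdicComplete (IsLocalRing.maximalIdeal R) R)
    (halgclosed : IsAlgClosed (IsLocalRing.ResidueField R))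
    (Q : Ideal R) [Q.IsPrime]
    (hht : ringKrullDim (Localization.AtPrime Q) = (1 : WithBot ℕ∞))
    (hmixedR : MixedCharLocal R) :
    letI : IsLocalRing (R ⧸ Q) :=
      IsLocalRing.of_surjective' (Ideal.Quotient.mk Q) Ideal.Quotient.mk_surjective
    MixedCharLocal (R ⧸ Q) →
      ∃ (B : Type u) (C : Type u) (_ : CommRing B) (_ : CommRing C) (_ : Algebra R B)
        (_ : Algebra (R ⧸ Q) C) (f : B →+* C),
        IsBalancedBigCM R B ∧ IsBalancedBigCM (R ⧸ Q) C ∧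
        ∀ r : R, f (algebraMap R B r) = algebraMap (R ⧸ Q) C (Ideal.Quotient.mk Q r) := by
  have : IsLocalRing (R ⧸ Q) :=
    IsLocalRing.of_surjective' (Ideal.Quotient.mk Q) Ideal.Quotient.mk_surjective
  intro hmixedQ
  obtain ⟨-, p, hp, hchar⟩ := hmixedR
  have : CharZero (R ⧸ Q) := hmixedQ.1
  have : Fact p.Prime := ⟨(CharP.char_is_prime_or_zero (IsLocalRing.ResidueField R) p).resolve_right hp.ne'⟩
  have hQ : Q.height = 1 := by
    rw [IsLocalization.AtPrime.ringKrullDim_eq_height Q] at hht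
    exact_mod_cast hht
  refine BigCM.exists_bigCM_of_charP (p := p) R Q hQ fun hpQ => ?_
  rw [← Ideal.Quotient.eq_zero_iff_mem, map_natCast, Nat.cast_eq_zero] at hpQ
  exact hp.ne' hpQ
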